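/- The space S_{24,2}(Γ₂,ε) has dimension 2 over ℂ. -/

import Mathlib

noncomputable section

open Matrix Complex Filter Topology

/-- The standard symplectic form matrix of size 4. -/
def J4 : Matrix (Fin 4) (Fin 4) ℤ := !![0,0,1,0; 0,0,0,1; -1,0,0,0; 0,-1,0,0]

/-- The Siegel modular group `Γ₂ = Sp(4,ℤ)`, as a set of 4×4 integer matrices. -/
def Sp4Z : Set (Matrix (Fin 4) (Fin 4) ℤ) := {γ | γᵀ * J4 * γ = J4}

/-- The principal congruence subgroup `Γ₂[2]` of level 2. -/
def Sp4Z2 : Set (Matrix (Fin 4) (Fin 4) ℤ) :=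
  {γ | γ ∈ Sp4Z ∧ ∀ i j, ((γ i j : ZMod 2) = if i = j then 1 else 0)}

/-- The Siegel upper half space of degree 2: symmetric 2×2 complex matrices with
positive definite imaginary part (encoded as functions `Fin 2 → Fin 2 → ℂ`). -/
def H2 : Set (Fin 2 → Fin 2 → ℂ) :=
  {τ | (Matrix.of τ).IsSymm ∧ (Matrix.of fun i j => (τ i j).im).PosDef}

/-- The four 2×2 blocks of a 4×4 integer matrix, as complex matrices. -/
def blk (γ : Matrix (Fin 4) (Fin 4) ℤ) (r s : Fin 2) : Matrix (Fin 2) (Fin 2) ℂ :=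
  Matrix.of fun i j =>
    ((γ ⟨2 * (r : ℕ) + (i : ℕ), by have h1 := r.isLt; have h2 := i.isLt; omega⟩
        ⟨2 * (s : ℕ) + (j : ℕ), by have h1 := s.isLt; have h2 := j.isLt; omega⟩ : ℤ) : ℂ)

/-- The factor `cτ + d`. -/
def den (γ : Matrix (Fin 4) (Fin 4) ℤ) (τ : Fin 2 → Fin 2 → ℂ) : Matrix (Fin 2) (Fin 2) ℂ :=
  blk γ 1 0 * Matrix.of τ + blk γ 1 1

/-- The action `γ·τ = (aτ+b)(cτ+d)⁻¹` of `Sp(4)` on the Siegel upper half space. -/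
def moeb (γ : Matrix (Fin 4) (Fin 4) ℤ) (τ : Fin 2 → Fin 2 → ℂ) : Fin 2 → Fin 2 → ℂ :=
  fun i j => ((blk γ 0 0 * Matrix.of τ + blk γ 0 1) * (den γ τ)⁻¹) i j

/-- Matrix coefficients of the `j`-th symmetric power of the standard representation of
`GL(2,ℂ)`, in the basis `x₁^(j-i) x₂^i`. -/
def symCoeff (j : ℕ) (m : Matrix (Fin 2) (Fin 2) ℂ) (l i : Fin (j + 1)) : ℂ :=
  (((Polynomial.C (m 0 0) + Polynomial.C (m 1 0) * Polynomial.X) ^ (j - (l : ℕ)) *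
    (Polynomial.C (m 0 1) + Polynomial.C (m 1 1) * Polynomial.X) ^ (l : ℕ)).coeff i)

/-- The `j`-th symmetric power `Sym^j(m)` acting on coordinate vectors. -/
def symAct (j : ℕ) (m : Matrix (Fin 2) (Fin 2) ℂ) (v : Fin (j + 1) → ℂ) : Fin (j + 1) → ℂ :=
  fun i => ∑ l, symCoeff j m l i * v l

lemma symAct_add (j : ℕ) (m : Matrix (Fin 2) (Fin 2) ℂ) (v w : Fin (j + 1) → ℂ) :
    symAct j m (v + w) = symAct j m v + symAct j m w := by
  funext i
  simp [symAct, mul_add, Finset.sum_add_distrib]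

lemma symAct_smul (j : ℕ) (m : Matrix (Fin 2) (Fin 2) ℂ) (a : ℂ) (v : Fin (j + 1) → ℂ) :
    symAct j m (a • v) = a • symAct j m v := by
  funext i
  simp only [symAct, Pi.smul_apply, smul_eq_mul, Finset.mul_sum]
  exact Finset.sum_congr rfl fun l _ => by ring

lemma symAct_zero (j : ℕ) (m : Matrix (Fin 2) (Fin 2) ℂ) : symAct j m 0 = 0 := by
  funext i; simp [symAct]

/-- The weight `(j,k)` automorphy action `Sym^j(m) ⊗ det(m)^k`. -/
def wt (j : ℕ) (k : ℤ) (m : Matrix (Fin 2) (Fin 2) ℂ) (v : Fin (j + 1) → ℂ) :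
    Fin (j + 1) → ℂ :=
  (m.det ^ k) • symAct j m v

lemma wt_add (j : ℕ) (k : ℤ) (m : Matrix (Fin 2) (Fin 2) ℂ) (v w : Fin (j + 1) → ℂ) :
    wt j k m (v + w) = wt j k m v + wt j k m w := by
  simp [wt, symAct_add, smul_add]

lemma wt_smul (j : ℕ) (k : ℤ) (m : Matrix (Fin 2) (Fin 2) ℂ) (a : ℂ) (v : Fin (j + 1) → ℂ) :
    wt j k m (a • v) = a • wt j k m v := by
  rw [wt, wt, symAct_smul, smul_comm]

lemma wt_zero (j : ℕ) (k : ℤ) (m : Matrix (Fin 2) (Fin 2) ℂ) : wt j k m 0 = 0 := by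
  simp [wt, symAct_zero]

/-- The slash operation `(F|γ)(τ) = Sym^j(cτ+d)⁻¹ det(cτ+d)⁻ᵏ F(γ·τ)`. -/
def slashS (j : ℕ) (k : ℤ) (γ : Matrix (Fin 4) (Fin 4) ℤ)
    (F : (Fin 2 → Fin 2 → ℂ) → (Fin (j + 1) → ℂ)) (τ : Fin 2 → Fin 2 → ℂ) :
    Fin (j + 1) → ℂ :=
  ((den γ τ).det ^ (-k)) • symAct j ((den γ τ)⁻¹) (F (moeb γ τ))

lemma slashS_add (j : ℕ) (k : ℤ) (γ : Matrix (Fin 4) (Fin 4) ℤ)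
    (F G : (Fin 2 → Fin 2 → ℂ) → (Fin (j + 1) → ℂ)) (τ : Fin 2 → Fin 2 → ℂ) :
    slashS j k γ (F + G) τ = slashS j k γ F τ + slashS j k γ G τ := by
  simp [slashS, symAct_add, smul_add]

lemma slashS_smul (j : ℕ) (k : ℤ) (γ : Matrix (Fin 4) (Fin 4) ℤ) (a : ℂ)
    (F : (Fin 2 → Fin 2 → ℂ) → (Fin (j + 1) → ℂ)) (τ : Fin 2 → Fin 2 → ℂ) :
    slashS j k γ (a • F) τ = a • slashS j k γ F τ := by
  simp only [slashS, Pi.smul_apply, symAct_smul]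
  rw [smul_comm]

lemma slashS_zero (j : ℕ) (k : ℤ) (γ : Matrix (Fin 4) (Fin 4) ℤ) (τ : Fin 2 → Fin 2 → ℂ) :
    slashS j k γ (0 : (Fin 2 → Fin 2 → ℂ) → (Fin (j + 1) → ℂ)) τ = 0 := by
  simp [slashS, symAct_zero]

/-- The diagonal point `diag(τ₁,τ₂)` of the Siegel upper half space. -/
def diagH (τ₁ τ₂ : ℂ) : Fin 2 → Fin 2 → ℂ :=
  fun i j => if i = j then (if i = 0 then τ₁ else τ₂) else 0

/-- `F` is a Siegel cusp form of degree 2 and weight `(j,k)` on `Γ`, with character `χ`: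
holomorphic on `ℍ₂`, transforming by `F(γ·τ) = χ(γ) Sym^j(cτ+d) det(cτ+d)^k F(τ)` for `γ ∈ Γ`,
with `(F|γ)(diag(τ₁,it)) → 0` as `t → ∞` for every `γ ∈ Γ₂`, and (normalization) vanishing
off `ℍ₂`. -/
def IsSiegelCuspForm (j : ℕ) (k : ℤ) (Γ : Set (Matrix (Fin 4) (Fin 4) ℤ))
    (χ : Matrix (Fin 4) (Fin 4) ℤ → ℂ)
    (F : (Fin 2 → Fin 2 → ℂ) → (Fin (j + 1) → ℂ)) : Prop :=
  DifferentiableOn ℂ F H2 ∧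
  (∀ γ ∈ Γ, ∀ τ ∈ H2, F (moeb γ τ) = χ γ • wt j k (den γ τ) (F τ)) ∧
  (∀ γ ∈ Sp4Z, ∀ τ₁ : ℂ, 0 < τ₁.im →
    Tendsto (fun t : ℝ => slashS j k γ F (diagH τ₁ (t * Complex.I))) atTop (𝓝 0)) ∧
  (∀ τ, τ ∉ H2 → F τ = 0)

/-- The space `S_{j,k}(Γ, χ)` of Siegel cusp forms of degree 2 and weight `(j,k)` on `Γ`
with character `χ`, as a complex vector space. -/
def SiegelCusp (j : ℕ) (k : ℤ) (Γ : Set (Matrix (Fin 4) (Fin 4) ℤ))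
    (χ : Matrix (Fin 4) (Fin 4) ℤ → ℂ) :
    Submodule ℂ ((Fin 2 → Fin 2 → ℂ) → (Fin (j + 1) → ℂ)) where
  carrier := {F | IsSiegelCuspForm j k Γ χ F}
  add_mem' := by
    rintro F G hF hG
    refine ⟨hF.1.add hG.1, ?_, ?_, ?_⟩
    · intro γ hγ τ hτ
      show F (moeb γ τ) + G (moeb γ τ) = χ γ • wt j k (den γ τ) (F τ + G τ)
      rw [wt_add, smul_add, hF.2.1 γ hγ τ hτ, hG.2.1 γ hγ τ hτ]
    · intro γ hγ τ₁ hτ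
      have h := (hF.2.2.1 γ hγ τ₁ hτ).add (hG.2.2.1 γ hγ τ₁ hτ)
      rw [add_zero] at h
      exact h.congr fun t => (slashS_add j k γ F G _).symm
    · intro τ hτ
      show F τ + G τ = 0
      rw [hF.2.2.2 τ hτ, hG.2.2.2 τ hτ, add_zero]
  zero_mem' := by
    refine ⟨?_, ?_, ?_, ?_⟩
    · exact differentiableOn_const 0
    · intro γ hγ τ hτ
      show (0 : Fin (j + 1) → ℂ) = χ γ • wt j k (den γ τ) 0
      rw [wt_zero, smul_zero]
    · intro γ hγ τ₁ hτ
      have : (fun t : ℝ => slashS j k γ (0 : (Fin 2 → Fin 2 → ℂ) → (Fin (j + 1) → ℂ))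
          (diagH τ₁ (t * Complex.I))) = fun _ => 0 := by
        funext t; exact slashS_zero j k γ _
      rw [this]
      exact tendsto_const_nhds
    · intro τ _; rfl
  smul_mem' := by
    rintro a F hF
    refine ⟨hF.1.const_smul a, ?_, ?_, ?_⟩
    · intro γ hγ τ hτ
      show a • F (moeb γ τ) = χ γ • wt j k (den γ τ) (a • F τ)
      rw [hF.2.1 γ hγ τ hτ, wt_smul, smul_comm]
    · intro γ hγ τ₁ hτ
      have h := (hF.2.2.1 γ hγ τ₁ hτ).const_smul a
      rw [smul_zero] at h
      exact h.congr fun t => (slashS_smul j k γ a F _).symm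
    · intro τ hτ
      show a • F τ = 0
      rw [hF.2.2.2 τ hτ, smul_zero]

/-- `ε` is (on `Γ₂`) the unique nontrivial homomorphism `Γ₂ → {±1}`. -/
def IsEps (ε : Matrix (Fin 4) (Fin 4) ℤ → ℂ) : Prop :=
  (∀ γ ∈ Sp4Z, ε γ = 1 ∨ ε γ = -1) ∧
  (∀ γ ∈ Sp4Z, ∀ δ ∈ Sp4Z, ε (γ * δ) = ε γ * ε δ) ∧
  (∃ γ ∈ Sp4Z, ε γ ≠ 1)

namespace SG

/-- binary form of degree 24 with coefficient vector v -/
def form (v : Fin 25 → ℂ) (x y : ℂ) : ℂ := ∑ i : Fin 25, v i * (x ^ (24 - (i : ℕ)) * y ^ (i : ℕ))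

lemma form_add (v w : Fin 25 → ℂ) (x y : ℂ) : form (v + w) x y = form v x y + form w x y := by
  simp [form, add_mul, Finset.sum_add_distrib]

lemma form_smul (a : ℂ) (v : Fin 25 → ℂ) (x y : ℂ) : form (a • v) x y = a * form v x y := by
  simp [form, Finset.mul_sum, mul_assoc]

/-- dehomogenized polynomial -/
def pol (v : Fin 25 → ℂ) : Polynomial ℂ := ∑ i : Fin 25, Polynomial.C (v i) * Polynomial.X ^ (i : ℕ)

lemma pol_coeff (v : Fin 25 → ℂ) (i : Fin 25) : (pol v).coeff i = v i := by
  simp only [pol, Polynomial.finsetSum_coeff, Polynomial.coeff_C_mul_X_pow]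
  rw [Finset.sum_eq_single i]
  · simp
  · intro b _ hb
    rw [if_neg]; intro h; exact hb (Fin.ext h.symm)
  · simp

lemma pol_eval (v : Fin 25 → ℂ) (y : ℂ) : (pol v).eval y = form v 1 y := by
  simp [pol, form, Polynomial.eval_finsetSum]

lemma form_ext {v w : Fin 25 → ℂ} (h : ∀ y, form v 1 y = form w 1 y) : v = w := by
  have : pol v = pol w := Polynomial.funext fun y => by rw [pol_eval, pol_eval, h]
  funext i
  rw [← pol_coeff v, this, pol_coeff]

lemma form_hom (v : Fin 25 → ℂ) (t x y : ℂ) : form v (t * x) (t * y) = t ^ 24 * form v x y := by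
  simp only [form, Finset.mul_sum, mul_pow]
  refine Finset.sum_congr rfl fun i _ => ?_
  have : t ^ 24 = t ^ (24 - (i : ℕ)) * t ^ (i : ℕ) := by
    rw [← pow_add]; congr 1; omega
  rw [this]; ring

lemma form_symAct_one (m : Matrix (Fin 2) (Fin 2) ℂ) (v : Fin 25 → ℂ) (y : ℂ) :
    form (symAct 24 m v) 1 y = form v (m 0 0 + m 1 0 * y) (m 0 1 + m 1 1 * y) := by
  simp only [form, symAct, Finset.sum_mul]
  rw [Finset.sum_comm]
  refine Finset.sum_congr rfl fun l _ => ?_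
  set P : Polynomial ℂ := (Polynomial.C (m 0 0) + Polynomial.C (m 1 0) * Polynomial.X) ^ (24 - (l : ℕ)) *
    (Polynomial.C (m 0 1) + Polynomial.C (m 1 1) * Polynomial.X) ^ (l : ℕ) with hP
  have h1 : ∀ a b : ℂ, (Polynomial.C a + Polynomial.C b * Polynomial.X).natDegree ≤ 1 := by
    intro a b; rw [add_comm]; exact Polynomial.natDegree_linear_le
  have hd : P.natDegree < 25 := by
    have : P.natDegree ≤ _ := Polynomial.natDegree_mul_le (p := (Polynomial.C (m 0 0) + Polynomial.C (m 1 0) * Polynomial.X) ^ (24 - (l : ℕ)))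
      (q := (Polynomial.C (m 0 1) + Polynomial.C (m 1 1) * Polynomial.X) ^ (l : ℕ))
    have h2 := Polynomial.natDegree_pow_le_of_le (24 - (l:ℕ)) (h1 (m 0 0) (m 1 0))
    have h3 := Polynomial.natDegree_pow_le_of_le (l:ℕ) (h1 (m 0 1) (m 1 1))
    omega
  have he : P.eval y = (m 0 0 + m 1 0 * y) ^ (24 - (l : ℕ)) * (m 0 1 + m 1 1 * y) ^ (l : ℕ) := by
    simp [hP]
  rw [← he, Polynomial.eval_eq_sum_range' hd, ← Fin.sum_univ_eq_sum_range (fun i => P.coeff i * y ^ i) 25, Finset.mul_sum]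
  refine Finset.sum_congr rfl fun i _ => ?_
  simp only [symCoeff, one_pow, one_mul]
  rw [← hP]; ring

lemma form_cont (v : Fin 25 → ℂ) {f g : ℂ → ℂ} (hf : Continuous f) (hg : Continuous g) :
    Continuous fun x => form v (f x) (g x) := by
  unfold form; fun_prop

lemma form_symAct (m : Matrix (Fin 2) (Fin 2) ℂ) (v : Fin 25 → ℂ) (x y : ℂ) :
    form (symAct 24 m v) x y = form v (m 0 0 * x + m 1 0 * y) (m 0 1 * x + m 1 1 * y) := by
  have h : (fun x => form (symAct 24 m v) x y) =
      fun x => form v (m 0 0 * x + m 1 0 * y) (m 0 1 * x + m 1 1 * y) := by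
    refine Continuous.ext_on (dense_compl_singleton (0 : ℂ)) ?_ ?_ ?_
    · exact form_cont _ (by fun_prop) (by fun_prop)
    · exact form_cont _ (by fun_prop) (by fun_prop)
    · intro x hx
      have hx : x ≠ 0 := hx
      have e1 : form (symAct 24 m v) x y = form (symAct 24 m v) (x * 1) (x * (y / x)) := by
        congr 1
        · ring
        · field_simp
      show form (symAct 24 m v) x y = _
      rw [e1, form_hom, form_symAct_one, ← form_hom]
      congr 1 <;> field_simp
  exact congrFun h x

lemma symAct_mul (m n : Matrix (Fin 2) (Fin 2) ℂ) (v : Fin 25 → ℂ) :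
    symAct 24 (m * n) v = symAct 24 m (symAct 24 n v) := by
  refine form_ext fun y => ?_
  simp only [form_symAct, Matrix.mul_apply, Fin.sum_univ_two]
  congr 1 <;> ring

lemma symAct_one (v : Fin 25 → ℂ) : symAct 24 (1 : Matrix (Fin 2) (Fin 2) ℂ) v = v := by
  refine form_ext fun y => ?_
  simp [form_symAct]

lemma wt_mul (m n : Matrix (Fin 2) (Fin 2) ℂ) (v : Fin 25 → ℂ) :
    wt 24 2 (m * n) v = wt 24 2 m (wt 24 2 n v) := by
  simp only [wt, symAct_mul, symAct_smul, smul_smul, Matrix.det_mul, mul_zpow]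

lemma form_wt (m : Matrix (Fin 2) (Fin 2) ℂ) (v : Fin 25 → ℂ) (x y : ℂ) :
    form (wt 24 2 m v) x y = m.det ^ 2 * form v (m 0 0 * x + m 1 0 * y) (m 0 1 * x + m 1 1 * y) := by
  have : m.det ^ (2 : ℤ) = m.det ^ 2 := by norm_cast
  rw [wt, form_smul, form_symAct, this]

/-- coordinates on the half space -/
def mk (a b d : ℂ) : Fin 2 → Fin 2 → ℂ := ![![a, b], ![b, d]]

lemma mk_mem (a b d : ℂ) : mk a b d ∈ H2 ↔ 0 < a.im ∧ b.im ^ 2 < a.im * d.im := by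
  constructor
  · rintro ⟨_, h⟩
    have h1 := h.diag_pos (i := 0)
    have h2 := h.det_pos
    simp [Matrix.det_fin_two, mk] at h1 h2
    exact ⟨h1, by nlinarith⟩
  · rintro ⟨h1, h2⟩
    refine ⟨?_, ?_⟩
    · ext i j; fin_cases i <;> fin_cases j <;> rfl
    · refine Matrix.PosDef.of_dotProduct_mulVec_pos ?_ ?_
      · ext i j; fin_cases i <;> fin_cases j <;> simp [mk]
      · intro x hx
        simp [dotProduct, Matrix.mulVec, Fin.sum_univ_two, mk]
        by_cases hx1 : x 1 = 0
        · have hx0 : x 0 ≠ 0 := by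
            intro h0; apply hx; ext i; fin_cases i <;> simp [h0, hx1]
          rw [hx1]
          have : 0 < x 0 * x 0 := mul_self_pos.2 hx0
          nlinarith
        · have h3 : 0 < x 1 ^ 2 := by positivity
          have h4 : 0 < a.im * (x 0 * (a.im * x 0 + b.im * x 1) + x 1 * (b.im * x 0 + d.im * x 1)) := by
            nlinarith [sq_nonneg (a.im * x 0 + b.im * x 1)]
          exact (mul_pos_iff_of_pos_left h1).1 h4

lemma eq_mk {τ : Fin 2 → Fin 2 → ℂ} (h : τ ∈ H2) : τ = mk (τ 0 0) (τ 0 1) (τ 1 1) := by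
  have := h.1.apply 0 1
  simp at this
  ext i j; fin_cases i <;> fin_cases j <;> simp [mk, this]

lemma moeb_eq {γ : Matrix (Fin 4) (Fin 4) ℤ} {τ τ' : Fin 2 → Fin 2 → ℂ}
    (hd : (den γ τ).det ≠ 0) (h : blk γ 0 0 * Matrix.of τ + blk γ 0 1 = Matrix.of τ' * den γ τ) :
    moeb γ τ = τ' := by
  funext i j
  simp only [moeb]
  rw [h, Matrix.mul_nonsing_inv_cancel_right _ _ (isUnit_iff_ne_zero.2 hd)]
  rfl

lemma moeb_mul_den {γ : Matrix (Fin 4) (Fin 4) ℤ} {τ : Fin 2 → Fin 2 → ℂ}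
    (hd : (den γ τ).det ≠ 0) :
    Matrix.of (moeb γ τ) * den γ τ = blk γ 0 0 * Matrix.of τ + blk γ 0 1 := by
  have : Matrix.of (moeb γ τ) = (blk γ 0 0 * Matrix.of τ + blk γ 0 1) * (den γ τ)⁻¹ := rfl
  rw [this, Matrix.nonsing_inv_mul_cancel_right _ _ (isUnit_iff_ne_zero.2 hd)]

lemma blk_mul (γ δ : Matrix (Fin 4) (Fin 4) ℤ) (r s : Fin 2) :
    blk (γ * δ) r s = blk γ r 0 * blk δ 0 s + blk γ r 1 * blk δ 1 s := by
  ext i j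
  simp [blk, Matrix.mul_apply, Fin.sum_univ_four, Fin.sum_univ_two]
  ring_nf

lemma den_mul {γ δ : Matrix (Fin 4) (Fin 4) ℤ} {τ : Fin 2 → Fin 2 → ℂ}
    (hd : (den δ τ).det ≠ 0) : den (γ * δ) τ = den γ (moeb δ τ) * den δ τ := by
  conv_rhs => rw [den, Matrix.add_mul, Matrix.mul_assoc, moeb_mul_den hd]
  simp only [den, blk_mul, Matrix.add_mul, Matrix.mul_add, Matrix.mul_assoc]
  abel

lemma moeb_mul {γ δ : Matrix (Fin 4) (Fin 4) ℤ} {τ : Fin 2 → Fin 2 → ℂ}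
    (hd : (den δ τ).det ≠ 0) (hd' : (den γ (moeb δ τ)).det ≠ 0) :
    moeb (γ * δ) τ = moeb γ (moeb δ τ) := by
  apply moeb_eq
  · rw [den_mul hd, Matrix.det_mul]; exact mul_ne_zero hd' hd
  · rw [den_mul hd, ← Matrix.mul_assoc, moeb_mul_den hd', Matrix.add_mul, Matrix.mul_assoc, moeb_mul_den hd]
    simp only [den, blk_mul, Matrix.add_mul, Matrix.mul_add, Matrix.mul_assoc]
    abel

/-- generators -/
def gT : Matrix (Fin 4) (Fin 4) ℤ := !![1,0,1,0; 0,1,0,0; 0,0,1,0; 0,0,0,1]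
def gTi : Matrix (Fin 4) (Fin 4) ℤ := !![1,0,-1,0; 0,1,0,0; 0,0,1,0; 0,0,0,1]
def gS : Matrix (Fin 4) (Fin 4) ℤ := !![0,0,-1,0; 0,1,0,0; 1,0,0,0; 0,0,0,1]
def gW : Matrix (Fin 4) (Fin 4) ℤ := !![0,1,0,0; 1,0,0,0; 0,0,0,1; 0,0,1,0]
def gL : Matrix (Fin 4) (Fin 4) ℤ := !![1,0,0,0; 1,1,0,0; 0,0,1,-1; 0,0,0,1]
def gLi : Matrix (Fin 4) (Fin 4) ℤ := !![1,0,0,0; -1,1,0,0; 0,0,1,1; 0,0,0,1]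

lemma den_gT (a b d : ℂ) : den gT (mk a b d) = 1 := by
  ext i j; fin_cases i <;> fin_cases j <;>
    simp [den, blk, gT, Matrix.mul_apply, Fin.sum_univ_two, mk]

lemma moeb_gT (a b d : ℂ) : moeb gT (mk a b d) = mk (a + 1) b d := by
  apply moeb_eq
  · simp [den_gT]
  · rw [den_gT]
    ext i j; fin_cases i <;> fin_cases j <;>
      simp [blk, gT, Matrix.mul_apply, Fin.sum_univ_two, mk]

lemma den_gTi (a b d : ℂ) : den gTi (mk a b d) = 1 := by
  ext i j; fin_cases i <;> fin_cases j <;>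
    simp [den, blk, gTi, Matrix.mul_apply, Fin.sum_univ_two, mk]

lemma moeb_gTi (a b d : ℂ) : moeb gTi (mk a b d) = mk (a - 1) b d := by
  apply moeb_eq
  · simp [den_gTi]
  · rw [den_gTi]
    ext i j; fin_cases i <;> fin_cases j <;>
      simp [blk, gTi, Matrix.mul_apply, Fin.sum_univ_two, mk, sub_eq_add_neg]

lemma den_gW (a b d : ℂ) : den gW (mk a b d) = !![0, 1; 1, 0] := by
  ext i j; fin_cases i <;> fin_cases j <;>
    simp [den, blk, gW, Matrix.mul_apply, Fin.sum_univ_two, mk]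

lemma moeb_gW (a b d : ℂ) : moeb gW (mk a b d) = mk d b a := by
  apply moeb_eq
  · simp [den_gW]
  · rw [den_gW]
    ext i j; fin_cases i <;> fin_cases j <;>
      simp [blk, gW, Matrix.mul_apply, Fin.sum_univ_two, mk]

lemma den_gL (a b d : ℂ) : den gL (mk a b d) = !![1, -1; 0, 1] := by
  ext i j; fin_cases i <;> fin_cases j <;>
    simp [den, blk, gL, Matrix.mul_apply, Fin.sum_univ_two, mk]

lemma moeb_gL (a b d : ℂ) : moeb gL (mk a b d) = mk a (b + a) (d + 2 * b + a) := by
  apply moeb_eq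
  · simp [den_gL]
  · rw [den_gL]
    ext i j; fin_cases i <;> fin_cases j <;>
      simp [blk, gL, Matrix.mul_apply, Fin.sum_univ_two, mk] <;> ring

lemma den_gLi (a b d : ℂ) : den gLi (mk a b d) = !![1, 1; 0, 1] := by
  ext i j; fin_cases i <;> fin_cases j <;>
    simp [den, blk, gLi, Matrix.mul_apply, Fin.sum_univ_two, mk]

lemma moeb_gLi (a b d : ℂ) : moeb gLi (mk a b d) = mk a (b - a) (d - 2 * b + a) := by
  apply moeb_eq
  · simp [den_gLi]
  · rw [den_gLi]
    ext i j; fin_cases i <;> fin_cases j <;>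
      simp [blk, gLi, Matrix.mul_apply, Fin.sum_univ_two, mk] <;> ring

lemma den_gS (a b d : ℂ) : den gS (mk a b d) = !![a, b; 0, 1] := by
  ext i j; fin_cases i <;> fin_cases j <;>
    simp [den, blk, gS, Matrix.mul_apply, Fin.sum_univ_two, mk]

lemma moeb_gS (a b d : ℂ) (ha : a ≠ 0) :
    moeb gS (mk a b d) = mk (-1 / a) (b / a) (d - b ^ 2 / a) := by
  apply moeb_eq
  · simp [den_gS, ha]
  · rw [den_gS]
    ext i j; fin_cases i <;> fin_cases j <;>
      simp [blk, gS, Matrix.mul_apply, Fin.sum_univ_two, mk, ha] <;> field_simp <;> ring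

lemma mk_ne {a b d : ℂ} (h : mk a b d ∈ H2) : a ≠ 0 := by
  rintro rfl
  have := ((mk_mem _ _ _).1 h).1
  simp at this

lemma gS_mem {a b d : ℂ} (h : mk a b d ∈ H2) : mk (-1 / a) (b / a) (d - b ^ 2 / a) ∈ H2 := by
  have ha := mk_ne h
  rw [mk_mem] at h ⊢
  obtain ⟨h1, h2⟩ := h
  have hn : 0 < normSq a := normSq_pos.2 ha
  have hn2 : normSq a = a.re * a.re + a.im * a.im := normSq_apply a
  have e1 : (-1 / a).im = a.im / normSq a := by
    simp [div_eq_mul_inv, Complex.inv_im]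
  have e2 : (b / a).im = (b.im * a.re - b.re * a.im) / normSq a := by
    rw [Complex.div_im]; ring
  have e3 : (d - b ^ 2 / a).im = d.im - (2 * b.re * b.im * a.re - (b.re ^ 2 - b.im ^ 2) * a.im) / normSq a := by
    rw [Complex.sub_im, Complex.div_im, pow_two, Complex.mul_im, Complex.mul_re]; ring
  rw [e1, e2, e3]
  refine ⟨by positivity, ?_⟩
  rw [div_pow, div_lt_iff₀ (by positivity)]
  have : a.im / normSq a * (d.im - (2 * b.re * b.im * a.re - (b.re ^ 2 - b.im ^ 2) * a.im) / normSq a) * normSq a ^ 2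
    = a.im * (d.im * normSq a - (2 * b.re * b.im * a.re - (b.re ^ 2 - b.im ^ 2) * a.im)) := by
    field_simp
  rw [this, hn2]
  rw [hn2] at hn
  nlinarith [mul_pos hn (sub_pos.2 h2)]

end SG

namespace SG

abbrev M4 := Matrix (Fin 4) (Fin 4) ℤ

def Gen : Submonoid M4 := Submonoid.closure {gT, gTi, gS, gW, gL, gLi}

lemma gT_gen : gT ∈ Gen := Submonoid.subset_closure (by simp)
lemma gTi_gen : gTi ∈ Gen := Submonoid.subset_closure (by simp)
lemma gS_gen : gS ∈ Gen := Submonoid.subset_closure (by simp)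
lemma gW_gen : gW ∈ Gen := Submonoid.subset_closure (by simp)
lemma gL_gen : gL ∈ Gen := Submonoid.subset_closure (by simp)
lemma gLi_gen : gLi ∈ Gen := Submonoid.subset_closure (by simp)

lemma Sp_mul {γ δ : M4} (h : γ ∈ Sp4Z) (h' : δ ∈ Sp4Z) : γ * δ ∈ Sp4Z := by
  have h1 : γᵀ * J4 * γ = J4 := h
  have h2 : δᵀ * J4 * δ = J4 := h'
  show (γ * δ)ᵀ * J4 * (γ * δ) = J4
  calc (γ * δ)ᵀ * J4 * (γ * δ) = δᵀ * (γᵀ * J4 * γ) * δ := by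
        rw [Matrix.transpose_mul]; simp only [Matrix.mul_assoc]
    _ = J4 := by rw [h1, h2]

lemma gT_Sp : gT ∈ Sp4Z := by show gTᵀ * J4 * gT = J4; decide
lemma gTi_Sp : gTi ∈ Sp4Z := by show gTiᵀ * J4 * gTi = J4; decide
lemma gS_Sp : gS ∈ Sp4Z := by show gSᵀ * J4 * gS = J4; decide
lemma gW_Sp : gW ∈ Sp4Z := by show gWᵀ * J4 * gW = J4; decide
lemma gL_Sp : gL ∈ Sp4Z := by show gLᵀ * J4 * gL = J4; decide
lemma gLi_Sp : gLi ∈ Sp4Z := by show gLiᵀ * J4 * gLi = J4; decide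
lemma one_Sp : (1 : M4) ∈ Sp4Z := by show (1 : M4)ᵀ * J4 * 1 = J4; simp

lemma Gen_Sp {γ : M4} (h : γ ∈ Gen) : γ ∈ Sp4Z := by
  induction h using Submonoid.closure_induction with
  | mem x hx =>
    simp only [Set.mem_insert_iff, Set.mem_singleton_iff] at hx
    rcases hx with rfl | rfl | rfl | rfl | rfl | rfl
    exacts [gT_Sp, gTi_Sp, gS_Sp, gW_Sp, gL_Sp, gLi_Sp]
  | one => exact one_Sp
  | mul x y _ _ hx hy => exact Sp_mul hx hy

abbrev SL2 := Matrix.SpecialLinearGroup (Fin 2) ℤ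

def emb1 (M : SL2) : M4 := !![M 0 0, 0, M 0 1, 0; 0, 1, 0, 0; M 1 0, 0, M 1 1, 0; 0, 0, 0, 1]
def emb2 (M : SL2) : M4 := !![1, 0, 0, 0; 0, M 0 0, 0, M 0 1; 0, 0, 1, 0; 0, M 1 0, 0, M 1 1]
def gU (M : SL2) : M4 :=
  !![M 0 0, M 0 1, 0, 0; M 1 0, M 1 1, 0, 0; 0, 0, M 1 1, -M 1 0; 0, 0, -M 0 1, M 0 0]

lemma emb1_mul (M N : SL2) : emb1 (M * N) = emb1 M * emb1 N := by
  ext i j; fin_cases i <;> fin_cases j <;>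
    simp [emb1, Matrix.mul_apply, Fin.sum_univ_four, Fin.sum_univ_two]
lemma emb2_eq (M : SL2) : emb2 M = gW * emb1 M * gW := by
  ext i j; fin_cases i <;> fin_cases j <;>
    simp [emb1, emb2, gW, Matrix.mul_apply, Fin.sum_univ_four]
lemma gU_mul (M N : SL2) : gU (M * N) = gU M * gU N := by
  ext i j; fin_cases i <;> fin_cases j <;>
    simp [gU, Matrix.mul_apply, Fin.sum_univ_four, Fin.sum_univ_two] <;> ring
lemma emb1_one : emb1 1 = 1 := by decide
lemma gU_one : gU 1 = 1 := by decide

lemma SL2_ind (f : SL2 → M4) (h1 : f 1 = 1) (hm : ∀ M N, f (M * N) = f M * f N)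
    (hS : f ModularGroup.S ∈ Gen) (hS' : f (ModularGroup.S⁻¹) ∈ Gen)
    (hT : f ModularGroup.T ∈ Gen) (hT' : f (ModularGroup.T⁻¹) ∈ Gen) (M : SL2) : f M ∈ Gen := by
  have hM : M ∈ Subgroup.closure {ModularGroup.S, ModularGroup.T} := by
    rw [SpecialLinearGroup.SL2Z_generators]; trivial
  have : f M ∈ Gen ∧ f M⁻¹ ∈ Gen := by
    induction hM using Subgroup.closure_induction with
    | mem x hx =>
      simp only [Set.mem_insert_iff, Set.mem_singleton_iff] at hx
      rcases hx with rfl | rfl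
      exacts [⟨hS, hS'⟩, ⟨hT, hT'⟩]
    | one => simp [h1, Gen.one_mem]
    | mul x y _ _ hx hy =>
      rw [_root_.mul_inv_rev, hm, hm]
      exact ⟨Gen.mul_mem hx.1 hy.1, Gen.mul_mem hy.2 hx.2⟩
    | inv x _ hx => rw [inv_inv]; exact hx.symm
  exact this.1

lemma emb1_gen (M : SL2) : emb1 M ∈ Gen := by
  refine SL2_ind emb1 emb1_one emb1_mul ?_ ?_ ?_ ?_ M
  · rw [show emb1 ModularGroup.S = gS by decide]; exact gS_gen
  · rw [show emb1 (ModularGroup.S⁻¹) = gS * gS * gS by decide]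
    exact Gen.mul_mem (Gen.mul_mem gS_gen gS_gen) gS_gen
  · rw [show emb1 ModularGroup.T = gT by decide]; exact gT_gen
  · rw [show emb1 (ModularGroup.T⁻¹) = gTi by decide]; exact gTi_gen

lemma gU_gen (M : SL2) : gU M ∈ Gen := by
  refine SL2_ind gU gU_one gU_mul ?_ ?_ ?_ ?_ M
  · rw [show gU ModularGroup.S = gS * gS * gW by decide]
    exact Gen.mul_mem (Gen.mul_mem gS_gen gS_gen) gW_gen
  · rw [show gU (ModularGroup.S⁻¹) = gW * (gS * gS) by decide]
    exact Gen.mul_mem gW_gen (Gen.mul_mem gS_gen gS_gen)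
  · rw [show gU ModularGroup.T = gW * gL * gW by decide]
    exact Gen.mul_mem (Gen.mul_mem gW_gen gL_gen) gW_gen
  · rw [show gU (ModularGroup.T⁻¹) = gW * gLi * gW by decide]
    exact Gen.mul_mem (Gen.mul_mem gW_gen gLi_gen) gW_gen

lemma emb2_gen (M : SL2) : emb2 M ∈ Gen := by
  rw [emb2_eq]; exact Gen.mul_mem (Gen.mul_mem gW_gen (emb1_gen M)) gW_gen

lemma cancel (f : SL2 → M4) (h1 : f 1 = 1) (hm : ∀ M N, f (M * N) = f M * f N)
    (hg : ∀ M, f M ∈ Gen) (M : SL2) {γ : M4} (h : f M * γ ∈ Gen) : γ ∈ Gen := by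
  have : γ = f M⁻¹ * (f M * γ) := by
    rw [← Matrix.mul_assoc, ← hm]; simp [h1]
  rw [this]; exact Gen.mul_mem (hg _) h

lemma emb2_one : emb2 1 = 1 := by decide
lemma emb2_mul (M N : SL2) : emb2 (M * N) = emb2 M * emb2 N := by
  ext i j; fin_cases i <;> fin_cases j <;>
    simp [emb2, Matrix.mul_apply, Fin.sum_univ_four, Fin.sum_univ_two]

lemma exM (a c : ℤ) : ∃ M : SL2, M 1 0 * a + M 1 1 * c = 0 := by
  by_cases h : a = 0 ∧ c = 0
  · exact ⟨1, by simp [h.1, h.2]⟩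
  · have hg : Int.gcd a c ≠ 0 := by rwa [Ne, Int.gcd_eq_zero_iff]
    obtain ⟨a', c', hc, ha, hb⟩ := Int.exists_gcd_one (Nat.pos_of_ne_zero hg)
    obtain ⟨M, e0, e1⟩ := ((Int.isCoprime_iff_gcd_eq_one.2 hc).symm).neg_left.exists_SL2_row 1
    refine ⟨M, ?_⟩
    rw [e0, e1]; linear_combination -c' * ha + a' * hb

lemma Sp_rel {γ : M4} (h : γ ∈ Sp4Z) (i j : Fin 4) :
    γ 0 i * γ 2 j + γ 1 i * γ 3 j - γ 2 i * γ 0 j - γ 3 i * γ 1 j = J4 i j := by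
  have h1 : γᵀ * J4 * γ = J4 := h
  have := congrFun (congrFun h1 i) j
  rw [← this]
  simp [Matrix.mul_apply, Fin.sum_univ_four, J4]
  ring

def Tn (n : ℤ) : SL2 := ⟨!![1, n; 0, 1], by simp⟩

lemma Tz_gen (u y x : ℤ) :
    (!![1, x, y, u; 0, 1, u, 0; 0, 0, 1, 0; 0, 0, -x, 1] : M4) ∈ Gen := by
  have : (!![1, x, y, u; 0, 1, u, 0; 0, 0, 1, 0; 0, 0, -x, 1] : M4) =
      gL * emb1 (Tn u) * gLi * emb1 (Tn (y + u * x - u)) * emb2 (Tn (-u)) * gU (Tn x) := by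
    ext i j; fin_cases i <;> fin_cases j <;>
      simp [emb1, emb2, gU, gL, gLi, Tn, Matrix.mul_apply, Fin.sum_univ_four]
  rw [this]
  exact Gen.mul_mem (Gen.mul_mem (Gen.mul_mem (Gen.mul_mem (Gen.mul_mem gL_gen (emb1_gen _)) gLi_gen)
    (emb1_gen _)) (emb2_gen _)) (gU_gen _)

lemma s5 {γ : M4} (h : γ ∈ Sp4Z) (h0 : γ 0 0 = 1) (h1 : γ 1 0 = 0) (h2 : γ 2 0 = 0) (h3 : γ 3 0 = 0)
    (m11 : γ 1 1 = 1) (m13 : γ 1 3 = 0) (m31 : γ 3 1 = 0) (m33 : γ 3 3 = 1) : γ ∈ Gen := by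
  have r1 := Sp_rel h 0 1
  have r2 := Sp_rel h 0 2
  have r3 := Sp_rel h 0 3
  simp [h0, h1, h2, h3, J4] at r1 r2 r3
  have r4 := Sp_rel h 1 2
  have r5 := Sp_rel h 2 3
  simp [r1, r2, r3, J4, m11, m13, m31, m33] at r4 r5
  have e : γ = !![1, γ 0 1, γ 0 2, γ 1 2; 0, 1, γ 1 2, 0; 0, 0, 1, 0; 0, 0, -γ 0 1, 1] := by
    ext i j; fin_cases i <;> fin_cases j <;> simp [*] <;> linarith
  rw [e]; exact Tz_gen _ _ _

lemma s4 {γ : M4} (h : γ ∈ Sp4Z) (h0 : γ 0 0 = 1) (h1 : γ 1 0 = 0) (h2 : γ 2 0 = 0) (h3 : γ 3 0 = 0) :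
    γ ∈ Gen := by
  have r1 := Sp_rel h 0 1
  have r3 := Sp_rel h 0 3
  simp [h0, h1, h2, h3, J4] at r1 r3
  have r4 := Sp_rel h 1 3
  simp [r1, r3, J4] at r4
  refine cancel emb2 emb2_one emb2_mul emb2_gen ⟨!![γ 3 3, -γ 1 3; -γ 3 1, γ 1 1], ?_⟩ ?_
  · rw [Matrix.det_fin_two]; simp; linarith
  · apply s5 (Sp_mul (Gen_Sp (emb2_gen _)) h) <;>
      simp [emb2, Matrix.mul_apply, Fin.sum_univ_four, *] <;> linarith

lemma s3 {γ : M4} (h : γ ∈ Sp4Z) (h1 : γ 1 0 = 0) (h2 : γ 2 0 = 0) (h3 : γ 3 0 = 0) :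
    γ ∈ Gen := by
  have r1 := Sp_rel h 0 2
  simp [h1, h2, h3, J4] at r1
  rcases Int.isUnit_iff.1 (IsUnit.of_mul_eq_one _ r1) with h0 | h0
  · exact s4 h h0 h1 h2 h3
  · refine cancel emb1 emb1_one emb1_mul emb1_gen (-1) ?_
    apply s4 (Sp_mul (Gen_Sp (emb1_gen _)) h) <;>
      simp [emb1, Matrix.mul_apply, Fin.sum_univ_four, *]

lemma s2 {γ : M4} (h : γ ∈ Sp4Z) (h2 : γ 2 0 = 0) (h3 : γ 3 0 = 0) : γ ∈ Gen := by
  obtain ⟨M, hM⟩ := exM (γ 0 0) (γ 1 0)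
  refine cancel gU gU_one gU_mul gU_gen M ?_
  apply s3 (Sp_mul (Gen_Sp (gU_gen _)) h) <;>
    simp [gU, Matrix.mul_apply, Fin.sum_univ_four, *]

lemma s1 {γ : M4} (h : γ ∈ Sp4Z) (h3 : γ 3 0 = 0) : γ ∈ Gen := by
  obtain ⟨M, hM⟩ := exM (γ 0 0) (γ 2 0)
  refine cancel emb1 emb1_one emb1_mul emb1_gen M ?_
  apply s2 (Sp_mul (Gen_Sp (emb1_gen _)) h) <;>
    simp [emb1, Matrix.mul_apply, Fin.sum_univ_four, *]

lemma Sp_Gen {γ : M4} (h : γ ∈ Sp4Z) : γ ∈ Gen := by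
  obtain ⟨M, hM⟩ := exM (γ 1 0) (γ 3 0)
  refine cancel emb2 emb2_one emb2_mul emb2_gen M ?_
  apply s1 (Sp_mul (Gen_Sp (emb2_gen _)) h)
  simp [emb2, Matrix.mul_apply, Fin.sum_univ_four, *]

lemma eps_word {ε : M4 → ℂ} (h1 : ε 1 = 1)
    (h2 : ∀ γ ∈ Sp4Z, ∀ δ ∈ Sp4Z, ε (γ * δ) = ε γ * ε δ) (l : List M4) (hl : ∀ g ∈ l, g ∈ Sp4Z) :
    l.prod ∈ Sp4Z ∧ ε l.prod = (l.map ε).prod := by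
  induction l with
  | nil => exact ⟨one_Sp, by simp [h1]⟩
  | cons a l ih =>
    have := ih fun g hg => hl g (List.mem_cons_of_mem _ hg)
    have ha := hl a List.mem_cons_self
    rw [List.prod_cons, List.map_cons, List.prod_cons, h2 _ ha _ this.1, this.2]
    exact ⟨Sp_mul ha this.1, rfl⟩

lemma eps_gen {ε : M4 → ℂ} (hε : IsEps ε) :
    ε gT = -1 ∧ ε gTi = -1 ∧ ε gS = -1 ∧ ε gW = -1 ∧ ε gL = -1 ∧ ε gLi = -1 := by
  obtain ⟨h1, h2, γ, hγ, hne⟩ := hε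
  have hT := h1 _ gT_Sp
  have hTi := h1 _ gTi_Sp
  have hS := h1 _ gS_Sp
  have hW := h1 _ gW_Sp
  have hL := h1 _ gL_Sp
  have hLi := h1 _ gLi_Sp
  have e1 : ε 1 = 1 := by
    have := h2 1 one_Sp 1 one_Sp
    rw [mul_one] at this
    rcases h1 1 one_Sp with h | h
    · exact h
    · rw [h] at this; norm_num at this
  have key := fun (l : List M4) (h : ∀ g ∈ l, g ∈ Gen) =>
    (eps_word e1 h2 l (fun g hg => Gen_Sp (h g hg))).2
  have rT := key [gT, gTi] (by simp [gT_gen, gTi_gen])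
  rw [show [gT, gTi].prod = 1 by decide, e1] at rT
  have rL := key [gL, gLi] (by simp [gL_gen, gLi_gen])
  rw [show [gL, gLi].prod = 1 by decide, e1] at rL
  have rS := key [gS, gT, gS, gT, gS, gT, gS, gS] (by simp [gS_gen, gT_gen])
  rw [show [gS, gT, gS, gT, gS, gT, gS, gS].prod = 1 by decide, e1] at rS
  have rW := key [gL, gW, gLi, gW, gL, gW, gS, gS] (by simp [gS_gen, gL_gen, gLi_gen, gW_gen])
  rw [show [gL, gW, gLi, gW, gL, gW, gS, gS].prod = 1 by decide, e1] at rW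
  have rZ := key [gS, gTi, gL, gT, gLi, gW, gTi, gW, gS, gS, gS]
    (by simp [gS_gen, gL_gen, gLi_gen, gW_gen, gT_gen, gTi_gen])
  rw [show [gS, gTi, gL, gT, gLi, gW, gTi, gW, gS, gS, gS].prod = gLi by decide] at rZ
  simp only [List.map_cons, List.map_nil, List.prod_cons, List.prod_nil, mul_one] at rT rL rS rW rZ
  rcases hT with hT | hT
  · exfalso
    rw [hT] at rT rS rZ
    have hTi' : ε gTi = 1 := by linear_combination -rT
    rw [hTi'] at rZ
    have hS' : ε gS = 1 := by
      rcases hS with h | h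
      · exact h
      · rw [h] at rS; norm_num at rS
    have hLi' : ε gLi = 1 := by
      rw [hS'] at rZ
      rcases hW with h | h <;> rw [h] at rZ <;> linear_combination rZ - rL
    have hL' : ε gL = 1 := by rw [hLi'] at rL; linear_combination -rL
    have hW' : ε gW = 1 := by
      rcases hW with h | h
      · exact h
      · rw [h, hS', hL', hLi'] at rW; norm_num at rW
    apply hne
    have := Sp_Gen hγ
    induction this using Submonoid.closure_induction with
    | mem x hx =>
      simp only [Set.mem_insert_iff, Set.mem_singleton_iff] at hx
      rcases hx with rfl | rfl | rfl | rfl | rfl | rfl <;> assumption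
    | one => exact e1
    | mul x y hx hy hx' hy' =>
      rw [h2 _ (Gen_Sp hx) _ (Gen_Sp hy)]
      have a1 : ε x = 1 := by
        by_contra hc; exact hc (hx' (Gen_Sp hx) hc)
      have a2 : ε y = 1 := by
        by_contra hc; exact hc (hy' (Gen_Sp hy) hc)
      rw [a1, a2, mul_one]
  · have hTi' : ε gTi = -1 := by rw [hT] at rT; linear_combination rT
    have hS' : ε gS = -1 := by
      rcases hS with h | h
      · rw [h, hT] at rS; norm_num at rS
      · exact h
    have hLi' : ε gLi = -1 := by
      rw [hS', hT, hTi'] at rZ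
      rcases hW with h | h <;> rw [h] at rZ <;> linear_combination rZ + rL
    have hL' : ε gL = -1 := by rw [hLi'] at rL; linear_combination rL
    have hW' : ε gW = -1 := by
      rcases hW with h | h
      · rw [h, hS', hL', hLi'] at rW; norm_num at rW
      · exact h
    exact ⟨hT, hTi', hS', hW', hL', hLi'⟩

end SG

namespace SG

lemma hs_congr {α : Type*} {f g : α → ℂ} {a : ℂ} (h : ∀ n, f n = g n) (hf : HasSum f a) :
    HasSum g a := by
  have : f = g := funext h
  rwa [← this]

lemma hasFP {c : ℕ → ℂ} {r : ℝ} (hr : 0 < r) {g : ℂ → ℂ}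
    (h : ∀ w, w ≠ 0 → ‖w‖ < r → HasSum (fun n => c n * w ^ n) (g w)) :
    HasFPowerSeriesOnBall (Function.update g 0 (c 0)) (.ofScalars ℂ c) 0 (ENNReal.ofReal r) := by
  constructor
  · refine le_of_forall_lt_imp_le_of_dense fun s hs ↦ ?_
    rcases eq_or_ne s 0 with rfl | hs'
    · simp
    · lift s to NNReal using hs.ne_top
      apply FormalMultilinearSeries.le_radius_of_summable
      have hs2 : (s : ℝ) < r := by
        have := (ENNReal.lt_ofReal_iff_toReal_lt (by simp)).1 hs
        simpa using this
      simpa [smul_eq_mul, norm_mul, mul_comm, mul_left_comm, mul_assoc] using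
        (h (s : ℝ) (by simpa using hs') (by simpa using hs2)).summable.norm
  · simpa using hr
  · intro y hy
    rw [Metric.eball_ofReal, mem_ball_zero_iff] at hy
    rcases eq_or_ne y 0 with rfl | hy'
    · simpa +contextual [zero_pow_eq] using hasSum_ite_eq 0 (c 0)
    · simpa [Function.update_of_ne hy', mul_comm] using h y hy' hy

lemma pow_uniq {c : ℕ → ℂ} {r : ℝ} (hr : 0 < r)
    (h : ∀ w, w ≠ 0 → ‖w‖ < r → HasSum (fun n => c n * w ^ n) 0) (n : ℕ) : c n = 0 := by
  have h1 := hasFP (g := fun _ => 0) hr h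
  have hc : Function.update (fun _ : ℂ => (0:ℂ)) 0 (c 0) = fun _ => 0 := by
    have L1 := h1.hasFPowerSeriesAt.continuousAt
    have L2 : ContinuousAt (fun _ : ℂ => (0:ℂ)) 0 := continuousAt_const
    have := (L1.eventuallyEq_nhds_iff_eventuallyEq_nhdsNE L2).mp <|
      by filter_upwards [self_mem_nhdsWithin] with a ha using Function.update_of_ne ha ..
    have h0 : c 0 = 0 := by simpa using this.eq_of_nhds
    rw [h0]; exact Function.update_eq_self 0 _
  rw [hc] at h1
  have h2 := h1.hasFPowerSeriesAt.eq_zero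
  have := congr_arg (FormalMultilinearSeries.coeff · n) h2
  have h3 : (0 : FormalMultilinearSeries ℂ ℂ ℂ).coeff n = 0 := rfl
  simp only [FormalMultilinearSeries.coeff_ofScalars] at this
  rw [this]; exact h3

lemma exists_tau {w : ℂ} (h0 : w ≠ 0) (h1 : ‖w‖ < 1) :
    ∃ τ : ℂ, 0 < τ.im ∧ cexp (Real.pi * I * τ) = w := by
  refine ⟨Complex.log w / (Real.pi * I), ?_, ?_⟩
  · have : Complex.log w / (Real.pi * I) = ((1 / Real.pi : ℝ) : ℂ) * (-I * Complex.log w) := by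
      have : (Real.pi : ℂ) ≠ 0 := by exact_mod_cast Real.pi_ne_zero
      push_cast; field_simp; simp
    rw [this, Complex.im_ofReal_mul]
    have h2 : Real.log ‖w‖ < 0 := Real.log_neg (norm_pos_iff.2 h0) h1
    have : (-I * Complex.log w).im = - Real.log ‖w‖ := by simp [Complex.log_re]
    rw [this]
    have := Real.pi_pos
    have : 0 < 1 / Real.pi := by positivity
    nlinarith
  · have : (Real.pi : ℂ) ≠ 0 := by exact_mod_cast Real.pi_ne_zero
    rw [mul_div_cancel₀ _ (mul_ne_zero this I_ne_zero), Complex.exp_log h0]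

lemma norm_e {τ : ℂ} (h : 0 < τ.im) : ‖cexp (Real.pi * I * τ)‖ < 1 := by
  rw [Complex.norm_exp, Real.exp_lt_one_iff]
  simp
  positivity

lemma e_pow (n : ℕ) (τ : ℂ) : cexp (Real.pi * I * n * τ) = cexp (Real.pi * I * τ) ^ n := by
  rw [← Complex.exp_nat_mul]; congr 1; ring

/-- Uniqueness for series in `e^{πiτ}`. -/
lemma e_uniq {c : ℕ → ℂ}
    (h : ∀ τ : ℂ, 0 < τ.im → HasSum (fun n : ℕ => c n * cexp (Real.pi * I * n * τ)) 0) (n : ℕ) :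
    c n = 0 := by
  refine pow_uniq (r := 1) one_pos (fun w h0 h1 => ?_) n
  obtain ⟨τ, ht, rfl⟩ := exists_tau h0 h1
  simpa [e_pow] using h τ ht

lemma e_diff {c : ℕ → ℂ} {f : ℂ → ℂ}
    (h : ∀ τ : ℂ, 0 < τ.im → HasSum (fun n : ℕ => c n * cexp (Real.pi * I * n * τ)) (f τ)) :
    DifferentiableOn ℂ f {τ | 0 < τ.im} := by
  have h1 := hasFP (g := fun w => ∑' n, c n * w ^ n) (c := c) one_pos (fun w h0 h1 => by
    obtain ⟨τ, ht, rfl⟩ := exists_tau h0 h1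
    have := h τ ht
    simp only [e_pow] at this
    exact this.summable.hasSum)
  have h2 : DifferentiableOn ℂ (fun τ : ℂ => Function.update (fun w => ∑' n, c n * w ^ n) 0 (c 0)
      (cexp (Real.pi * I * τ))) {τ | 0 < τ.im} := by
    have h3 := h1.differentiableOn
    rw [Metric.eball_ofReal] at h3
    refine h3.comp (f := fun τ : ℂ => cexp (Real.pi * I * τ)) (by fun_prop) ?_
    intro τ ht
    simpa using! norm_e ht
  refine h2.congr fun τ ht => ?_
  rw [Function.update_of_ne (exp_ne_zero _)]
  have := h τ ht
  simp only [e_pow] at this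
  exact this.tsum_eq.symm

open UpperHalfPlane hiding I in
open ModularForm in
open MatrixGroups in
lemma mkMF (f : ℂ → ℂ) (k : ℤ) (hd : DifferentiableOn ℂ f {τ | 0 < τ.im})
    (hT : ∀ τ : ℂ, 0 < τ.im → f (τ + 1) = f τ)
    (hS : ∀ τ : ℂ, 0 < τ.im → f (-1 / τ) = τ ^ k * f τ)
    (hb : IsBoundedAtImInfty (fun τ : UpperHalfPlane => f τ)) :
    ∃ g : ModularForm 𝒮ℒ k, ∀ τ : UpperHalfPlane, g τ = f τ := by
  have iS : (fun τ : UpperHalfPlane => f τ) ∣[k] ModularGroup.S = (fun τ : UpperHalfPlane => f τ) := by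
    ext z
    rw [SlashInvariantForm.slash_S_apply]
    have h1 : f (-(z:ℂ))⁻¹ = (z:ℂ) ^ k * f z := by
      rw [← hS z z.im_pos]; congr 1; rw [neg_div, one_div, inv_neg]
    show f (-(z:ℂ))⁻¹ * (z:ℂ) ^ (-k) = f z
    rw [h1, _root_.zpow_neg]
    have : (z:ℂ) ^ k ≠ 0 := zpow_ne_zero _ z.ne_zero
    field_simp
  have iT : (fun τ : UpperHalfPlane => f τ) ∣[k] ModularGroup.T = (fun τ : UpperHalfPlane => f τ) := by
    ext z
    rw [SL_slash_apply, denom, modular_T_smul, ModularGroup.T]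
    have := hT z z.im_pos
    rw [add_comm] at this
    have e1 : ((Matrix.SpecialLinearGroup.map (Int.castRingHom ℝ)) ⟨!![1, 1; 0, 1], ModularGroup.T._proof_1⟩ : Matrix (Fin 2) (Fin 2) ℝ) 1 0 = 0 := by
      show ((0:ℤ):ℝ) = 0; simp
    have e2 : ((Matrix.SpecialLinearGroup.map (Int.castRingHom ℝ)) ⟨!![1, 1; 0, 1], ModularGroup.T._proof_1⟩ : Matrix (Fin 2) (Fin 2) ℝ) 1 1 = 1 := by
      show ((1:ℤ):ℝ) = 1; simp
    simp [this, e1, e2]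
  refine ⟨{ toFun := fun τ : UpperHalfPlane => f τ
            slash_action_eq' := ?_
            holo' := ?_
            bdd_at_cusps' := ?_ }, fun τ => rfl⟩
  · rintro A ⟨A, rfl⟩
    exact SlashInvariantForm.slash_action_generators_SL2Z iS iT A
  · rw [UpperHalfPlane.mdifferentiable_iff]
    refine hd.congr fun z hz => ?_
    simp [ofComplex_apply_of_im_pos hz]
  · intro c hc
    rw [Subgroup.IsArithmetic.isCusp_iff_isCusp_SL2Z] at hc
    rw [OnePoint.isBoundedAt_iff_forall_SL2Z hc]
    intro γ _
    show IsBoundedAtImInfty ((fun τ : UpperHalfPlane => f τ) ∣[k] γ)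
    rw [SlashInvariantForm.slash_action_generators_SL2Z iS iT]
    exact hb

lemma im_inv_pos {τ : ℂ} (h : 0 < τ.im) : 0 < (-1 / τ).im := by
  have h0 : τ ≠ 0 := by rintro rfl; simp at h
  have : 0 < Complex.normSq τ := Complex.normSq_pos.2 h0
  rw [neg_div, one_div, Complex.neg_im, Complex.inv_im]
  rw [neg_div, neg_neg]; positivity

lemma sq_sum {b : ℕ → ℂ} {f : ℂ → ℂ}
    (hf : ∀ τ : ℂ, 0 < τ.im → HasSum (fun n : ℕ => b n * cexp (Real.pi * I * n * τ)) (f τ))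
    (hodd : ∀ n, Even n → b n = 0) (τ : ℂ) (ht : 0 < τ.im) :
    HasSum (fun n : ℕ => (∑ kl ∈ Finset.HasAntidiagonal.antidiagonal (2 * n), b kl.1 * b kl.2) *
      cexp (2 * Real.pi * I * n * τ)) (f τ ^ 2) := by
  have h := hf τ ht
  have hn := h.summable.norm
  have h2 := tsum_mul_tsum_eq_tsum_sum_antidiagonal_of_summable_norm hn hn
  have h3 := (summable_norm_sum_mul_antidiagonal_of_summable_norm hn hn).of_norm.hasSum
  rw [← h2, h.tsum_eq, ← sq] at h3
  have h4 : ∀ n : ℕ, (∑ kl ∈ Finset.HasAntidiagonal.antidiagonal n, b kl.1 * cexp (Real.pi * I * kl.1 * τ) *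
      (b kl.2 * cexp (Real.pi * I * kl.2 * τ))) =
      (∑ kl ∈ Finset.HasAntidiagonal.antidiagonal n, b kl.1 * b kl.2) * cexp (Real.pi * I * n * τ) := by
    intro n
    rw [Finset.sum_mul]
    refine Finset.sum_congr rfl fun kl hkl => ?_
    rw [← Finset.HasAntidiagonal.mem_antidiagonal.1 hkl]
    push_cast
    rw [show (Real.pi : ℂ) * I * (kl.1 + kl.2) * τ = Real.pi * I * kl.1 * τ + Real.pi * I * kl.2 * τ by ring,
      Complex.exp_add]; ring
  simp only [h4] at h3
  have hi : Function.Injective (fun n : ℕ => 2 * n) := fun a b h => by simpa using h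
  rw [← hi.hasSum_iff] at h3
  · refine hs_congr (fun n => ?_) h3
    simp only [Function.comp]
    push_cast; congr 2; ring
  · intro n hn
    have hno : ¬ Even n := by
      rintro ⟨m, rfl⟩; exact hn ⟨m, by simp; ring⟩
    rw [Finset.sum_eq_zero, zero_mul]
    intro kl hkl
    rw [← Finset.HasAntidiagonal.mem_antidiagonal.1 hkl, Nat.even_add] at hno
    by_cases h1 : Even kl.1
    · rw [hodd _ h1, zero_mul]
    · have : Even kl.2 := by tauto
      rw [hodd _ this, mul_zero]

open ModularForm in
lemma eta12_S {τ : ℂ} (h : 0 < τ.im) : ModularForm.eta (-1 / τ) ^ 12 = - τ ^ 6 * ModularForm.eta τ ^ 12 := by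
  have he : ModularForm.eta (-1 / τ) = (sqrt I)⁻¹ * (sqrt τ * ModularForm.eta τ) := by
    simpa using eta_comp_eq_csqrt_I_inv h
  have h0 : τ ≠ 0 := by rintro rfl; simp at h
  have hs : ∀ z : ℂ, z ≠ 0 → (sqrt z) ^ 12 = z ^ 6 := by
    intro z hz
    rw [Complex.sqrt, ← Complex.cpow_nat_mul]
    norm_num
  rw [he, mul_pow, mul_pow, inv_pow, hs _ I_ne_zero, hs _ h0]
  have : I ^ 6 = -1 := by
    rw [show 6 = 4 + 2 by rfl, pow_add, I_pow_four, I_sq]; simp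
  rw [this]; ring

open ModularForm in
lemma eta12_T {τ : ℂ} : ModularForm.eta (τ + 1) ^ 12 = - ModularForm.eta τ ^ 12 := by
  have : ModularForm.eta (τ + 1) ^ 12 = (Function.Periodic.qParam 24 (τ+1))^12 * (∏' n, (1 - eta_q n τ)) ^ 12 := by
    rw [ModularForm.eta, mul_pow]
    congr 4 with n
    rw [eta_q, eta_q]
    congr 2
    simp [Function.Periodic.qParam, mul_add, Complex.exp_add]
  rw [this, ModularForm.eta, mul_pow, ← neg_mul]
  congr 1
  simp only [Function.Periodic.qParam]
  rw [← Complex.exp_nat_mul, ← Complex.exp_nat_mul]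
  rw [show ((12:ℕ):ℂ) * (2 * Real.pi * I * (τ + 1) / (24:ℝ)) =
    (12:ℕ) * (2 * Real.pi * I * τ / (24:ℝ)) + Real.pi * I by push_cast; ring, Complex.exp_add, Complex.exp_pi_mul_I]
  ring

open UpperHalfPlane hiding I in
open ModularForm in
open MatrixGroups in
theorem vanish (b : ℕ → ℂ) (f : ℂ → ℂ) (k p0 : ℕ)
    (hf : ∀ τ : ℂ, 0 < τ.im → HasSum (fun n : ℕ => b n * cexp (Real.pi * I * n * τ)) (f τ))
    (hodd : ∀ n, Even n → b n = 0) (hp : ∀ n < p0, b n = 0)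
    (hS : ∀ τ : ℂ, 0 < τ.im → f (-1 / τ) = -τ ^ k * f τ) (hk : k < 6 * p0 ∨ k = 8) :
    ∀ n, b n = 0 := by
  have hT : ∀ τ : ℂ, 0 < τ.im → f (τ + 1) = - f τ := by
    intro τ ht
    have h1 := hf (τ + 1) (by simpa using ht)
    refine h1.unique ?_
    have h2 := (hf τ ht).neg
    refine hs_congr (fun n => ?_) h2
    symm
    rcases Nat.even_or_odd n with h | h
    · simp [hodd n h]
    · rw [← mul_neg, mul_add, Complex.exp_add]
      congr 1
      rw [show (Real.pi : ℂ) * I * n * 1 = n * (Real.pi * I) by ring, Complex.exp_nat_mul,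
        Complex.exp_pi_mul_I, h.neg_one_pow]; ring
  have hd : DifferentiableOn ℂ f {τ | 0 < τ.im} := e_diff hf
  suffices hz : ∀ τ : ℂ, 0 < τ.im → f τ = 0 by
    refine e_uniq fun τ ht => ?_
    have := hf τ ht
    rwa [hz τ ht] at this
  set B : ℕ → ℂ := fun n => ∑ kl ∈ Finset.HasAntidiagonal.antidiagonal (2 * n), b kl.1 * b kl.2 with hB
  have hq : ∀ τ : UpperHalfPlane, HasSum (fun m ↦ B m • (Function.Periodic.qParam 1 τ) ^ m) (f τ ^ 2) := by
    intro τ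
    refine hs_congr (fun n => ?_) (sq_sum hf hodd τ τ.im_pos)
    rw [smul_eq_mul]
    congr 1
    simp only [Function.Periodic.qParam]
    rw [← Complex.exp_nat_mul]; congr 1; push_cast; ring
  have hb := isBoundedAtImInfty_of_hasSum_qExpansion one_pos hq
  obtain ⟨g, hg⟩ := mkMF (fun τ => f τ ^ 2) ((2 * k : ℕ) : ℤ) (hd.pow 2)
    (fun τ ht => by simp only [hT τ ht]; ring) (fun τ ht => by
      simp only [hS τ ht, zpow_natCast]; ring) hb
  have hgq : ∀ m, B m = (qExpansion 1 g).coeff m := fun m =>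
    ModularFormClass.qExpansion_coeff_unique one_pos one_mem_strictPeriods_SL
      (fun τ => by rw [hg τ]; exact hq τ) m
  rcases hk with hk | rfl
  · have hBz : ∀ n < p0, B n = 0 := by
      intro n hn
      refine Finset.sum_eq_zero fun kl hkl => ?_
      have h1 := Finset.HasAntidiagonal.mem_antidiagonal.1 hkl
      rcases lt_or_ge kl.1 p0 with h | h
      · rw [hp _ h, zero_mul]
      · rw [hp kl.2 (by omega), mul_zero]
    have h0 : g = 0 := by
      apply sturm_bound_levelOne_nat
      have h1 : (p0 : ℕ∞) ≤ (qExpansion 1 g).order := by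
        apply PowerSeries.nat_le_order
        intro i hi
        rw [← hgq, hBz i hi]
      refine lt_of_lt_of_le ?_ h1
      have : 2 * k / 12 < p0 := by omega
      exact_mod_cast this
    intro τ ht
    have := hg ⟨τ, ht⟩
    rw [h0] at this
    simpa using this.symm
  · have hB0 : (qExpansion 1 g).coeff 0 = 0 := by
      rw [← hgq, hB]; simp [hodd 0]
    set G := CuspForm.discriminantEquiv (toCuspForm g hB0) with hG
    have hGv : ∀ τ : UpperHalfPlane, G τ = f τ ^ 2 / ModularForm.eta τ ^ 24 := by
      intro τ
      rw [hG, CuspForm.discriminantEquiv_apply]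
      show g τ / _ = _
      rw [hg]; rfl
    have hGb : IsBoundedAtImInfty (fun τ : UpperHalfPlane => f τ / ModularForm.eta τ ^ 12) := by
      have h1 : IsBoundedAtImInfty G := ModularFormClass.bdd_at_infty G
      rw [isBoundedAtImInfty_iff] at h1 ⊢
      obtain ⟨M, A, h⟩ := h1
      refine ⟨M + 1, A, fun z hz => ?_⟩
      have h2 := h z hz
      rw [hGv] at h2
      have h3 : ‖f z / ModularForm.eta z ^ 12‖ ^ 2 ≤ M := by
        rw [← norm_pow, div_pow, ← pow_mul]; exact h2
      nlinarith [norm_nonneg (f z / ModularForm.eta z ^ 12)]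
    obtain ⟨u, hu⟩ := mkMF (fun τ => f τ / ModularForm.eta τ ^ 12) 2
      (hd.div (fun z hz => ((differentiableAt_eta_of_mem_upperHalfPlaneSet hz).pow
      12).differentiableWithinAt) (fun z hz => pow_ne_zero _ (eta_ne_zero hz)))
      (fun τ ht => by simp only [hT τ ht, eta12_T]; rw [neg_div_neg_eq]) (fun τ ht => by
        have h0 : τ ≠ 0 := by rintro rfl; simp at ht
        have h1 := eta_ne_zero ht
        simp only [hS τ ht, eta12_S ht]
        rw [show (2:ℤ) = ((2:ℕ):ℤ) by rfl, zpow_natCast]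
        field_simp) hGb
    have hu0 : u = 0 := by
      have := rank_zero_iff_forall_zero.1 levelOne_weight_two_rank_zero
      exact this u
    intro τ ht
    have := hu ⟨τ, ht⟩
    rw [hu0] at this
    have h1 := pow_ne_zero 12 (eta_ne_zero ht)
    have h2 : f τ / ModularForm.eta τ ^ 12 = 0 := this.symm
    exact (div_eq_zero_iff.1 h2).resolve_right h1

end SG

namespace SG

abbrev T3 := Fin 3 → UnitAddCircle
abbrev μ3 : MeasureTheory.Measure T3 :=
  MeasureTheory.Measure.pi (fun _ : Fin 3 => (AddCircle.haarAddCircle : MeasureTheory.Measure UnitAddCircle))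

def rep (t : T3) : Fin 3 → ℝ := fun j => (AddCircle.equivIco 1 0 (t j) : ℝ)
def toT (X : Fin 3 → ℝ) : T3 := fun j => (X j : UnitAddCircle)

lemma toT_rep (t : T3) : toT (rep t) = t := by
  funext j
  exact (AddCircle.equivIco (1:ℝ) 0).symm_apply_apply (t j)

lemma rep_toT (X : Fin 3 → ℝ) : ∃ n : Fin 3 → ℤ, rep (toT X) = fun j => X j + n j := by
  refine ⟨fun j => - ⌊X j⌋, ?_⟩
  funext j
  simp only [rep, toT]
  rw [AddCircle.coe_equivIco_mk_apply]
  have := Int.floor_add_fract (X j)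
  simp; linarith

lemma toT_add (X Y : Fin 3 → ℝ) : toT (fun j => X j + Y j) = toT X + toT Y := by
  funext j; simp [toT]

/-- periodic functions -/
def Per (g : (Fin 3 → ℝ) → ℂ) : Prop := ∀ X, ∀ n : Fin 3 → ℤ, g (fun j => X j + n j) = g X

lemma lift_coe {g : (Fin 3 → ℝ) → ℂ} (hg : Per g) (X : Fin 3 → ℝ) : g (rep (toT X)) = g X := by
  obtain ⟨n, hn⟩ := rep_toT X
  rw [hn, hg]

lemma toT_quot : IsOpenQuotientMap toT := by
  have : toT = Pi.map (fun _ : Fin 3 => ((↑) : ℝ → UnitAddCircle)) := rfl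
  rw [this]
  exact IsOpenQuotientMap.piMap fun _ => QuotientAddGroup.isOpenQuotientMap_mk

lemma toT_cont : Continuous toT := toT_quot.continuous

lemma lift_cont {g : (Fin 3 → ℝ) → ℂ} (hg : Per g) (hc : Continuous g) :
    Continuous (fun t => g (rep t)) := by
  rw [toT_quot.isQuotientMap.continuous_iff]
  have : (fun t => g (rep t)) ∘ toT = g := funext fun X => lift_coe hg X
  rwa [this]

/-- Domain in ℂ³ -/
def dom : Set (Fin 3 → ℂ) := {Z | 0 < (Z 0).im ∧ (Z 1).im ^ 2 < (Z 0).im * (Z 2).im}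
/-- cone in ℝ³ -/
def cone : Set (Fin 3 → ℝ) := {Y | 0 < Y 0 ∧ Y 1 ^ 2 < Y 0 * Y 2}

def pt (Y X : Fin 3 → ℝ) : Fin 3 → ℂ := fun j => X j + Y j * I

lemma pt_dom (Y X : Fin 3 → ℝ) : pt Y X ∈ dom ↔ Y ∈ cone := by
  simp [pt, dom, cone]

lemma dom_open : IsOpen dom := by
  apply IsOpen.inter
  · exact isOpen_lt (f := fun _ => (0:ℝ)) (g := fun Z : Fin 3 → ℂ => (Z 0).im) (by fun_prop) (by fun_prop)
  · exact isOpen_lt (f := fun Z : Fin 3 → ℂ => (Z 1).im ^ 2) (g := fun Z : Fin 3 → ℂ => (Z 0).im * (Z 2).im) (by fun_prop) (by fun_prop)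

structure Good (G : (Fin 3 → ℂ) → ℂ) : Prop where
  diff : DifferentiableOn ℂ G dom
  per : ∀ Z ∈ dom, ∀ n : Fin 3 → ℤ, G (fun j => Z j + n j) = G Z

lemma Good.Per {G : (Fin 3 → ℂ) → ℂ} (h : Good G) {Y : Fin 3 → ℝ} (hY : Y ∈ cone) :
    Per (fun X => G (pt Y X)) := by
  intro X n
  refine Eq.trans ?_ (h.per _ ((pt_dom Y X).2 hY) n)
  show G _ = _
  congr 1; funext j; simp [pt]; ring

lemma Good.cont {G : (Fin 3 → ℂ) → ℂ} (h : Good G) {Y : Fin 3 → ℝ} (hY : Y ∈ cone) :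
    Continuous (fun X => G (pt Y X)) :=
  h.diff.continuousOn.comp_continuous (by unfold pt; fun_prop) fun X => (pt_dom Y X).2 hY

def bb (G : (Fin 3 → ℂ) → ℂ) (Y : Fin 3 → ℝ) : ℂ := ∫ t, G (pt Y (rep t)) ∂μ3

lemma rect {h : ℂ → ℂ} {η : ℝ} (hd : ∀ x y : ℝ, y ∈ Set.uIcc 0 η → DifferentiableAt ℂ h (x + y * I))
    (hp : ∀ y ∈ Set.uIcc 0 η, h (1 + y * I) = h (y * I)) :
    ∫ x in (0:ℝ)..1, h x = ∫ x in (0:ℝ)..1, h (x + η * I) := by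
  have h1 := Complex.integral_boundary_rect_eq_zero_of_differentiableOn h 0 (1 + η * I) (by
    intro z hz
    have := hd z.re z.im (by simpa using hz.2)
    rw [Complex.re_add_im] at this
    exact this.differentiableWithinAt)
  have h2 : ∫ y in (0:ℝ)..η, h (1 + y * I) = ∫ y in (0:ℝ)..η, h (y * I) :=
    intervalIntegral.integral_congr fun y hy => hp y hy
  simp at h1
  rw [h2] at h1
  simp at h1
  exact sub_eq_zero.1 h1

lemma bb_avg {G : (Fin 3 → ℂ) → ℂ} (h : Good G) {Y : Fin 3 → ℝ} (hY : Y ∈ cone) (j : Fin 3) :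
    bb G Y = ∫ t, (∫ x in (0:ℝ)..1, G (pt Y (rep t + Pi.single j x))) ∂μ3 := by
  have key : ∀ t x, G (pt Y (rep t + Pi.single j x)) = G (pt Y (rep (t + toT (Pi.single j x)))) := by
    intro t x
    have h1 := lift_coe (h.Per hY) (rep t + Pi.single j x)
    have h2 : toT (rep t + Pi.single j x) = t + toT (Pi.single j x) := by
      conv_rhs => rw [← toT_rep t]
      exact toT_add _ _
    rw [h2] at h1
    exact h1.symm
  have h1 : ∀ x : ℝ, ∫ t, G (pt Y (rep t + Pi.single j x)) ∂μ3 = bb G Y := by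
    intro x
    simp only [key]
    exact MeasureTheory.integral_add_right_eq_self (μ := μ3) (fun t => G (pt Y (rep t))) _
  have hc : Continuous (fun p : ℝ × T3 => G (pt Y (rep (p.2 + toT (Pi.single j p.1))))) := by
    have := lift_cont (h.Per hY) (h.cont hY)
    refine this.comp (continuous_snd.add (toT_cont.comp ?_))
    exact (continuous_single j).comp continuous_fst
  calc bb G Y = ∫ x in (0:ℝ)..1, ∫ t, G (pt Y (rep t + Pi.single j x)) ∂μ3 := by
        simp [h1]
    _ = _ := by
        simp only [key]
        rw [MeasureTheory.intervalIntegral_integral_swap]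
        have h3 : MeasureTheory.IntegrableOn
          (fun p : ℝ × T3 => G (pt Y (rep (p.2 + toT (Pi.single j p.1)))))
          (Set.Icc (0:ℝ) 1 ×ˢ Set.univ) (MeasureTheory.volume.prod μ3) :=
          hc.continuousOn.integrableOn_compact (isCompact_Icc.prod isCompact_univ)
        have h4 := h3.mono_set (s := Set.uIoc (0:ℝ) 1 ×ˢ Set.univ) (by
          rw [Set.uIoc_of_le zero_le_one]
          exact Set.prod_mono Set.Ioc_subset_Icc_self le_rfl)
        rw [MeasureTheory.IntegrableOn, ← MeasureTheory.Measure.prod_restrict,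
          MeasureTheory.Measure.restrict_univ] at h4
        exact h4

lemma bb_move {G : (Fin 3 → ℂ) → ℂ} (h : Good G) {Y : Fin 3 → ℝ} (j : Fin 3) (η : ℝ)
    (hs : ∀ y ∈ Set.uIcc 0 η, Y + Pi.single j y ∈ cone) :
    bb G Y = bb G (Y + Pi.single j η) := by
  have hY : Y ∈ cone := by simpa using hs 0 (by simp)
  rw [bb_avg h hY j, bb_avg h (hs η (by simp)) j]
  congr 1; funext t
  have e : ∀ x y : ℝ, pt (Y + Pi.single j y) (rep t + Pi.single j x) =
      fun i => pt Y (rep t) i + (Pi.single j ((x:ℂ) + y * I) : Fin 3 → ℂ) i := by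
    intro x y
    funext i
    by_cases hij : i = j
    · subst hij; simp [pt]; ring
    · simp [pt, hij]
  have h1 := rect (h := fun ζ => G (fun i => pt Y (rep t) i + (Pi.single j ζ : Fin 3 → ℂ) i)) (η := η) (by
    intro x y hy
    have hm : (fun i => pt Y (rep t) i + (Pi.single j ((x:ℂ) + y * I) : Fin 3 → ℂ) i) ∈ dom := by
      rw [← e x y, pt_dom]; exact hs y hy
    have h2 := h.diff.differentiableAt (dom_open.mem_nhds hm)
    refine DifferentiableAt.comp (g := G) ((x:ℂ) + y * I) h2 ?_
    rw [differentiableAt_pi]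
    intro i
    by_cases hij : i = j
    · subst hij; simp; fun_prop
    · simp [hij]) (by
    intro y hy
    have hm : (fun i => pt Y (rep t) i + (Pi.single j ((y:ℂ) * I) : Fin 3 → ℂ) i) ∈ dom := by
      have := e 0 y
      simp only [ofReal_zero, zero_add] at this
      rw [← this, pt_dom]; exact hs y hy
    show G _ = G _
    rw [← h.per _ hm (Pi.single j 1)]
    congr 1; funext i
    by_cases hij : i = j
    · subst hij; simp; ring
    · simp [hij])
  have e0 : ∀ x : ℝ, pt Y (rep t + Pi.single j x) =
      fun i => pt Y (rep t) i + (Pi.single j (x:ℂ) : Fin 3 → ℂ) i := by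
    intro x; simpa using e x 0
  simp only [e, e0]
  exact h1

lemma cone_pos {Y : Fin 3 → ℝ} (h : Y ∈ cone) : 0 < Y 2 := by
  obtain ⟨h1, h2⟩ := h
  by_contra h3
  nlinarith [sq_nonneg (Y 1)]

lemma bb_big {G : (Fin 3 → ℂ) → ℂ} (h : Good G) {Y : Fin 3 → ℝ} (hY : Y ∈ cone) {R : ℝ}
    (hR : ∀ j, |Y j| < R) : bb G Y = bb G ![R, 0, R] := by
  have hp := cone_pos hY
  obtain ⟨h1, h2⟩ := hY
  have r0 := (abs_lt.1 (hR 0)).2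
  have r1 := abs_lt.1 (hR 1)
  have r2 := (abs_lt.1 (hR 2)).2
  have m1 := bb_move h (Y := Y) 0 (R - Y 0) (by
    intro y hy
    rw [Set.uIcc_of_le (by linarith)] at hy
    refine ⟨by simp; linarith [hy.1], ?_⟩
    simp; nlinarith [hy.1])
  have e1 : Y + Pi.single 0 (R - Y 0) = ![R, Y 1, Y 2] := by
    funext j; fin_cases j <;> simp
  have m2 := bb_move h (Y := ![R, Y 1, Y 2]) 2 (R - Y 2) (by
    intro y hy
    rw [Set.uIcc_of_le (by linarith)] at hy
    refine ⟨by simp; linarith [hy.1], ?_⟩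
    simp; nlinarith [hy.1])
  have e2 : (![R, Y 1, Y 2] + Pi.single 2 (R - Y 2) : Fin 3 → ℝ) = ![R, Y 1, R] := by
    funext j; fin_cases j <;> simp
  have m3 := bb_move h (Y := ![R, Y 1, R]) 1 (- Y 1) (by
    intro y hy
    have : |Y 1 + y| < R := by
      rcases le_total 0 (-Y 1) with h | h
      · rw [Set.uIcc_of_le h] at hy
        rw [abs_lt]; constructor <;> linarith [hy.1, hy.2]
      · rw [Set.uIcc_of_ge h] at hy
        rw [abs_lt]; constructor <;> linarith [hy.1, hy.2]
    refine ⟨by simp; linarith, ?_⟩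
    have h5 := sq_lt_sq.2 (show |Y 1 + y| < |R| by rwa [abs_of_pos (by linarith : 0 < R)])
    simp; nlinarith)
  have e3 : (![R, Y 1, R] + Pi.single 1 (- Y 1) : Fin 3 → ℝ) = ![R, 0, R] := by
    funext j; fin_cases j <;> simp
  rw [m1, e1, m2, e2, m3, e3]

lemma bb_const {G : (Fin 3 → ℂ) → ℂ} (h : Good G) {Y Y' : Fin 3 → ℝ} (hY : Y ∈ cone) (hY' : Y' ∈ cone) :
    bb G Y = bb G Y' := by
  have : ∃ R, ∀ j, |Y j| < R ∧ |Y' j| < R := by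
    refine ⟨|Y 0| + |Y 1| + |Y 2| + |Y' 0| + |Y' 1| + |Y' 2| + 1, fun j => ?_⟩
    have := abs_nonneg (Y 0); have := abs_nonneg (Y 1); have := abs_nonneg (Y 2)
    have := abs_nonneg (Y' 0); have := abs_nonneg (Y' 1); have := abs_nonneg (Y' 2)
    fin_cases j <;> simp <;> constructor <;> linarith
  obtain ⟨R, hR⟩ := this
  rw [bb_big h hY fun j => (hR j).1, bb_big h hY' fun j => (hR j).2]

end SG

namespace SG

def ek (k : Fin 3 → ℤ) (Z : Fin 3 → ℂ) : ℂ := cexp (2 * Real.pi * I * (k 0 * Z 0 + k 1 * Z 1 + k 2 * Z 2))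

lemma ek_per (k n : Fin 3 → ℤ) (Z : Fin 3 → ℂ) : ek k (fun j => Z j + n j) = ek k Z := by
  unfold ek
  rw [Complex.exp_eq_exp_iff_exists_int]
  refine ⟨k 0 * n 0 + k 1 * n 1 + k 2 * n 2, ?_⟩
  push_cast; ring

lemma ek_diff (k : Fin 3 → ℤ) : Differentiable ℂ (ek k) := by
  unfold ek; fun_prop

lemma ek_ne (k Z) : ek k Z ≠ 0 := Complex.exp_ne_zero _

lemma ek_neg_mul (k : Fin 3 → ℤ) (Z) : ek (-k) Z * ek k Z = 1 := by
  unfold ek; rw [← Complex.exp_add]; simp; ring_nf; simp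

lemma ek_add (k l : Fin 3 → ℤ) (Z) : ek (k + l) Z = ek k Z * ek l Z := by
  unfold ek; rw [← Complex.exp_add]; simp; ring_nf

lemma ek_norm (k : Fin 3 → ℤ) (Y X) : ‖ek k (pt Y X)‖ = Real.exp (-(2 * Real.pi) * (k 0 * Y 0 + k 1 * Y 1 + k 2 * Y 2)) := by
  unfold ek pt
  rw [Complex.norm_exp]
  congr 1
  simp

lemma ek_pt (k : Fin 3 → ℤ) (Y X) : ek k (pt Y X) = ek k (pt Y 0) * UnitAddTorus.mFourier k (toT X) := by
  unfold UnitAddTorus.mFourier ek pt toT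
  simp only [ContinuousMap.coe_mk, Fin.prod_univ_three, fourier_coe_apply]
  rw [← Complex.exp_add, ← Complex.exp_add, ← Complex.exp_add]
  congr 1
  simp
  ring

def cf (G : (Fin 3 → ℂ) → ℂ) (k : Fin 3 → ℤ) : ℂ := bb (fun Z => G Z * ek (-k) Z) ![1, 0, 1]

lemma Good.mul {G : (Fin 3 → ℂ) → ℂ} (h : Good G) (k) : Good (fun Z => G Z * ek k Z) :=
  ⟨h.diff.mul (ek_diff k).differentiableOn, fun Z hZ n => by rw [h.per Z hZ, ek_per]⟩

lemma cf_eq {G : (Fin 3 → ℂ) → ℂ} (h : Good G) (k) {Y} (hY : Y ∈ cone) :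
    cf G k = bb (fun Z => G Z * ek (-k) Z) Y :=
  bb_const (h.mul _) ⟨by simp, by simp⟩ hY

lemma cf_bound {G : (Fin 3 → ℂ) → ℂ} (h : Good G) {Y} (hY : Y ∈ cone) :
    ∃ C, 0 ≤ C ∧ ∀ k, ‖cf G k‖ ≤ C * Real.exp (2 * Real.pi * (k 0 * Y 0 + k 1 * Y 1 + k 2 * Y 2)) := by
  have hc := lift_cont (h.Per hY) (h.cont hY)
  obtain ⟨C, hC⟩ := (isCompact_univ (X := T3)).exists_bound_of_continuousOn hc.continuousOn
  refine ⟨C, (norm_nonneg _).trans (hC 0 trivial), fun k => ?_⟩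
  rw [cf_eq h k hY]
  unfold bb
  refine (MeasureTheory.norm_integral_le_of_norm_le_const (C := C * Real.exp (2 * Real.pi * (k 0 * Y 0 + k 1 * Y 1 + k 2 * Y 2))) (Eventually.of_forall fun t => ?_)).trans ?_
  · rw [norm_mul, ek_norm]
    refine le_of_le_of_eq (mul_le_mul_of_nonneg_right (hC t trivial) (Real.exp_nonneg _)) ?_
    congr 2; simp; ring
  · simp

lemma cone_open : IsOpen cone := by
  apply IsOpen.inter
  · exact isOpen_lt (f := fun _ => (0:ℝ)) (g := fun Z : Fin 3 → ℝ => (Z 0)) (by fun_prop) (by fun_prop)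
  · exact isOpen_lt (f := fun Z : Fin 3 → ℝ => (Z 1) ^ 2) (g := fun Z : Fin 3 → ℝ => (Z 0) * (Z 2)) (by fun_prop) (by fun_prop)

lemma cone_near {Y} (hY : Y ∈ cone) : ∃ δ > 0, ∀ σ : Fin 3 → ℝ, (∀ j, |σ j| ≤ 1) → (fun j => Y j - δ * σ j) ∈ cone := by
  obtain ⟨ε, he, hb⟩ := Metric.isOpen_iff.1 cone_open Y hY
  refine ⟨ε / 2, by positivity, fun σ hσ => hb ?_⟩
  rw [Metric.mem_ball]
  refine lt_of_le_of_lt ((dist_pi_le_iff (by positivity : 0 ≤ ε / 2)).2 fun j => ?_) (half_lt_self he)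
  rw [Real.dist_eq]
  have : Y j - ε / 2 * σ j - Y j = -(ε / 2 * σ j) := by ring
  rw [this, abs_neg, abs_mul, abs_of_pos (by positivity : 0 < ε / 2)]
  nlinarith [hσ j]

def e3 : (Fin 3 → ℤ) ≃ ℤ × ℤ × ℤ where
  toFun k := (k 0, k 1, k 2)
  invFun p := ![p.1, p.2.1, p.2.2]
  left_inv k := by funext j; fin_cases j <;> rfl
  right_inv p := rfl

lemma sum_exp_int {δ : ℝ} (hδ : 0 < δ) : Summable (fun n : ℤ => Real.exp (-δ * |(n:ℝ)|)) := by
  have h : Summable (fun n : ℕ => Real.exp (-δ * n)) := by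
    have := summable_geometric_of_lt_one (Real.exp_nonneg (-δ)) (by rw [Real.exp_lt_one_iff]; linarith)
    refine this.congr fun n => ?_
    rw [← Real.exp_nat_mul]; ring_nf
  apply Summable.of_nat_of_neg
  · simpa using h
  · simpa using h

lemma sum_exp3 {δ : ℝ} (hδ : 0 < δ) :
    Summable (fun k : Fin 3 → ℤ => Real.exp (-δ * (|(k 0:ℝ)| + |(k 1:ℝ)| + |(k 2:ℝ)|))) := by
  have h := sum_exp_int hδ
  have h2 := h.mul_of_nonneg (h.mul_of_nonneg h (fun _ => Real.exp_nonneg _) (fun _ => Real.exp_nonneg _))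
    (fun _ => Real.exp_nonneg _) (fun _ => by positivity)
  refine (e3.summable_iff.2 h2).congr fun k => ?_
  show Real.exp (-δ * |(k 0:ℝ)|) * (Real.exp (-δ * |(k 1:ℝ)|) * Real.exp (-δ * |(k 2:ℝ)|)) = _
  rw [← Real.exp_add, ← Real.exp_add]; ring_nf

lemma cf_decay {G : (Fin 3 → ℂ) → ℂ} (h : Good G) {Y} (hY : Y ∈ cone) :
    Summable (fun k => ‖cf G k‖ * Real.exp (-(2 * Real.pi) * (k 0 * Y 0 + k 1 * Y 1 + k 2 * Y 2))) := by
  obtain ⟨δ, hδ, hc⟩ := cone_near hY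
  have hs : ∀ s : Fin 3 → Bool, (fun j => Y j - δ * (if s j then 1 else -1)) ∈ cone := fun s =>
    hc (fun j => if s j then 1 else -1) fun j => by split_ifs <;> simp
  choose C hC0 hC using fun s => cf_bound h (hs s)
  have hb := sum_exp3 (δ := 2 * Real.pi * δ) (by positivity)
  refine Summable.of_nonneg_of_le (fun k => by positivity) (fun k => ?_) (hb.mul_left (∑ s, C s))
  set s : Fin 3 → Bool := fun j => decide (0 ≤ k j) with hsd
  have h1 := hC s k
  have h2 : C s ≤ ∑ s, C s := Finset.single_le_sum (fun i _ => hC0 i) (Finset.mem_univ s)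
  have ha : ∀ j, (k j : ℝ) * (if s j then 1 else -1) = |(k j : ℝ)| := by
    intro j
    by_cases hj : 0 ≤ k j
    · have : (0:ℝ) ≤ k j := by exact_mod_cast hj
      simp [hsd, hj, abs_of_nonneg this]
    · have : (k j : ℝ) < 0 := by exact_mod_cast not_le.1 hj
      simp [hsd, hj, abs_of_neg this]
  calc _ ≤ (C s * _) * Real.exp (-(2 * Real.pi) * (k 0 * Y 0 + k 1 * Y 1 + k 2 * Y 2)) := by gcongr
    _ = C s * Real.exp (-(2 * Real.pi * δ) * (|(k 0:ℝ)| + |(k 1:ℝ)| + |(k 2:ℝ)|)) := by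
      rw [mul_assoc, ← Real.exp_add, ← ha 0, ← ha 1, ← ha 2]; congr 2; ring
    _ ≤ _ := by gcongr

lemma expand {G : (Fin 3 → ℂ) → ℂ} (h : Good G) (Z) (hZ : Z ∈ dom) :
    HasSum (fun k => cf G k * ek k Z) (G Z) := by
  obtain ⟨Y, X, rfl⟩ : ∃ Y X, Z = pt Y X := ⟨fun j => (Z j).im, fun j => (Z j).re, by
    funext j; simp [pt]⟩
  have hY := (pt_dom Y X).1 hZ
  let f : C(UnitAddTorus (Fin 3), ℂ) := ⟨fun t => G (pt Y (rep t)), lift_cont (h.Per hY) (h.cont hY)⟩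
  have hco : ∀ k, UnitAddTorus.mFourierCoeff f k = cf G k * ek k (pt Y 0) := by
    intro k
    rw [cf_eq h k hY]
    unfold bb
    rw [← MeasureTheory.integral_mul_const]
    refine MeasureTheory.integral_congr_ae (μ := μ3) (Eventually.of_forall fun t => ?_)
    show UnitAddTorus.mFourier (-k) t • G (pt Y (rep t)) = G (pt Y (rep t)) * ek (-k) (pt Y (rep t)) * ek k (pt Y 0)
    rw [ek_pt, toT_rep, smul_eq_mul]
    linear_combination (-UnitAddTorus.mFourier (-k) t * G (pt Y (rep t))) * ek_neg_mul k (pt Y 0)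
  have hsum : Summable (UnitAddTorus.mFourierCoeff f) := by
    refine Summable.of_norm ((cf_decay h hY).congr fun k => ?_)
    rw [hco, norm_mul, ek_norm]
  have h1 := UnitAddTorus.hasSum_mFourier_series_apply_of_summable hsum (toT X)
  have h2 : f (toT X) = G (pt Y X) := lift_coe (h.Per hY) X
  rw [h2] at h1
  refine hs_congr (fun k => ?_) h1
  rw [hco, smul_eq_mul, ek_pt k Y X]; ring

lemma ek_int {Y} (k : Fin 3 → ℤ) : ∫ t, ek k (pt Y (rep t)) ∂μ3 = if k = 0 then 1 else 0 := by
  have h1 := orthonormal_iff_ite.mp (UnitAddTorus.orthonormal_mFourier (d := Fin 3)) 0 k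
  simp only [MeasureTheory.ContinuousMap.inner_toLp, UnitAddTorus.mFourier_zero] at h1
  have h2 : ∫ t, UnitAddTorus.mFourier k t ∂μ3 = if k = 0 then 1 else 0 := by
    simp only [eq_comm (a := k)]
    refine Eq.trans ?_ h1
    refine MeasureTheory.integral_congr_ae (μ := μ3) (Eventually.of_forall fun t => ?_)
    simp
  have h3 : ∀ t, ek k (pt Y (rep t)) = ek k (pt Y 0) * UnitAddTorus.mFourier k t := by
    intro t; rw [ek_pt, toT_rep]
  simp only [h3]
  rw [MeasureTheory.integral_const_mul, h2]
  split_ifs with hk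
  · subst hk; simp [ek]
  · simp

lemma uniq {c : (Fin 3 → ℤ) → ℂ} (h : ∀ Z ∈ dom, HasSum (fun k => c k * ek k Z) 0) (n) : c n = 0 := by
  have hY : (![1,0,1] : Fin 3 → ℝ) ∈ cone := ⟨by simp, by simp⟩
  generalize (![1,0,1] : Fin 3 → ℝ) = Y at hY
  have hs : Summable (fun k => ‖c k‖ * ‖ek k (pt Y 0)‖) := by
    refine ((h _ ((pt_dom Y 0).2 hY)).summable.norm).congr fun k => by rw [norm_mul]
  have hn : ∀ k X, ‖ek k (pt Y X)‖ = ‖ek k (pt Y 0)‖ := by intro k X; rw [ek_norm, ek_norm]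
  have hc : ∀ k, Continuous (fun t => ek k (pt Y (rep t))) := by
    intro k
    apply lift_cont (g := fun X => ek k (pt Y X))
    · intro X n
      have e : pt Y (fun j => X j + n j) = fun j => pt Y X j + n j := by
        funext j; simp only [pt]; push_cast; ring
      show ek k (pt Y _) = ek k (pt Y X)
      rw [e, ek_per]
    · refine (ek_diff k).continuous.comp ?_
      unfold pt; fun_prop
  have hI : ∀ k, MeasureTheory.Integrable (fun t => ek k (pt Y (rep t))) μ3 := fun k =>
    (hc k).integrable_of_hasCompactSupport (HasCompactSupport.of_compactSpace _)
  have h1 := MeasureTheory.hasSum_integral_of_summable_integral_norm (μ := μ3)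
    (F := fun k t => c k * ek (k - n) (pt Y (rep t))) (fun k => (hI _).const_mul _) (by
      have : ∀ k t, ‖c k * ek (k - n) (pt Y (rep t))‖ = ‖c k‖ * ‖ek k (pt Y 0)‖ * ‖ek (-n) (pt Y 0)‖ := by
        intro k t
        rw [sub_eq_add_neg, ek_add, norm_mul, norm_mul, hn k, hn (-n)]; ring
      simp only [this]
      simpa using hs.mul_right _)
  have h2 : ∀ t, ∑' k, c k * ek (k - n) (pt Y (rep t)) = 0 := by
    intro t
    have := (h (pt Y (rep t)) ((pt_dom _ _).2 hY)).mul_right (ek (-n) (pt Y (rep t)))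
    rw [zero_mul] at this
    refine HasSum.tsum_eq (hs_congr (fun k => ?_) this)
    rw [sub_eq_add_neg, ek_add]; ring
  simp only [h2, MeasureTheory.integral_const_mul, ek_int, MeasureTheory.integral_zero] at h1
  have h3 := hasSum_single (f := fun k => c k * (if k - n = 0 then (1:ℂ) else 0)) n (by
    intro k hk; simp [sub_eq_zero, hk])
  have := h1.unique h3
  simpa using this.symm

end SG

namespace SG

structure Law (F : (Fin 2 → Fin 2 → ℂ) → (Fin 25 → ℂ)) : Prop where
  intro ::
  diff : DifferentiableOn ℂ F H2
  hT : ∀ a b d, mk a b d ∈ H2 → F (mk (a + 1) b d) = - F (mk a b d)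
  hW : ∀ a b d, mk a b d ∈ H2 → ∀ x y, form (F (mk d b a)) x y = - form (F (mk a b d)) y x
  hL : ∀ a b d, mk a b d ∈ H2 → ∀ x y, form (F (mk a (b + a) (d + 2 * b + a))) x y = - form (F (mk a b d)) x (y - x)
  hS : ∀ a b d, mk a b d ∈ H2 → ∀ x y, form (F (mk (-1 / a) (b / a) (d - b ^ 2 / a))) x y =
    - a ^ 2 * form (F (mk a b d)) (a * x) (b * x + y)

lemma form_neg (v : Fin 25 → ℂ) (x y : ℂ) : form (-v) x y = - form v x y := by
  simp [form]

lemma law_of {ε : M4 → ℂ} (hε : IsEps ε) {F} (hF : F ∈ SiegelCusp 24 2 Sp4Z ε) : Law F := by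
  obtain ⟨hd, hm, -, -⟩ := hF
  obtain ⟨eT, -, eS, eW, eL, -⟩ := eps_gen hε
  refine ⟨hd, ?_, ?_, ?_, ?_⟩
  · intro a b d h
    refine form_ext fun y => ?_
    have := hm _ gT_Sp _ h
    rw [moeb_gT] at this
    rw [this, form_smul, form_wt, den_gT, eT, form_neg]; simp
  · intro a b d h x y
    have := hm _ gW_Sp _ h
    rw [moeb_gW] at this
    rw [this, form_smul, form_wt, den_gW, eW]; simp
  · intro a b d h x y
    have := hm _ gL_Sp _ h
    rw [moeb_gL] at this
    rw [this, form_smul, form_wt, den_gL, eL]; simp [sub_eq_neg_add]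
  · intro a b d h x y
    have := hm _ gS_Sp _ h
    rw [moeb_gS _ _ _ (mk_ne h)] at this
    rw [this, form_smul, form_wt, den_gS, eS]; simp

variable {F : (Fin 2 → Fin 2 → ℂ) → (Fin 25 → ℂ)}

lemma mem_sw {a b d : ℂ} (h : mk a b d ∈ H2) : mk d b a ∈ H2 := by
  rw [mk_mem] at *
  refine ⟨?_, by linarith [h.2]⟩
  by_contra h3
  nlinarith [sq_nonneg b.im, h.1, h.2]

lemma mem_z {a b d a' b' d' : ℂ} (h : mk a b d ∈ H2) (ha : a'.im = a.im) (hb : b'.im = b.im) (hd : d'.im = d.im) :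
    mk a' b' d' ∈ H2 := by
  rw [mk_mem] at *; rwa [ha, hb, hd]

lemma Law.hT2 (h : Law F) (a b d : ℂ) (hm : mk a b d ∈ H2) : F (mk a b (d + 1)) = - F (mk a b d) := by
  refine form_ext fun y => ?_
  have h1 := h.hW (d + 1) b a (mem_z (mem_sw hm) (by simp) rfl rfl) 1 y
  rw [h.hT _ _ _ (mem_sw hm), form_neg, h.hW a b d hm] at h1
  rw [h1, form_neg]; ring

lemma Law.hZ (h : Law F) (a b d : ℂ) (hm : mk a b d ∈ H2) : F (mk a (b + 1) d) = - F (mk a b d) := by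
  have hm' : mk a (b - a) (d - 2 * b + a) ∈ H2 := by
    rw [mk_mem] at *
    refine ⟨hm.1, ?_⟩
    simp; nlinarith [hm.2]
  have h1 := h.hL a (b - a) (d - 2 * b + a) hm'
  have h2 := h.hL (a + 1) (b - a) (d - 2 * b + a) (mem_z hm' (by simp) rfl rfl)
  rw [h.hT _ _ _ hm'] at h2
  have e1 : b - a + a = b := by ring
  have e2 : d - 2 * b + a + 2 * (b - a) + a = d := by ring
  have e3 : b - a + (a + 1) = b + 1 := by ring
  have e4 : d - 2 * b + a + 2 * (b - a) + (a + 1) = d + 1 := by ring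
  rw [e1, e2] at h1
  rw [e3, e4] at h2
  have hm1 : mk a (b + 1) d ∈ H2 := mem_z hm rfl (by simp) rfl
  rw [h.hT _ _ _ (mem_z hm rfl (by simp) (by simp)), h.hT2 _ _ _ hm1] at h2
  refine form_ext fun y => ?_
  have := h2 1 y
  simp only [form_neg, neg_neg] at this ⊢
  rw [this, h1, neg_neg]

lemma Law.hD (h : Law F) (a b d : ℂ) (hm : mk a b d ∈ H2) (x y : ℂ) :
    form (F (mk a (-b) d)) x y = form (F (mk a b d)) (-x) y := by
  have ha := mk_ne hm
  have h1 := h.hS _ _ _ (gS_mem hm) x y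
  rw [h.hS _ _ _ hm] at h1
  have e1 : -1 / (-1 / a) = a := by field_simp
  have e2 : b / a / (-1 / a) = -b := by field_simp
  have e3 : d - b ^ 2 / a - (b / a) ^ 2 / (-1 / a) = d := by field_simp; ring
  have e4 : a * (-1 / a * x) = - x := by field_simp
  have e5 : b * (-1 / a * x) + (b / a * x + y) = y := by field_simp; ring
  rw [e1, e2, e3, e4, e5] at h1
  rw [h1]; field_simp

def GG (F : (Fin 2 → Fin 2 → ℂ) → (Fin 25 → ℂ)) (i : Fin 25) (Z : Fin 3 → ℂ) : ℂ :=
  F (mk (2 * Z 0) (2 * Z 1) (2 * Z 2)) i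

lemma dom_mk {Z : Fin 3 → ℂ} (h : Z ∈ dom) : mk (2 * Z 0) (2 * Z 1) (2 * Z 2) ∈ H2 := by
  rw [mk_mem]; obtain ⟨h1, h2⟩ := h
  simp; constructor <;> nlinarith

lemma per_all {g : ℂ → ℂ} {P : ℂ → Prop} (hP : ∀ z (n : ℤ), P z → P (z + n)) (h : ∀ z, P z → g (z + 1) = g z) (z : ℂ) (hz : P z) (n : ℤ) :
    g (z + n) = g z := by
  induction n using Int.induction_on with
  | zero => simp
  | succ i ih =>
    have := h _ (hP z i hz)
    rw [← ih, ← this]; congr 1; push_cast; ring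
  | pred i ih =>
    have := h _ (hP z (-i - 1) hz)
    rw [← ih, ← this]; congr 1; push_cast; ring

lemma Law.good (h : Law F) (i : Fin 25) : Good (GG F i) := by
  constructor
  · have h1 : DifferentiableOn ℂ (fun Z : Fin 3 → ℂ => F (mk (2 * Z 0) (2 * Z 1) (2 * Z 2))) dom := by
      refine h.diff.comp (t := H2) (f := fun Z : Fin 3 → ℂ => mk (2 * Z 0) (2 * Z 1) (2 * Z 2)) ?_ fun Z hZ => dom_mk hZ
      apply Differentiable.differentiableOn
      unfold mk
      rw [differentiable_pi]; intro i
      rw [differentiable_pi]; intro j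
      fin_cases i <;> fin_cases j <;> simp <;> fun_prop
    exact fun Z hZ => (differentiableWithinAt_pi.1 (h1 Z hZ)) i
  · intro Z hZ n
    have hm := dom_mk hZ
    unfold GG
    simp only
    generalize Z 0 = a at *
    generalize Z 1 = b at *
    generalize Z 2 = d at *
    have im2 : ∀ (z : ℂ) (m : ℤ), (2 * (z + m)).im = (2 * z).im := by intro z m; simp
    have s1 := per_all (g := fun z => F (mk (2 * z) (2 * b) (2 * d)) i)
      (P := fun z => mk (2 * z) (2 * b) (2 * d) ∈ H2) (fun z m hz => mem_z hz (im2 _ _) rfl rfl) (by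
        intro z hz
        have e : 2 * (z + 1) = 2 * z + 1 + 1 := by ring
        simp only [e]
        rw [h.hT _ _ _ (mem_z hz (by simp) rfl rfl), h.hT _ _ _ hz, neg_neg]) a hm (n 0)
    have hm1 : mk (2 * (a + n 0)) (2 * b) (2 * d) ∈ H2 := mem_z hm (im2 _ _) rfl rfl
    have s2 := per_all (g := fun z => F (mk (2 * (a + n 0)) (2 * z) (2 * d)) i)
      (P := fun z => mk (2 * (a + n 0)) (2 * z) (2 * d) ∈ H2) (fun z m hz => mem_z hz rfl (im2 _ _) rfl) (by
        intro z hz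
        have e : 2 * (z + 1) = 2 * z + 1 + 1 := by ring
        simp only [e]
        rw [h.hZ _ _ _ (mem_z hz rfl (by simp) rfl), h.hZ _ _ _ hz, neg_neg]) b hm1 (n 1)
    have hm2 : mk (2 * (a + n 0)) (2 * (b + n 1)) (2 * d) ∈ H2 := mem_z hm1 rfl (im2 _ _) rfl
    have s3 := per_all (g := fun z => F (mk (2 * (a + n 0)) (2 * (b + n 1)) (2 * z)) i)
      (P := fun z => mk (2 * (a + n 0)) (2 * (b + n 1)) (2 * z) ∈ H2) (fun z m hz => mem_z hz rfl rfl (im2 _ _)) (by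
        intro z hz
        have e : 2 * (z + 1) = 2 * z + 1 + 1 := by ring
        simp only [e]
        rw [h.hT2 _ _ _ (mem_z hz rfl rfl (by simp)), h.hT2 _ _ _ hz, neg_neg]) d hm2 (n 2)
    exact s3.trans (s2.trans s1)

/-- Fourier coefficients -/
def ca (F : (Fin 2 → Fin 2 → ℂ) → (Fin 25 → ℂ)) (k : Fin 3 → ℤ) : Fin 25 → ℂ := fun i => cf (GG F i) k

lemma Law.fe (h : Law F) (i : Fin 25) (Z) (hZ : Z ∈ dom) :
    HasSum (fun k => ca F k i * ek k Z) (F (mk (2 * Z 0) (2 * Z 1) (2 * Z 2)) i) :=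
  expand (h.good i) Z hZ

lemma Law.fef (h : Law F) (x y : ℂ) (Z) (hZ : Z ∈ dom) :
    HasSum (fun k => form (ca F k) x y * ek k Z) (form (F (mk (2 * Z 0) (2 * Z 1) (2 * Z 2))) x y) := by
  have := hasSum_sum (s := Finset.univ) (f := fun (i : Fin 25) k => ca F k i * ek k Z * (x ^ (24 - (i:ℕ)) * y ^ (i:ℕ))) fun i _ => (h.fe i Z hZ).mul_right _
  refine hs_congr (fun k => ?_) this
  simp only [form, Finset.sum_mul]
  refine Finset.sum_congr rfl fun i _ => by ring

lemma Law.rel (h : Law F) (σ : (Fin 3 → ℤ) ≃ (Fin 3 → ℤ)) (M : (Fin 3 → ℂ) → Fin 3 → ℂ) (χ : (Fin 3 → ℤ) → ℂ)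
    (s x y x' y' : ℂ) (hM : ∀ Z ∈ dom, M Z ∈ dom) (he : ∀ k Z, ek k (M Z) = χ k * ek (σ k) Z)
    (hF : ∀ Z ∈ dom, form (F (mk (2 * M Z 0) (2 * M Z 1) (2 * M Z 2))) x y =
      s * form (F (mk (2 * Z 0) (2 * Z 1) (2 * Z 2))) x' y') (k) :
    form (ca F k) x y * χ k = s * form (ca F (σ k)) x' y' := by
  have key := uniq (c := fun k => form (ca F (σ.symm k)) x y * χ (σ.symm k) - s * form (ca F k) x' y') (by
    intro Z hZ
    have h1 := h.fef x y (M Z) (hM Z hZ)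
    rw [hF Z hZ, ← σ.symm.hasSum_iff] at h1
    have h2 := (h.fef x' y' Z hZ).mul_left s
    have h3 := h1.sub h2
    rw [sub_self] at h3
    refine hs_congr (fun k => ?_) h3
    simp only [Function.comp, he, Equiv.apply_symm_apply]
    ring) (σ k)
  simpa [sub_eq_zero] using key

def σL : (Fin 3 → ℤ) ≃ (Fin 3 → ℤ) where
  toFun k := ![k 0 + k 1 + k 2, k 1 + 2 * k 2, k 2]
  invFun k := ![k 0 - k 1 + k 2, k 1 - 2 * k 2, k 2]
  left_inv k := by funext j; fin_cases j <;> simp <;> ring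
  right_inv k := by funext j; fin_cases j <;> simp <;> ring
def σW : (Fin 3 → ℤ) ≃ (Fin 3 → ℤ) where
  toFun k := ![k 2, k 1, k 0]
  invFun k := ![k 2, k 1, k 0]
  left_inv k := by funext j; fin_cases j <;> simp
  right_inv k := by funext j; fin_cases j <;> simp
def σD : (Fin 3 → ℤ) ≃ (Fin 3 → ℤ) where
  toFun k := ![k 0, -k 1, k 2]
  invFun k := ![k 0, -k 1, k 2]
  left_inv k := by funext j; fin_cases j <;> simp
  right_inv k := by funext j; fin_cases j <;> simp

lemma Law.rL (h : Law F) (p q s : ℤ) (x y : ℂ) :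
    form (ca F ![p, q, s]) x y = - form (ca F ![p + q + s, q + 2 * s, s]) x (y - x) := by
  have := h.rel σL (fun Z => ![Z 0, Z 1 + Z 0, Z 2 + 2 * Z 1 + Z 0]) (fun _ => 1) (-1) x y x (y - x) (by
    rintro Z ⟨h1, h2⟩
    refine ⟨by simpa using h1, ?_⟩
    simp; nlinarith) (by
    intro k Z
    rw [one_mul]; unfold ek σL
    congr 1; simp; ring) (by
    intro Z hZ
    have := h.hL _ _ _ (dom_mk hZ) x y
    rw [neg_one_mul, ← this]
    congr 3 <;> simp <;> ring) ![p, q, s]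
  simpa [σL] using this

lemma Law.rW (h : Law F) (p q s : ℤ) (x y : ℂ) :
    form (ca F ![p, q, s]) x y = - form (ca F ![s, q, p]) y x := by
  have := h.rel σW (fun Z => ![Z 2, Z 1, Z 0]) (fun _ => 1) (-1) x y y x (by
    rintro Z hZ
    have := mem_sw (dom_mk hZ)
    rw [mk_mem] at this
    simp at this
    exact ⟨by simpa using this.1, by simp; nlinarith [this.2]⟩) (by
    intro k Z
    rw [one_mul]; unfold ek σW
    congr 1; simp; ring) (by
    intro Z hZ
    have := h.hW _ _ _ (dom_mk hZ) x y
    rw [neg_one_mul, ← this]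
    congr 3) ![p, q, s]
  simpa [σW] using this

lemma Law.rD (h : Law F) (p q s : ℤ) (x y : ℂ) :
    form (ca F ![p, q, s]) x y = form (ca F ![p, -q, s]) (-x) y := by
  have := h.rel σD (fun Z => ![Z 0, -Z 1, Z 2]) (fun _ => 1) 1 x y (-x) y (by
    rintro Z ⟨h1, h2⟩
    exact ⟨by simpa using h1, by simpa using h2⟩) (by
    intro k Z
    rw [one_mul]; unfold ek σD
    congr 1; simp) (by
    intro Z hZ
    have := h.hD _ _ _ (dom_mk hZ) x y
    rw [one_mul, ← this]
    congr 3; simp) ![p, q, s]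
  simpa [σD] using this

lemma form_zero (x y : ℂ) : form 0 x y = 0 := by simp [form]

lemma form_eq_zero {v : Fin 25 → ℂ} (h : ∀ y, form v 1 y = 0) : v = 0 :=
  form_ext fun y => by rw [h, form_zero]

lemma Law.oddp (h : Law F) (p q s : ℤ) (hp : Even p) : ca F ![p, q, s] = 0 := by
  refine form_eq_zero fun y => ?_
  have := h.rel (Equiv.refl _) (fun Z => ![Z 0 + 1 / 2, Z 1, Z 2]) (fun k => cexp (Real.pi * I * k 0)) (-1) 1 y 1 y (by
    rintro Z ⟨h1, h2⟩
    exact ⟨by simpa using h1, by simpa using h2⟩) (by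
    intro k Z
    unfold ek
    rw [← Complex.exp_add]
    congr 1; simp; ring) (by
    intro Z hZ
    have := h.hT _ _ _ (dom_mk hZ)
    rw [neg_one_mul, ← form_neg, ← this]
    congr 3; simp; ring) ![p, q, s]
  obtain ⟨m, rfl⟩ := hp
  have e : cexp (Real.pi * I * ((m + m : ℤ) : ℂ)) = 1 := by
    rw [Complex.exp_eq_one_iff]; exact ⟨m, by push_cast; ring⟩
  simp only [Matrix.cons_val_zero, e, Equiv.refl_apply] at this
  linear_combination this / 2

lemma form_swap_zero {v : Fin 25 → ℂ} (h : ∀ x y, form v x y = 0) : v = 0 := form_eq_zero fun y => h 1 y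

lemma Law.odds (h : Law F) (p q s : ℤ) (hs : Even s) : ca F ![p, q, s] = 0 := by
  refine form_eq_zero fun y => ?_
  rw [h.rW, h.oddp _ _ _ hs, form_zero, neg_zero]

lemma Law.oddq (h : Law F) (p q s : ℤ) (hq : Even q) : ca F ![p, q, s] = 0 := by
  by_cases hp : Even p
  · exact h.oddp _ _ _ hp
  by_cases hs : Even s
  · exact h.odds _ _ _ hs
  refine form_eq_zero fun y => ?_
  rw [h.rL, h.oddp, form_zero, neg_zero]
  rw [Int.even_add, Int.even_add]; tauto

lemma Law.rLn (h : Law F) (p q s : ℤ) (n : ℕ) (x y : ℂ) :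
    form (ca F ![p, q, s]) x y = (-1) ^ n * form (ca F ![p + n * q + n ^ 2 * s, q + 2 * n * s, s]) x (y - n * x) := by
  induction n with
  | zero => simp
  | succ n ih =>
    rw [ih, h.rL, pow_succ (-1 : ℂ) n]
    have e1 : p + n * q + n ^ 2 * s + (q + 2 * n * s) + s = p + ((n + 1 : ℕ):ℤ) * q + ((n + 1 : ℕ):ℤ) ^ 2 * s := by push_cast; ring
    have e2 : q + 2 * n * s + 2 * s = q + 2 * ((n + 1 : ℕ):ℤ) * s := by push_cast; ring
    have e3 : y - n * x - x = y - ((n + 1 : ℕ):ℂ) * x := by push_cast; ring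
    rw [e1, e2, e3]; ring

lemma form_bound (v : Fin 25 → ℂ) (C R : ℝ) (hv : ∀ i, ‖v i‖ ≤ C) (y : ℂ) (hy : ‖y‖ ≤ R) (hR : 1 ≤ R) :
    ‖form v 1 y‖ ≤ 25 * C * R ^ 24 := by
  have hC : 0 ≤ C := (norm_nonneg _).trans (hv 0)
  unfold form
  refine (norm_sum_le _ _).trans ?_
  refine (Finset.sum_le_card_nsmul _ _ (C * R ^ 24) fun i _ => ?_).trans ?_
  · rw [norm_mul, one_pow, one_mul, norm_pow]
    gcongr
    · exact hv i
    · calc ‖y‖ ^ (i:ℕ) ≤ R ^ (i:ℕ) := by gcongr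
        _ ≤ R ^ 24 := pow_le_pow_right₀ hR (by omega)
  · simp; linarith

lemma Law.negs (h : Law F) (p q s : ℤ) (hs : s < 0) : ca F ![p, q, s] = 0 := by
  have hY : (![1,0,1] : Fin 3 → ℝ) ∈ cone := ⟨by simp, by simp⟩
  choose C hC0 hC using fun i => cf_bound (h.good i) hY
  refine form_eq_zero fun y => ?_
  set D := ∑ i, C i with hD
  have hDi : ∀ i, C i ≤ D := fun i => Finset.single_le_sum (f := C) (fun i _ => hC0 i) (Finset.mem_univ i)
  have hD0 : 0 ≤ D := (hC0 0).trans (hDi 0)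
  set B := 25 * (D * Real.exp (2 * Real.pi * (p + s))) with hB
  have hb : ∀ n : ℕ, |q| + 1 ≤ n → ‖form (ca F ![p, q, s]) 1 y‖ ≤ B * ((‖y‖ + 1 + n) ^ 24 * Real.exp (-(‖y‖ + 1 + n))) * Real.exp (‖y‖ + 1) := by
    intro n hn
    rw [h.rLn p q s n, norm_mul, norm_pow, norm_neg, norm_one, one_pow, one_mul]
    refine (form_bound _ (D * Real.exp (2 * Real.pi * (p + s)) * Real.exp (-n)) (‖y‖ + 1 + n) (fun i => ?_) _ ?_ (by linarith [norm_nonneg y, (Nat.cast_nonneg n : (0:ℝ) ≤ n)])).trans ?_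
    · refine (hC i _).trans ?_
      rw [mul_assoc D, ← Real.exp_add]
      have h1 : (n:ℤ) * q + n ^ 2 * s ≤ - n := by
        have := neg_abs_le q; have := le_abs_self q
        nlinarith [abs_nonneg q]
      have h2 : (n:ℝ) * q + n ^ 2 * s ≤ - n := by exact_mod_cast h1
      have hpi := Real.pi_gt_three
      have hn0 : (0:ℝ) ≤ n := Nat.cast_nonneg n
      refine mul_le_mul (hDi i) (Real.exp_le_exp.2 ?_) (Real.exp_nonneg _) hD0
      simp
      nlinarith
    · refine (norm_sub_le _ _).trans ?_
      simp
    · rw [hB]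
      have : Real.exp (-(n:ℝ)) = Real.exp (-(‖y‖ + 1 + n)) * Real.exp (‖y‖ + 1) := by
        rw [← Real.exp_add]; ring_nf
      rw [this]; apply le_of_eq; ring
  have ht : Tendsto (fun n : ℕ => B * ((‖y‖ + 1 + n) ^ 24 * Real.exp (-(‖y‖ + 1 + n))) * Real.exp (‖y‖ + 1)) atTop (𝓝 0) := by
    have h1 := Real.tendsto_pow_mul_exp_neg_atTop_nhds_zero 24
    have h2 : Tendsto (fun n : ℕ => ‖y‖ + 1 + (n:ℝ)) atTop atTop :=
      tendsto_atTop_add_const_left _ _ tendsto_natCast_atTop_atTop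
    have := ((h1.comp h2).const_mul B).mul_const (Real.exp (‖y‖ + 1))
    simpa using this
  have := ge_of_tendsto ht (Filter.eventually_atTop.2 ⟨(|q| + 1).toNat, fun n hn => hb n (by
    have := Int.self_le_toNat (|q| + 1); omega)⟩)
  exact norm_le_zero_iff.1 this

lemma Law.poss (h : Law F) (p q s : ℤ) (hs : s ≤ 0) : ca F ![p, q, s] = 0 := by
  rcases hs.lt_or_eq with hs | rfl
  · exact h.negs _ _ _ hs
  · exact h.odds _ _ _ (by simp)

lemma Law.posp (h : Law F) (p q s : ℤ) (hs : p ≤ 0) : ca F ![p, q, s] = 0 := by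
  refine form_eq_zero fun y => ?_
  rw [h.rW, h.poss _ _ _ hs, form_zero, neg_zero]

lemma Law.rLi (h : Law F) (p q s : ℤ) (x y : ℂ) :
    form (ca F ![p, q, s]) x y = - form (ca F ![p - q + s, q - 2 * s, s]) x (y + x) := by
  rw [h.rL (p - q + s) (q - 2 * s) s]
  have e1 : p - q + s + (q - 2 * s) + s = p := by ring
  rw [e1]; simp

/-- zero transport for shears -/
lemma Law.zL (h : Law F) {p q s : ℤ} (h0 : ca F ![p + q + s, q + 2 * s, s] = 0) : ca F ![p, q, s] = 0 :=
  form_eq_zero fun y => by rw [h.rL, h0, form_zero, neg_zero]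
lemma Law.zLi (h : Law F) {p q s : ℤ} (h0 : ca F ![p - q + s, q - 2 * s, s] = 0) : ca F ![p, q, s] = 0 :=
  form_eq_zero fun y => by rw [h.rLi, h0, form_zero, neg_zero]
lemma Law.zW (h : Law F) {p q s : ℤ} (h0 : ca F ![s, q, p] = 0) : ca F ![p, q, s] = 0 :=
  form_eq_zero fun y => by rw [h.rW, h0, form_zero, neg_zero]

lemma Law.disc (h : Law F) (m : ℕ) : ∀ p q s : ℤ, p + s + |q| ≤ m → 4 * p * s ≤ q ^ 2 → ca F ![p, q, s] = 0 := by
  induction m using Nat.strong_induction_on with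
  | _ m ih =>
    intro p q s hm hd
    by_cases hs : s ≤ 0
    · exact h.poss _ _ _ hs
    by_cases hp : p ≤ 0
    · exact h.posp _ _ _ hp
    by_cases hq0 : Even q
    · exact h.oddq _ _ _ hq0
    push Not at hs hp
    have hq : q ≠ 0 := by rintro rfl; simp at hq0
    -- reduce to s ≤ p
    have main : ∀ p s : ℤ, 0 < s → s ≤ p → p + s + |q| ≤ m → 4 * p * s ≤ q ^ 2 → ca F ![p, q, s] = 0 := by
      intro p s hs hsp hm hd
      rcases lt_or_gt_of_ne hq with hq1 | hq1
      · rw [abs_of_neg hq1] at hm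
        apply h.zL
        by_cases h5 : p + q + s ≤ 0
        · exact h.posp _ _ _ h5
        have h6 : |q + 2 * s| < -q := by
          rw [abs_lt]; constructor <;> nlinarith
        refine ih (p + q + s + s + |q + 2 * s|).toNat ?_ _ _ _ (Int.self_le_toNat _) ?_
        · have : p + q + s + s + |q + 2 * s| < m := by nlinarith
          have := abs_nonneg (q + 2 * s)
          omega
        · nlinarith
      · rw [abs_of_pos hq1] at hm
        apply h.zLi
        by_cases h5 : p - q + s ≤ 0
        · exact h.posp _ _ _ h5
        have h6 : |q - 2 * s| < q := by
          rw [abs_lt]; constructor <;> nlinarith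
        refine ih (p - q + s + s + |q - 2 * s|).toNat ?_ _ _ _ (Int.self_le_toNat _) ?_
        · have : p - q + s + s + |q - 2 * s| < m := by nlinarith
          have := abs_nonneg (q - 2 * s)
          omega
        · nlinarith
    rcases le_total s p with hsp | hsp
    · exact main p s hs hsp hm hd
    · exact h.zW (main s p hp hsp (by linarith) (by linarith))

lemma Law.supp (h : Law F) {p q s : ℤ} (h0 : ca F ![p, q, s] ≠ 0) : 0 < p ∧ 0 < s ∧ q ^ 2 < 4 * p * s ∧ Odd p ∧ Odd q ∧ Odd s := by
  refine ⟨?_, ?_, ?_, ?_, ?_, ?_⟩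
  · by_contra h1; exact h0 (h.posp _ _ _ (not_lt.1 h1))
  · by_contra h1; exact h0 (h.poss _ _ _ (not_lt.1 h1))
  · by_contra h1; exact h0 (h.disc (p + s + |q|).toNat _ _ _ (Int.self_le_toNat _) (not_lt.1 h1))
  · by_contra h1; exact h0 (h.oddp _ _ _ (Int.not_odd_iff_even.1 h1))
  · by_contra h1; exact h0 (h.oddq _ _ _ (Int.not_odd_iff_even.1 h1))
  · by_contra h1; exact h0 (h.odds _ _ _ (Int.not_odd_iff_even.1 h1))

end SG

namespace SG

variable {F : (Fin 2 → Fin 2 → ℂ) → (Fin 25 → ℂ)}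

def e3' : (Fin 3 → ℤ) ≃ ℤ × (ℤ × ℤ) where
  toFun k := (k 2, k 0, k 1)
  invFun p := ![p.2.1, p.2.2, p.1]
  left_inv k := by funext j; fin_cases j <;> rfl
  right_inv p := rfl

lemma Law.fe3 (h : Law F) (i : Fin 25) {a b d : ℂ} (hm : mk a b d ∈ H2) :
    HasSum (fun k : ℤ × (ℤ × ℤ) => ca F ![k.2.1, k.2.2, k.1] i * cexp (Real.pi * I * (k.2.1 * a + k.2.2 * b)) *
      cexp (Real.pi * I * k.1 * d)) (F (mk a b d) i) := by
  have hZ : (![a / 2, b / 2, d / 2] : Fin 3 → ℂ) ∈ dom := by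
    rw [mk_mem] at hm
    refine ⟨by simpa using hm.1, ?_⟩
    simp; nlinarith [hm.2]
  have h1 := h.fe i _ hZ
  have e : ∀ z : ℂ, 2 * (z / 2) = z := fun z => by ring
  simp only [Matrix.cons_val_zero, Matrix.cons_val_one, Matrix.cons_val, e] at h1
  rw [← e3'.symm.hasSum_iff] at h1
  refine hs_congr (fun k => ?_) h1
  change ca F ![k.2.1, k.2.2, k.1] i * ek ![k.2.1, k.2.2, k.1] ![a / 2, b / 2, d / 2] = _
  rw [mul_assoc, ← Complex.exp_add, ek]
  congr 2
  simp; ring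

def phi (F : (Fin 2 → Fin 2 → ℂ) → (Fin 25 → ℂ)) (s : ℤ) (τ z : ℂ) : Fin 25 → ℂ := fun i =>
  ∑' k : ℤ × ℤ, ca F ![k.1, k.2, s] i * cexp (Real.pi * I * (k.1 * τ + k.2 * z))

lemma exists_d (τ z : ℂ) (h : 0 < τ.im) : ∃ d, mk τ z d ∈ H2 := by
  refine ⟨((z.im ^ 2 / τ.im + 1 : ℝ) : ℂ) * I, (mk_mem _ _ _).2 ⟨h, ?_⟩⟩
  have : τ.im * (z.im ^ 2 / τ.im) = z.im ^ 2 := by field_simp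
  have h2 : (((z.im ^ 2 / τ.im + 1 : ℝ) : ℂ) * I).im = z.im ^ 2 / τ.im + 1 := by simp only [Complex.im_ofReal_mul, Complex.I_im, mul_one]
  rw [h2]; nlinarith

lemma Law.phi_sum (h : Law F) (s : ℤ) {τ : ℂ} (z : ℂ) (ht : 0 < τ.im) (i : Fin 25) :
    HasSum (fun k : ℤ × ℤ => ca F ![k.1, k.2, s] i * cexp (Real.pi * I * (k.1 * τ + k.2 * z))) (phi F s τ z i) := by
  obtain ⟨d, hd⟩ := exists_d τ z ht
  have h1 := ((h.fe3 i hd).summable.prod_factor s).mul_right (cexp (-(Real.pi * I * s * d)))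
  refine Summable.hasSum (h1.congr fun k => ?_)
  simp only
  rw [mul_assoc, ← Complex.exp_add]; simp

lemma Law.phi_neg (h : Law F) {s : ℤ} (hs : s ≤ 0) (τ z : ℂ) : phi F s τ z = 0 := by
  funext i
  simp [phi, h.poss _ _ _ hs]

lemma hs_nat {f : ℤ → ℂ} {a : ℂ} (h : HasSum f a) (h0 : ∀ s < 0, f s = 0) : HasSum (fun n : ℕ => f n) a := by
  refine (Function.Injective.hasSum_iff (g := fun n : ℕ => (n : ℤ)) (fun m n h => Int.ofNat.inj h) ?_).2 h
  intro s hs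
  refine h0 s ?_
  by_contra hc
  exact hs ⟨s.toNat, Int.toNat_of_nonneg (by omega)⟩

lemma Law.fj (h : Law F) {a b d : ℂ} (hm : mk a b d ∈ H2) (i : Fin 25) :
    HasSum (fun n : ℕ => phi F n a b i * cexp (Real.pi * I * d) ^ n) (F (mk a b d) i) := by
  have ha := ((mk_mem _ _ _).1 hm).1
  have h1 : HasSum (fun s : ℤ => phi F s a b i * cexp (Real.pi * I * s * d)) (F (mk a b d) i) :=
    (h.fe3 i hm).prod_fiberwise fun s => (h.phi_sum s b ha i).mul_right (cexp (Real.pi * I * s * d))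
  refine hs_congr (fun n => ?_) (hs_nat h1 fun s hs => ?_)
  · rw [← e_pow, Int.cast_natCast]
  · rw [h.phi_neg hs.le, Pi.zero_apply, zero_mul]

lemma Law.fjf (h : Law F) {a b d : ℂ} (hm : mk a b d ∈ H2) (x y : ℂ) :
    HasSum (fun n : ℕ => form (phi F n a b) x y * cexp (Real.pi * I * d) ^ n) (form (F (mk a b d)) x y) := by
  have := hasSum_sum (s := Finset.univ) (f := fun (i : Fin 25) (n : ℕ) => phi F n a b i * cexp (Real.pi * I * d) ^ n * (x ^ (24 - (i:ℕ)) * y ^ (i:ℕ))) fun i _ => (h.fj hm i).mul_right _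
  refine hs_congr (fun k => ?_) this
  simp only [form, Finset.sum_mul]
  refine Finset.sum_congr rfl fun i _ => by ring

lemma Law.jac (h : Law F) (s : ℕ) {τ : ℂ} (z : ℂ) (ht : 0 < τ.im) (x y : ℂ) :
    form (phi F s (-1 / τ) (z / τ)) x y * cexp (-(Real.pi * I * s * z ^ 2 / τ)) =
      - τ ^ 2 * form (phi F s τ z) (τ * x) (z * x + y) := by
  have key := pow_uniq (c := fun s : ℕ => form (phi F s (-1 / τ) (z / τ)) x y * cexp (-(Real.pi * I * s * z ^ 2 / τ)) -
      - τ ^ 2 * form (phi F s τ z) (τ * x) (z * x + y)) (r := Real.exp (-Real.pi * (z.im ^ 2 / τ.im))) (Real.exp_pos _) (by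
    intro w h0 h1
    obtain ⟨d, hd, rfl⟩ := exists_tau h0 (h1.trans_le (by
      rw [Real.exp_le_one_iff]
      have : 0 ≤ Real.pi * (z.im ^ 2 / τ.im) := by positivity
      linarith))
    rw [Complex.norm_exp, Real.exp_lt_exp] at h1
    simp at h1
    have h2 : z.im ^ 2 / τ.im < d.im := by
      have := Real.pi_pos
      nlinarith
    have hm : mk τ z d ∈ H2 := by
      rw [mk_mem]; refine ⟨ht, ?_⟩
      rw [div_lt_iff₀ ht] at h2; linarith
    have h3 := h.fjf (gS_mem hm) x y
    rw [h.hS _ _ _ hm] at h3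
    have h4 := (h.fjf hm (τ * x) (z * x + y)).mul_left (-τ ^ 2)
    have h5 := h3.sub h4
    rw [sub_self] at h5
    refine hs_congr (fun n => ?_) h5
    have e : cexp (Real.pi * I * (d - z ^ 2 / τ)) ^ n = cexp (-(Real.pi * I * n * z ^ 2 / τ)) * cexp (Real.pi * I * d) ^ n := by
      rw [← Complex.exp_nat_mul, ← Complex.exp_nat_mul, ← Complex.exp_add]; congr 1; ring
    rw [e]; ring) s
  exact sub_eq_zero.1 key

lemma lead {v w : Fin 25 → ℂ} {a b c d : ℂ} (m : Fin 25) (hv : ∀ l, m < l → v l = 0)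
    (h : ∀ y, form w 1 y * c = d * form v a (b + y)) : w m * c = d * a ^ (24 - (m:ℕ)) * v m := by
  have hp : pol w * Polynomial.C c = Polynomial.C d * (∑ l : Fin 25, (Polynomial.C (v l * a ^ (24 - (l:ℕ))) * (Polynomial.X + Polynomial.C b) ^ (l:ℕ) : Polynomial ℂ)) := by
    refine Polynomial.funext fun y => ?_
    rw [Polynomial.eval_mul, pol_eval, Polynomial.eval_C, h]
    simp only [Polynomial.eval_mul, Polynomial.eval_C, Polynomial.eval_finsetSum, Polynomial.eval_pow,
      Polynomial.eval_add, Polynomial.eval_X, form]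
    congr 1
    refine Finset.sum_congr rfl fun l _ => ?_
    rw [add_comm b y]; ring
  have := congrArg (fun p => Polynomial.coeff p (m:ℕ)) hp
  simp only [Polynomial.coeff_mul_C, pol_coeff, Polynomial.coeff_C_mul, Polynomial.finsetSum_coeff, Polynomial.coeff_X_add_C_pow] at this
  rw [this, Finset.sum_eq_single m]
  · simp; ring
  · intro l _ hl
    rcases lt_or_gt_of_ne hl with h1 | h1
    · rw [Nat.choose_eq_zero_of_lt h1]; simp
    · rw [hv l h1]; simp
  · simp

lemma Law.jl (h : Law F) (M : ℕ) (m : Fin 25) (h0 : ∀ p q : ℤ, ∀ l, m < l → ca F ![p, q, M] l = 0)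
    {τ : ℂ} (z : ℂ) (ht : 0 < τ.im) :
    phi F M (-1 / τ) (z / τ) m * cexp (-(Real.pi * I * M * z ^ 2 / τ)) =
      - τ ^ (2 + (24 - (m:ℕ))) * phi F M τ z m := by
  have := lead (v := phi F M τ z) (w := phi F M (-1 / τ) (z / τ)) (a := τ) (b := z)
    (c := cexp (-(Real.pi * I * M * z ^ 2 / τ))) (d := -τ ^ 2) m (fun l hl => by simp [phi, h0 _ _ l hl])
    (fun y => by simpa using h.jac M z ht 1 y)
  rw [this, pow_add]; ring

end SG

namespace SG

structure Jac (c : ℤ → ℤ → ℂ) (M k : ℕ) (φ : ℂ → ℂ → ℂ) : Prop where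
  intro ::
  supp : ∀ p q, c p q ≠ 0 → 0 < p ∧ q ^ 2 < 4 * p * M ∧ Odd p
  sum : ∀ τ z, 0 < τ.im → HasSum (fun k : ℤ × ℤ => c k.1 k.2 * cexp (Real.pi * I * (k.1 * τ + k.2 * z))) (φ τ z)
  jac : ∀ τ z, 0 < τ.im → φ (-1 / τ) (z / τ) * cexp (-(Real.pi * I * M * z ^ 2 / τ)) = - τ ^ k * φ τ z

def fd (c : ℤ → ℤ → ℂ) (d : ℕ) (τ : ℂ) : ℂ := ∑' k : ℤ × ℤ, c k.1 k.2 * cexp (Real.pi * I * k.1 * τ) * (k.2 : ℂ) ^ d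

def Mom (c : ℤ → ℤ → ℂ) (M d : ℕ) (p : ℤ) : ℂ := ∑ q ∈ Finset.Ioo (-(p + M)) (p + M), (q : ℂ) ^ d * c p q

variable {c : ℤ → ℤ → ℂ} {M k : ℕ} {φ : ℂ → ℂ → ℂ}

def trm (c : ℤ → ℤ → ℂ) (τ z : ℂ) (x : (ℤ × ℤ) × ℕ) : ℂ :=
  c x.1.1 x.1.2 * cexp (Real.pi * I * x.1.1 * τ) * ((Real.pi * I * x.1.2 * z) ^ x.2 / (x.2.factorial : ℂ))

lemma trm_inner (τ z : ℂ) (k : ℤ × ℤ) :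
    HasSum (fun d : ℕ => trm c τ z (k, d)) (c k.1 k.2 * cexp (Real.pi * I * (k.1 * τ + k.2 * z))) := by
  have h := (NormedSpace.expSeries_div_hasSum_exp (Real.pi * I * k.2 * z : ℂ)).mul_left
    (c k.1 k.2 * cexp (Real.pi * I * k.1 * τ))
  rw [← Complex.exp_eq_exp_ℂ, mul_assoc (c k.1 k.2), ← Complex.exp_add] at h
  have e : (Real.pi * I * k.1 * τ + Real.pi * I * k.2 * z : ℂ) = Real.pi * I * (k.1 * τ + k.2 * z) := by ring
  rw [e] at h
  exact h

lemma Jac.trm_summable (h : Jac c M k φ) {τ : ℂ} (z : ℂ) (ht : 0 < τ.im) : Summable (trm c τ z) := by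
  apply Summable.of_norm
  have hn : ∀ k : ℤ × ℤ, HasSum (fun d : ℕ => ‖trm c τ z (k, d)‖)
      (‖c k.1 k.2 * cexp (Real.pi * I * k.1 * τ)‖ * Real.exp (Real.pi * |(k.2:ℝ)| * ‖z‖)) := by
    intro k
    have h1 := (NormedSpace.expSeries_div_hasSum_exp (Real.pi * |(k.2:ℝ)| * ‖z‖)).mul_left
      ‖c k.1 k.2 * cexp (Real.pi * I * k.1 * τ)‖
    rw [← Real.exp_eq_exp_ℝ] at h1
    have e : (fun d : ℕ => ‖trm c τ z (k, d)‖) = fun d : ℕ => ‖c k.1 k.2 * cexp (Real.pi * I * k.1 * τ)‖ * ((Real.pi * |(k.2:ℝ)| * ‖z‖) ^ d / d.factorial) := ?_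
    · rw [e]; exact h1
    funext d
    rw [trm, norm_mul, norm_div, norm_pow]
    simp [abs_of_pos Real.pi_pos]
  rw [summable_prod_of_nonneg (fun _ => norm_nonneg _)]
  refine ⟨fun k => (hn k).summable, ?_⟩
  have h1 := (h.sum τ (‖z‖ * I) ht).summable.norm
  have h2 := (h.sum τ (-(‖z‖ * I)) ht).summable.norm
  refine Summable.of_nonneg_of_le (fun k => tsum_nonneg fun _ => norm_nonneg _) (fun k => ?_) (h1.add h2)
  rw [(hn k).tsum_eq]
  have e1 : ∀ w : ℂ, ‖c k.1 k.2 * cexp (Real.pi * I * (k.1 * τ + k.2 * w))‖ =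
      ‖c k.1 k.2 * cexp (Real.pi * I * k.1 * τ)‖ * Real.exp (-(Real.pi * k.2 * w.im)) := by
    intro w
    have : (Real.pi * I * (k.1 * τ + k.2 * w) : ℂ) = Real.pi * I * k.1 * τ + Real.pi * I * k.2 * w := by ring
    rw [this, Complex.exp_add, ← mul_assoc, norm_mul _ (cexp (Real.pi * I * k.2 * w)), Complex.norm_exp (Real.pi * I * k.2 * w)]
    congr 2
    simp
  rw [e1, e1, ← mul_add]
  refine mul_le_mul_of_nonneg_left ?_ (norm_nonneg _)
  simp only [Complex.neg_im, Complex.im_ofReal_mul, Complex.I_im, mul_one]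
  rcases abs_cases (k.2 : ℝ) with ⟨h3, -⟩ | ⟨h3, -⟩ <;> rw [h3]
  · have := Real.exp_pos (-(Real.pi * k.2 * ‖z‖))
    have e : -(Real.pi * k.2 * -‖z‖) = Real.pi * k.2 * ‖z‖ := by ring
    rw [e]; linarith
  · have := Real.exp_pos (-(Real.pi * k.2 * -‖z‖))
    have e : Real.pi * -(k.2:ℝ) * ‖z‖ = -(Real.pi * k.2 * ‖z‖) := by ring
    rw [e]; linarith

lemma Jac.fd_sum (h : Jac c M k φ) (d : ℕ) {τ : ℂ} (ht : 0 < τ.im) :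
    HasSum (fun k : ℤ × ℤ => c k.1 k.2 * cexp (Real.pi * I * k.1 * τ) * (k.2 : ℂ) ^ d) (fd c d τ) := by
  have h1 := (((Equiv.prodComm ℕ (ℤ × ℤ)).summable_iff).2 (h.trm_summable 1 ht)).prod_factor d
  have h2 := h1.mul_right ((d.factorial : ℂ) / (Real.pi * I) ^ d)
  refine Summable.hasSum (h2.congr fun k => ?_)
  change trm c τ 1 (k, d) * _ = _
  have : (d.factorial : ℂ) ≠ 0 := by exact_mod_cast d.factorial_ne_zero
  have h3 : ((Real.pi : ℂ) * I) ^ d ≠ 0 := pow_ne_zero _ (by simp [Real.pi_ne_zero])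
  have h4 : ((Real.pi : ℂ) * I * k.2 * 1) ^ d = ((Real.pi : ℂ) * I) ^ d * (k.2:ℂ) ^ d := by rw [mul_one, mul_pow _ (k.2:ℂ)]
  simp only [trm]
  rw [h4]
  field_simp

lemma Jac.tay (h : Jac c M k φ) {τ : ℂ} (z : ℂ) (ht : 0 < τ.im) :
    HasSum (fun d : ℕ => fd c d τ * ((Real.pi * I) ^ d / (d.factorial : ℂ)) * z ^ d) (φ τ z) := by
  have hs := (h.trm_summable z ht).hasSum
  have hv := (hs.prod_fiberwise (trm_inner τ z)).unique (h.sum τ z ht)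
  rw [hv, ← (Equiv.prodComm ℕ (ℤ × ℤ)).hasSum_iff] at hs
  refine hs.prod_fiberwise fun d => ?_
  refine hs_congr (fun k => ?_) (((h.fd_sum d ht).mul_right ((Real.pi * I) ^ d / (d.factorial : ℂ))).mul_right (z ^ d))
  change _ = trm c τ z (k, d)
  simp only [trm]
  rw [mul_pow _ z, mul_pow _ (k.2:ℂ)]
  ring

lemma Jac.zero (h : Jac c M k φ) {p q : ℤ} (hq : ¬ (0 < p ∧ q ^ 2 < 4 * p * M ∧ Odd p)) : c p q = 0 := by
  by_contra h0
  exact hq (h.supp p q h0)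

lemma Jac.zero' (h : Jac c M k φ) {p q : ℤ} (hq : q ∉ Finset.Ioo (-(p + M)) (p + M)) : c p q = 0 := by
  refine h.zero fun ⟨h1, h2, _⟩ => hq ?_
  have : q ^ 2 < (p + M) ^ 2 := by nlinarith [sq_nonneg (p - M)]
  rw [sq_lt_sq, abs_of_nonneg (by positivity : (0:ℤ) ≤ p + M), abs_lt] at this
  rw [Finset.mem_Ioo]; exact this

lemma Jac.fd_exp (h : Jac c M k φ) (d : ℕ) {τ : ℂ} (ht : 0 < τ.im) :
    HasSum (fun p : ℕ => Mom c M d p * cexp (Real.pi * I * p * τ)) (fd c d τ) := by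
  have h1 : HasSum (fun p : ℤ => Mom c M d p * cexp (Real.pi * I * p * τ)) (fd c d τ) := by
    refine (h.fd_sum d ht).prod_fiberwise fun p => ?_
    have : HasSum (fun q : ℤ => c p q * cexp (Real.pi * I * p * τ) * (q : ℂ) ^ d) (∑ q ∈ Finset.Ioo (-(p + M)) (p + M), c p q * cexp (Real.pi * I * p * τ) * (q : ℂ) ^ d) := hasSum_sum_of_ne_finset_zero fun q hq => by rw [h.zero' hq]; ring
    rw [Mom, Finset.sum_mul]
    convert this using 1
    exact Finset.sum_congr rfl fun q _ => by ring
  refine hs_congr (fun n => ?_) (hs_nat h1 fun s hs => ?_)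
  · rw [Int.cast_natCast]
  · rw [Mom, Finset.sum_eq_zero, zero_mul]
    intro q _
    rw [h.zero (by omega), mul_zero]

lemma Jac.mom_even (h : Jac c M k φ) (d : ℕ) (n : ℕ) (hn : Even n) : Mom c M d n = 0 := by
  rw [Mom, Finset.sum_eq_zero]
  intro q _
  rw [h.zero, mul_zero]
  rintro ⟨_, _, h3⟩
  rw [← Int.not_even_iff_odd] at h3
  exact h3 (by exact_mod_cast hn)

def EE (w : ℂ) (n : ℕ) : ℂ := if Even n then w ^ (n / 2) / ((n / 2).factorial : ℂ) else 0

lemma EE_sum (w z : ℂ) : HasSum (fun n => EE w n * z ^ n) (cexp (w * z ^ 2)) := by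
  have h := NormedSpace.expSeries_div_hasSum_exp (w * z ^ 2 : ℂ)
  rw [← Complex.exp_eq_exp_ℂ] at h
  rw [← (mul_right_injective₀ (two_ne_zero (α := ℕ))).hasSum_iff]
  · refine hs_congr (fun n => ?_) h
    simp [EE]
    rw [pow_mul, mul_pow]; ring
  · intro n hn
    rw [EE, if_neg, zero_mul]
    rintro ⟨m, rfl⟩
    exact hn ⟨m, by simp; ring⟩

lemma Jac.coef (h : Jac c M k φ) (d : ℕ) {τ : ℂ} (ht : 0 < τ.im) :
    ∑ x ∈ Finset.HasAntidiagonal.antidiagonal d,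
      fd c x.1 (-1 / τ) * ((Real.pi * I) ^ x.1 / (x.1.factorial : ℂ)) * (1 / τ) ^ x.1 * EE (-(Real.pi * I * M / τ)) x.2 =
      - τ ^ k * (fd c d τ * ((Real.pi * I) ^ d / (d.factorial : ℂ))) := by
  have key := pow_uniq (c := fun d => ∑ x ∈ Finset.HasAntidiagonal.antidiagonal d,
      fd c x.1 (-1 / τ) * ((Real.pi * I) ^ x.1 / (x.1.factorial : ℂ)) * (1 / τ) ^ x.1 * EE (-(Real.pi * I * M / τ)) x.2 -
      (- τ ^ k * (fd c d τ * ((Real.pi * I) ^ d / (d.factorial : ℂ))))) one_pos (by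
    intro z _ _
    have h1 := h.tay (z / τ) (im_inv_pos ht)
    have h2 := EE_sum (-(Real.pi * I * M / τ)) z
    have h3 := (h.tay z ht).mul_left (-τ ^ k)
    have h4 := tsum_mul_tsum_eq_tsum_sum_antidiagonal_of_summable_norm h1.summable.norm h2.summable.norm
    have h5 := (summable_norm_sum_mul_antidiagonal_of_summable_norm h1.summable.norm h2.summable.norm).of_norm.hasSum
    rw [← h4, h1.tsum_eq, h2.tsum_eq] at h5
    have e : (-(Real.pi * I * M / τ) * z ^ 2 : ℂ) = -(Real.pi * I * M * z ^ 2 / τ) := by ring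
    rw [e, h.jac τ z ht] at h5
    have h6 := h5.sub h3
    rw [sub_self] at h6
    refine hs_congr (fun n => ?_) h6
    rw [sub_mul, Finset.sum_mul]
    congr 1
    · refine Finset.sum_congr rfl fun x hx => ?_
      rw [← Finset.HasAntidiagonal.mem_antidiagonal.1 hx, pow_add, div_pow, div_pow, one_pow]; ring
    · ring) d
  exact sub_eq_zero.1 key

lemma Jac.fd_zero (h : Jac c M k φ) {d : ℕ} (h0 : ∀ p, Mom c M d p = 0) {τ : ℂ} (ht : 0 < τ.im) : fd c d τ = 0 := by
  refine (h.fd_exp d ht).unique ?_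
  simp [h0, hasSum_zero]

lemma ne_of_im {τ : ℂ} (ht : 0 < τ.im) : τ ≠ 0 := by rintro rfl; simp at ht

lemma mom_all (h : Jac c M k φ) {d : ℕ} (h0 : ∀ p : ℕ, Mom c M d p = 0) (p : ℤ) : Mom c M d p = 0 := by
  by_cases hp : 0 ≤ p
  · obtain ⟨n, rfl⟩ := Int.eq_ofNat_of_zero_le hp
    exact h0 n
  · exact Finset.sum_eq_zero fun q _ => by rw [h.zero (by omega), mul_zero]

lemma Jac.fd_S (h : Jac c M k φ) {d : ℕ} (h0 : ∀ d' < d, ∀ p, Mom c M d' p = 0) {τ : ℂ} (ht : 0 < τ.im) :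
    fd c d (-1 / τ) = - τ ^ (k + d) * fd c d τ := by
  have h1 := h.coef d ht
  rw [Finset.sum_eq_single (d, 0)] at h1
  · have : (d.factorial : ℂ) ≠ 0 := by exact_mod_cast d.factorial_ne_zero
    have h3 : ((Real.pi : ℂ) * I) ^ d ≠ 0 := pow_ne_zero _ (by simp [Real.pi_ne_zero])
    have ht0 := ne_of_im ht
    simp only [EE, one_div, inv_pow] at h1
    simp only [Even.zero, if_true, Nat.zero_div, pow_zero, Nat.factorial_zero, Nat.cast_one, div_one, mul_one] at h1
    have h4 := mul_left_cancel₀ (a := ((Real.pi : ℂ) * I) ^ d / (d.factorial : ℂ)) (div_ne_zero h3 this)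
      (b := fd c d (-1 / τ) * (τ ^ d)⁻¹) (c := - τ ^ k * fd c d τ) (by linear_combination h1)
    rw [pow_add]
    have h5 : fd c d (-1 / τ) = (fd c d (-1 / τ) * (τ ^ d)⁻¹) * τ ^ d := by field_simp
    rw [h5, h4]; ring
  · intro x hx hne
    have h2 := Finset.HasAntidiagonal.mem_antidiagonal.1 hx
    have h3 : x.1 < d := by
      rcases Nat.lt_or_ge x.1 d with h3 | h3
      · exact h3
      · exact absurd (Prod.ext (by simp; omega) (by simp; omega)) hne
    rw [h.fd_zero (h0 _ h3) (im_inv_pos ht)]; ring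
  · intro hx; exact absurd (Finset.HasAntidiagonal.mem_antidiagonal.2 (by simp)) hx

lemma Jac.JV (h : Jac c M k φ) (d p0 : ℕ) (h0 : ∀ d' < d, ∀ p, Mom c M d' p = 0)
    (hp : ∀ p : ℕ, p < p0 → Mom c M d p = 0) (hk : k + d < 6 * p0 ∨ k + d = 8) (p : ℤ) : Mom c M d p = 0 :=
  mom_all h (vanish (fun p => Mom c M d p) (fd c d) (k + d) p0 (fun _ ht => h.fd_exp d ht) (fun n hn => h.mom_even d n hn) hp
    (fun _ ht => h.fd_S h0 ht) hk) p

lemma e_deriv {b : ℕ → ℂ} {f : ℂ → ℂ} (h : ∀ τ : ℂ, 0 < τ.im → HasSum (fun n : ℕ => b n * cexp (Real.pi * I * n * τ)) (f τ))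
    {τ : ℂ} (ht : 0 < τ.im) : HasSum (fun n : ℕ => b n * (Real.pi * I * n) * cexp (Real.pi * I * n * τ)) (deriv f τ) := by
  have hU : IsOpen {w : ℂ | τ.im / 2 < w.im} := isOpen_lt continuous_const Complex.continuous_im
  have hu := (h (τ / 2) (by simp; exact ht)).summable.norm
  have hd : ∀ (n : ℕ) (w : ℂ), HasDerivAt (fun w => b n * cexp (Real.pi * I * n * w)) (b n * (Real.pi * I * n) * cexp (Real.pi * I * n * w)) w := by
    intro n w
    have h1 : HasDerivAt (fun w : ℂ => Real.pi * I * n * w) (Real.pi * I * n) w := by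
      simpa using (hasDerivAt_id w).const_mul (Real.pi * I * n : ℂ)
    have := (h1.cexp).const_mul (b n)
    exact this.congr_deriv (by ring)
  have h1 := Complex.hasSum_deriv_of_summable_norm hu (F := fun n w => b n * cexp (Real.pi * I * n * w)) (U := {w : ℂ | τ.im / 2 < w.im})
    (fun n w _ => (hd n w).differentiableAt.differentiableWithinAt) hU (fun n w hw => by
      rw [norm_mul, norm_mul]
      refine mul_le_mul_of_nonneg_left ?_ (norm_nonneg _)
      rw [Complex.norm_exp, Complex.norm_exp, Real.exp_le_exp]
      have hw' : τ.im / 2 < w.im := hw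
      have h3 : (Real.pi * n) * (τ.im / 2) ≤ (Real.pi * n) * w.im := mul_le_mul_of_nonneg_left hw'.le (by positivity)
      simp at h3 ⊢
      linarith) (z := τ) (by simp; exact ht)
  have h2 : deriv (fun w => ∑' n, b n * cexp (Real.pi * I * n * w)) τ = deriv f τ := by
    refine Filter.EventuallyEq.deriv_eq ?_
    filter_upwards [hU.mem_nhds (by simp; exact ht : τ ∈ {w : ℂ | τ.im / 2 < w.im})] with w hw
    exact (h w (lt_trans (by linarith) hw)).tsum_eq
  rw [h2] at h1
  exact hs_congr (fun n => (hd n τ).deriv) h1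

lemma Jac.heat (h : Jac c 3 5 φ) (h0 : ∀ p, Mom c 3 0 p = 0) (h2 : ∀ p, Mom c 3 2 p = 0) (p : ℤ) :
    Mom c 3 3 p = 3 * p * Mom c 3 1 p := by
  have hS1 : ∀ τ : ℂ, 0 < τ.im → fd c 1 (-1 / τ) = - τ ^ 6 * fd c 1 τ := fun τ ht =>
    h.fd_S (fun d' hd' p => by interval_cases d'; exact h0 p) ht
  have hpi : ((Real.pi : ℂ) * I) ≠ 0 := by simp [Real.pi_ne_zero]
  have hS3 : ∀ τ : ℂ, 0 < τ.im → fd c 3 (-1 / τ) = - τ ^ 8 * fd c 3 τ - 18 / (Real.pi * I) * τ ^ 7 * fd c 1 τ := by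
    intro τ ht
    have h1 := h.coef 3 ht
    have ht0 := ne_of_im ht
    rw [Finset.Nat.sum_antidiagonal_eq_sum_range_succ_mk] at h1
    simp only [Finset.sum_range_succ, Finset.sum_range_zero, Nat.succ_eq_add_one, h.fd_zero h0 (im_inv_pos ht), h.fd_zero h2 (im_inv_pos ht), hS1 τ ht] at h1
    generalize fd c 3 (-1 / τ) = f3 at h1 ⊢
    simp [EE, Nat.factorial, show ¬ Even 3 by decide] at h1
    field_simp at h1 ⊢
    linear_combination h1
  have hd : ∀ τ : ℂ, 0 < τ.im → deriv (fd c 1) (-1 / τ) = - 6 * τ ^ 7 * fd c 1 τ - τ ^ 8 * deriv (fd c 1) τ := by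
    intro τ ht
    have ht0 := ne_of_im ht
    have hdf := e_diff (fun τ ht => h.fd_exp 1 (τ := τ) ht)
    have hU : IsOpen {w : ℂ | 0 < w.im} := isOpen_lt continuous_const Complex.continuous_im
    have d1 := (hdf.differentiableAt (hU.mem_nhds ht)).hasDerivAt
    have d2 := (hdf.differentiableAt (hU.mem_nhds (im_inv_pos ht))).hasDerivAt
    have d3 : HasDerivAt (fun w : ℂ => -1 / w) (1 / τ ^ 2) τ := by
      have := ((hasDerivAt_inv ht0).const_mul (-1)).congr_deriv (show -1 * -(τ ^ 2)⁻¹ = 1 / τ ^ 2 by ring)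
      simpa only [div_eq_mul_inv] using this
    have d4 := d2.comp τ d3
    have d5 := (((hasDerivAt_id τ).pow 6).neg).mul d1
    have d6 : HasDerivAt (fd c 1 ∘ fun w => -1 / w) _ τ := d5.congr_of_eventuallyEq (by
      filter_upwards [hU.mem_nhds ht] with w hw
      exact hS1 w hw)
    have := d4.unique d6
    generalize deriv (fd c 1) (-1 / τ) = f3 at this ⊢
    simp at this
    field_simp at this
    linear_combination this
  have key := vanish (fun p => Mom c 3 3 p - 3 / (Real.pi * I) * (Mom c 3 1 p * (Real.pi * I * p))) (fun τ => fd c 3 τ - 3 / (Real.pi * I) * deriv (fd c 1) τ) 8 0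
    (fun τ ht => by
      refine hs_congr (fun n => ?_) ((h.fd_exp 3 ht).sub ((e_deriv (fun τ ht => h.fd_exp 1 (τ := τ) ht) ht).mul_left (3 / (Real.pi * I))))
      ring) (fun n hn => by rw [h.mom_even _ _ hn, h.mom_even _ _ hn]; ring) (fun n hn => by omega)
    (fun τ ht => by
      rw [hS3 τ ht, hd τ ht]; field_simp; ring) (Or.inr rfl)
  by_cases hp : 0 ≤ p
  · obtain ⟨n, rfl⟩ := Int.eq_ofNat_of_zero_le hp
    have := key n
    have e : 3 / ((Real.pi : ℂ) * I) * (Mom c 3 1 n * (Real.pi * I * n)) = 3 * n * Mom c 3 1 n := by field_simp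
    rw [e] at this
    push_cast
    exact sub_eq_zero.1 this
  · rw [Mom, Mom, Finset.sum_eq_zero, Finset.sum_eq_zero, mul_zero]
    all_goals
      intro q _
      rw [h.zero (by omega), mul_zero]

end SG

namespace SG

variable {F : (Fin 2 → Fin 2 → ℂ) → (Fin 25 → ℂ)}

def Z (F : (Fin 2 → Fin 2 → ℂ) → (Fin 25 → ℂ)) (M m : ℕ) : Prop := ∀ p q : ℤ, ∀ l : Fin 25, m ≤ (l:ℕ) → ca F ![p, q, M] l = 0

lemma Z_top (M : ℕ) : Z F M 25 := fun p q l hl => by omega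

lemma Z_step {M m : ℕ} (hz : Z F M (m + 1)) (h : ∀ hm : m < 25, ∀ p q : ℤ, ca F ![p, q, M] ⟨m, hm⟩ = 0) : Z F M m := by
  intro p q l hl
  rcases Nat.lt_or_ge m l with h1 | h1
  · exact hz p q l h1
  · have : m = l := le_antisymm hl h1
    subst this
    exact h l.2 p q

lemma Law.jac' (h : Law F) {M m : ℕ} (hz : Z F M (m + 1)) (hm : m < 25) :
    Jac (fun p q => ca F ![p, q, M] ⟨m, hm⟩) M (2 + (24 - m)) (fun τ z => phi F M τ z ⟨m, hm⟩) := by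
  refine Jac.intro (fun p q h0 => ?_) (fun τ z ht => h.phi_sum M z ht _) (fun τ z ht => ?_)
  · have h1 : ca F ![p, q, M] ≠ 0 := fun h1 => h0 (by rw [h1]; rfl)
    have h2 := h.supp h1
    exact ⟨h2.1, h2.2.2.1, h2.2.2.2.1⟩
  · exact h.jl M ⟨m, hm⟩ (fun p q l hl => hz p q l hl) z ht

lemma Law.lsh (h : Law F) {M m : ℕ} (hz : Z F M (m + 1)) (hm : m < 25) (p q : ℤ) :
    ca F ![p, q, M] ⟨m, hm⟩ = - ca F ![p + q + M, q + 2 * M, M] ⟨m, hm⟩ := by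
  have := lead (v := ca F ![p + q + M, q + 2 * M, M]) (w := ca F ![p, q, M]) (a := 1) (b := -1) (c := 1) (d := -1) ⟨m, hm⟩
    (fun l hl => hz _ _ l hl) (fun y => by rw [h.rL p q M 1 y, sub_eq_neg_add]; ring)
  simpa using this

lemma Law.par (h : Law F) (p q s : ℤ) (i : Fin 25) : ca F ![p, q, s] i = (-1) ^ (i:ℕ) * ca F ![p, -q, s] i := by
  have : ca F ![p, q, s] = fun i : Fin 25 => (-1) ^ (i:ℕ) * ca F ![p, -q, s] i := by
    refine form_ext fun y => ?_
    rw [h.rD]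
    refine Finset.sum_congr rfl fun i _ => ?_
    have e : (-1 : ℂ) ^ (24 - (i:ℕ)) = (-1) ^ (i:ℕ) := by
      have h1 : (-1 : ℂ) ^ (24 - (i:ℕ)) * (-1) ^ (i:ℕ) = 1 := by
        rw [← pow_add, Nat.sub_add_cancel (by omega)]; norm_num
      have h2 : (-1 : ℂ) ^ (i:ℕ) * (-1) ^ (i:ℕ) = 1 := by rw [← pow_add, ← two_mul, pow_mul]; norm_num
      linear_combination (-1 : ℂ) ^ (i:ℕ) * h1 - (-1 : ℂ) ^ (24 - (i:ℕ)) * h2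
    rw [e]; simp; ring
  exact congrFun this i

lemma Law.core (h : Law F) {M m : ℕ} (hz : Z F M (m + 1)) (hm : m < 25)
    (hc : ∀ p : ℤ, (∀ q : ℤ, (M:ℤ) < |q| → ca F ![p, q, M] ⟨m, hm⟩ = 0) → ∀ q : ℤ, |q| ≤ M → ca F ![p, q, M] ⟨m, hm⟩ = 0) :
    ∀ p q : ℤ, ca F ![p, q, M] ⟨m, hm⟩ = 0 := by
  have key : ∀ n : ℕ, ∀ p : ℤ, p ≤ n → ∀ q : ℤ, ca F ![p, q, M] ⟨m, hm⟩ = 0 := by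
    intro n
    induction n with
    | zero => intro p hp q; rw [h.posp p q M (by simpa using hp)]; rfl
    | succ n ih =>
      intro p hp q
      have h1 : ∀ q : ℤ, (M:ℤ) < |q| → ca F ![p, q, M] ⟨m, hm⟩ = 0 := by
        intro q hq
        rcases lt_abs.1 hq with h2 | h2
        · have := h.lsh hz hm (p - q + M) (q - 2 * M)
          rw [show p - q + M + (q - 2 * M) + M = p by ring, show q - 2 * (M:ℤ) + 2 * M = q by ring,
            ih _ (by push_cast at hp; omega)] at this
          exact neg_eq_zero.1 this.symm
        · rw [h.lsh hz hm p q, ih _ (by push_cast at hp; omega), neg_zero]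
      rcases le_or_gt |q| (M:ℤ) with h2 | h2
      · exact hc p h1 q h2
      · exact h1 q h2
  intro p q
  exact key p.toNat p (Int.self_le_toNat p) q

lemma Law.mom_par (h : Law F) {M m : ℕ} (hm : m < 25) (d : ℕ) (hd : ¬ Even (d + m)) (p : ℤ) :
    Mom (fun p q => ca F ![p, q, M] ⟨m, hm⟩) M d p = 0 := by
  have : Mom (fun p q => ca F ![p, q, M] ⟨m, hm⟩) M d p = - Mom (fun p q => ca F ![p, q, M] ⟨m, hm⟩) M d p := by
    conv_lhs => rw [Mom]
    rw [Mom, ← Finset.sum_neg_distrib]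
    refine Finset.sum_nbij' (fun q => -q) (fun q => -q) ?_ ?_ (fun _ _ => neg_neg _) (fun _ _ => neg_neg _) ?_
    · intro q hq; rw [Finset.mem_Ioo] at hq ⊢; omega
    · intro q hq; rw [Finset.mem_Ioo] at hq ⊢; omega
    · intro q _
      rw [h.par p q M]
      push_cast
      rw [neg_pow (q:ℂ)]
      have : (-1 : ℂ) ^ d * (-1) ^ m = -1 := by rw [← pow_add]; exact Odd.neg_one_pow (Nat.not_even_iff_odd.1 hd)
      have h2 : (-1 : ℂ) ^ d * (-1) ^ d = 1 := by rw [← pow_add, ← two_mul, pow_mul]; norm_num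
      linear_combination ((-1 : ℂ) ^ d * (q:ℂ)^d * ca F ![p, -q, M] ⟨m, hm⟩) * this - (-1 : ℂ) ^ m * (q:ℂ)^d * ca F ![p, -q, M] ⟨m, hm⟩ * h2
  linear_combination (1/2 : ℂ) * this

lemma mom_poly {c : ℤ → ℤ → ℂ} {M : ℕ} {p : ℤ} (h0 : ∀ d ≤ M, Mom c M d p = 0) (P : Polynomial ℂ) (hP : P.natDegree ≤ M) :
    ∑ q ∈ Finset.Ioo (-(p + M)) (p + M), P.eval (q:ℂ) * c p q = 0 := by
  simp_rw [Polynomial.eval_eq_sum_range, Finset.sum_mul]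
  rw [Finset.sum_comm]
  refine Finset.sum_eq_zero fun d hd => ?_
  rw [Finset.mem_range] at hd
  have := h0 d (by omega)
  rw [Mom] at this
  calc _ = P.coeff d * ∑ q ∈ Finset.Ioo (-(p + M)) (p + M), (q : ℂ) ^ d * c p q := by
        rw [Finset.mul_sum]; exact Finset.sum_congr rfl fun q _ => by ring
    _ = 0 := by rw [this, mul_zero]

lemma Law.L3 (h : Law F) {M m : ℕ} (hM : Odd M) (hz : Z F M (m + 1)) (hm : m < 25)
    (h0 : ∀ d ≤ M, ∀ p, Mom (fun p q => ca F ![p, q, M] ⟨m, hm⟩) M d p = 0) :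
    ∀ p q : ℤ, ca F ![p, q, M] ⟨m, hm⟩ = 0 := by
  refine h.core hz hm fun p hp q0 hq0 => ?_
  by_contra hne
  let S : Finset ℤ := (Finset.range (M + 1)).image fun i : ℕ => 2 * (i:ℤ) - M
  have hS : ∀ q : ℤ, Odd q → |q| ≤ M → q ∈ S := by
    intro q h1 h2
    obtain ⟨a, ha⟩ := h1
    obtain ⟨b, hb⟩ := hM
    rw [abs_le] at h2
    refine Finset.mem_image.2 ⟨((q + M) / 2).toNat, Finset.mem_range.2 ?_, ?_⟩ <;> omega
  have hodd : ∀ q : ℤ, ca F ![p, q, M] ⟨m, hm⟩ ≠ 0 → Odd q := by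
    intro q h1
    have h2 : ca F ![p, q, M] ≠ 0 := fun h2 => h1 (by rw [h2]; rfl)
    exact (h.supp h2).2.2.2.2.1
  have hcard : S.card ≤ M + 1 := by
    refine Finset.card_image_le.trans ?_; simp
  have hmem := hS q0 (hodd q0 hne) hq0
  let P : Polynomial ℂ := ∏ r ∈ S.erase q0, (Polynomial.X - Polynomial.C (r:ℂ))
  have hP : P.natDegree ≤ M := by
    have : P.natDegree = (S.erase q0).card := by
      simp only [P]
      rw [Polynomial.natDegree_prod_of_monic _ _ fun r _ => Polynomial.monic_X_sub_C _]
      simp only [Polynomial.natDegree_X_sub_C, Finset.sum_const, smul_eq_mul, mul_one]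
    rw [this, Finset.card_erase_of_mem hmem]; omega
  have h1 := mom_poly (fun d hd => h0 d hd p) P hP
  have he : ∀ q : ℤ, P.eval (q:ℂ) = ∏ r ∈ S.erase q0, ((q:ℂ) - r) := by
    intro q; simp [P, Polynomial.eval_prod]
  rw [Finset.sum_eq_single q0] at h1
  · rcases mul_eq_zero.1 h1 with h2 | h2
    · rw [he, Finset.prod_eq_zero_iff] at h2
      obtain ⟨r, hr, h3⟩ := h2
      rw [sub_eq_zero] at h3
      exact (Finset.mem_erase.1 hr).1 (by exact_mod_cast h3.symm)
    · exact hne h2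
  · intro q _ hq
    by_cases h3 : ca F ![p, q, M] ⟨m, hm⟩ = 0
    · rw [h3, mul_zero]
    · have h4 : |q| ≤ M := by
        by_contra h4
        exact h3 (hp q (not_le.1 h4))
      rw [he, Finset.prod_eq_zero (Finset.mem_erase.2 ⟨hq, hS q (hodd q h3) h4⟩) (sub_self (q:ℂ)), zero_mul]
  · intro hq
    have := (h.jac' hz hm).zero' hq
    rw [this, mul_zero]

lemma Law.step (h : Law F) {M m : ℕ} (hM : Odd M) (hz : Z F M (m + 1)) (p0 : ℕ)
    (hp : ∀ hm : m < 25, ∀ p q : ℤ, p < p0 → ca F ![p, q, M] ⟨m, hm⟩ = 0)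
    (hk : ∀ d ≤ M, Even (d + m) → 2 + (24 - m) + d < 6 * p0 ∨ 2 + (24 - m) + d = 8) : Z F M m := by
  refine Z_step hz fun hm => h.L3 hM hz hm fun d => ?_
  induction d using Nat.strong_induction_on with
  | _ d ih =>
    intro hd
    by_cases hpar : Even (d + m)
    · refine (h.jac' hz hm).JV d p0 (fun d' hd' => ih d' hd' (by omega)) (fun p hp' => ?_) (hk d hd hpar)
      refine Finset.sum_eq_zero fun q _ => ?_
      dsimp only
      rw [hp hm _ _ (by exact_mod_cast hp'), mul_zero]
    · exact h.mom_par hm d hpar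

lemma Law.even1 (h : Law F) {m : ℕ} (hz : Z F 1 (m + 1)) (he : Even m) : Z F 1 m := by
  refine Z_step hz fun hm => h.core hz hm fun p _ q hq => ?_
  have h1 := h.lsh hz hm p (-1)
  have h2 := h.par p 1 1 ⟨m, hm⟩
  simp only [he.neg_one_pow, one_mul] at h2
  have e : ca F ![p, 1, 1] ⟨m, hm⟩ = 0 := by
    have h3 : ca F ![p, -1, 1] ⟨m, hm⟩ = - ca F ![p, 1, 1] ⟨m, hm⟩ := by
      have := h1
      norm_num at this
      exact this
    rw [h3] at h2
    linear_combination (1/2 : ℂ) * h2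
  rw [abs_le] at hq
  obtain ⟨h4, h5⟩ := hq
  push_cast at h4 h5 ⊢
  interval_cases q
  · rw [← h2, e]
  · rw [h.oddq _ _ _ (by decide)]; rfl
  · exact e

end SG

namespace SG

variable {F : (Fin 2 → Fin 2 → ℂ) → (Fin 25 → ℂ)}

lemma Law.sw (h : Law F) (p q s : ℤ) (i : Fin 25) : ca F ![p, q, s] i = - ca F ![s, q, p] (Fin.rev i) := by
  have : ca F ![p, q, s] = fun i : Fin 25 => - ca F ![s, q, p] (Fin.rev i) := by
    refine form_ext fun y => ?_
    rw [h.rW, form, form, ← Finset.sum_neg_distrib, ← Equiv.sum_comp Fin.revPerm]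
    refine Finset.sum_congr rfl fun i _ => ?_
    simp only [Fin.revPerm_apply, Fin.val_rev]
    have h1 : 24 - (25 - ((i:ℕ) + 1)) = i := by omega
    rw [h1]; simp
  exact congrFun this i

lemma X_dvd {v : Fin 25 → ℂ} {k : ℕ} (h : ∀ i : Fin 25, (i:ℕ) < k → v i = 0) (hk : k ≤ 25) : Polynomial.X ^ k ∣ pol v := by
  rw [Polynomial.X_pow_dvd_iff]
  intro d hd
  have := pol_coeff v ⟨d, by omega⟩
  rw [h _ hd] at this
  exact this

lemma pol_deg {v : Fin 25 → ℂ} {n : ℕ} (h : ∀ i : Fin 25, n < (i:ℕ) → v i = 0) : (pol v).natDegree ≤ n := by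
  refine Polynomial.natDegree_sum_le_of_forall_le _ _ fun i _ => ?_
  rcases Nat.lt_or_ge n i with h1 | h1
  · rw [h i h1]; simp
  · exact (Polynomial.natDegree_C_mul_X_pow_le _ _).trans h1

lemma sym_dvd {f : Polynomial ℂ} (hs : ∀ y, f.eval y = - f.eval (-1 - y)) {k : ℕ} (hd : Polynomial.X ^ k ∣ f) :
    (Polynomial.X + Polynomial.C 1) ^ k ∣ f := by
  obtain ⟨g, hg⟩ := hd
  refine ⟨-(-1) ^ k * g.comp (-1 - Polynomial.X), Polynomial.funext fun y => ?_⟩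
  rw [hs, hg]
  simp only [Polynomial.eval_mul, Polynomial.eval_pow, Polynomial.eval_X, Polynomial.eval_add, Polynomial.eval_C,
    Polynomial.eval_neg, Polynomial.eval_one, Polynomial.eval_comp, Polynomial.eval_sub]
  rw [show (-1 - y : ℂ) = (-1) * (y + 1) by ring, mul_pow]; ring

lemma Law.sym (h : Law F) (p : ℤ) (y : ℂ) : (pol (ca F ![p, 1, 1])).eval y = - (pol (ca F ![p, 1, 1])).eval (-1 - y) := by
  rw [pol_eval, pol_eval, h.rD, h.rL]
  norm_num
  have := form_hom (ca F ![p, 1, 1]) (-1) 1 (-1 - y)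
  norm_num at this
  rw [← this]

lemma cop {a b : ℂ} (h : a ≠ b) (m n : ℕ) : IsCoprime ((Polynomial.X + Polynomial.C a) ^ m) ((Polynomial.X + Polynomial.C b) ^ n) := by
  refine IsCoprime.pow ?_
  have := Polynomial.isCoprime_X_sub_C_of_isUnit_sub (R := ℂ) (a := -a) (b := -b) (IsUnit.mk0 _ (by
    intro h1; apply h; linear_combination -h1))
  simpa using this

lemma Law.small1 (h : Law F) {i : Fin 25} (h0 : ca F ![1, 1, 1] i = 0) (p q : ℤ) (hp : p < 3) : ca F ![p, q, 1] i = 0 := by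
  by_contra hne
  have h2 : ca F ![p, q, 1] ≠ 0 := fun h2 => hne (by rw [h2]; rfl)
  obtain ⟨a1, -, a3, ⟨u, hu⟩, ⟨w, hw⟩, -⟩ := h.supp h2
  have hp1 : p = 1 := by omega
  subst hp1
  have b1 : -2 < q := by nlinarith
  have b2 : q < 2 := by nlinarith
  have : q = 1 ∨ q = -1 := by omega
  rcases this with rfl | rfl
  · exact hne h0
  · rw [h.par] at hne
    apply hne
    rw [neg_neg, h0, mul_zero]

lemma Law.zA (h : Law F) (h21 : ca F ![1, 1, 1] 21 = 0) (h17 : ca F ![1, 1, 1] 17 = 0) : ca F ![1, 1, 1] = 0 ∧ Z F 1 16 := by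
  have o1 : Odd 1 := odd_one
  have p1 : ∀ m, ∀ hm : m < 25, ∀ p q : ℤ, p < ((1:ℕ):ℤ) → ca F ![p, q, ((1:ℕ):ℤ)] ⟨m, hm⟩ = 0 := by
    intro m hm p q hp; rw [h.posp _ _ _ (by push_cast at hp; omega)]; rfl
  have z24 := h.even1 (Z_top 1) (by decide)
  have z23 := h.step (m := 23) o1 z24 1 (p1 _) (by decide)
  have z22 := h.even1 z23 (by decide)
  have z21 := h.step (m := 21) o1 z22 3 (fun hm p q hp => h.small1 h21 p q hp) (by decide)
  have z20 := h.even1 z21 (by decide)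
  have z19 := h.step (m := 19) o1 z20 1 (p1 _) (by decide)
  have z18 := h.even1 z19 (by decide)
  have z17 := h.step (m := 17) o1 z18 3 (fun hm p q hp => h.small1 h17 p q hp) (by decide)
  have z16 := h.even1 z17 (by decide)
  refine ⟨?_, z16⟩
  have d1 : (pol (ca F ![1, 1, 1])).natDegree ≤ 15 := pol_deg fun i hi => z16 1 1 i hi
  have d2 : Polynomial.X ^ 9 ∣ pol (ca F ![1, 1, 1]) := X_dvd (fun i hi => by
    rw [h.sw, neg_eq_zero]
    exact z16 1 1 _ (by rw [Fin.val_rev]; omega)) (by norm_num)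
  have d3 := sym_dvd (h.sym 1) d2
  have c1 := cop (a := 0) (b := 1) (by norm_num) 9 9
  rw [Polynomial.C_0, add_zero] at c1
  have d4 := c1.mul_dvd d2 d3
  have d5 := Polynomial.eq_zero_of_dvd_of_natDegree_lt d4 (by
    rw [Polynomial.natDegree_mul (pow_ne_zero _ Polynomial.X_ne_zero) (pow_ne_zero _ (Polynomial.X_add_C_ne_zero _)),
      Polynomial.natDegree_X_pow, Polynomial.natDegree_pow, Polynomial.natDegree_X_add_C]
    omega)
  refine form_eq_zero fun y => ?_
  rw [← pol_eval, d5, Polynomial.eval_zero]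

lemma Law.ind1 (h : Law F) (p0 a : ℕ) (hp : ∀ p q : ℤ, p < p0 → ca F ![p, q, 1] = 0) (n : ℕ) (hn : ∀ m, a ≤ m → m < 25 → 27 - m < 6 * p0)
    (z : Z F 1 (a + n)) : Z F 1 a := by
  induction n with
  | zero => exact z
  | succ n ih =>
    refine ih ?_
    by_cases h1 : a + n < 25
    · refine h.step odd_one z p0 (fun hm p q hp' => ?_) (fun d hd _ => Or.inl ?_)
      · have := hp p q hp'
        exact congrFun this _
      · have := hn (a + n) (by omega) h1
        omega
    · exact fun p q l hl => by omega

lemma Law.z3 (h : Law F) (hA : ca F ![1, 1, 1] = 0) : Z F 3 21 := by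
  have o3 : Odd 3 := by decide
  have c3 : ca F ![1, 3, 3] = 0 := by
    refine h.zW (h.zLi ?_)
    norm_num; exact hA
  have c3' : ∀ i, ca F ![1, -3, 3] i = 0 := fun i => by rw [h.par, neg_neg, c3]; simp
  -- moment at 1
  have mo : ∀ m (hm : m < 25) d, Even (d + m) → Mom (fun p q => ca F ![p, q, ((3:ℕ):ℤ)] ⟨m, hm⟩) 3 d 1 = 2 * ca F ![1, 1, 3] ⟨m, hm⟩ := by
    intro m hm d hd
    have e : Finset.Ioo (-((1:ℤ) + ((3:ℕ):ℤ))) (1 + ((3:ℕ):ℤ)) = {-3, -2, -1, 0, 1, 2, 3} := by decide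
    have e2 : (((3:ℕ):ℤ)) = 3 := rfl
    rw [Mom, e, e2]
    rw [Finset.sum_insert (by decide), Finset.sum_insert (by decide), Finset.sum_insert (by decide), Finset.sum_insert (by decide),
      Finset.sum_insert (by decide), Finset.sum_insert (by decide), Finset.sum_singleton]
    rw [c3', c3, h.oddq 1 (-2) 3 (by decide), h.oddq 1 0 3 (by decide), h.oddq 1 2 3 (by decide), h.par 1 (-1) 3]
    have : (-1 : ℂ) ^ d * (-1) ^ m = 1 := by rw [← pow_add]; exact hd.neg_one_pow
    simp
    linear_combination ca F ![1, 1, 3] ⟨m, hm⟩ * this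
  have sm : ∀ m (hm : m < 25), ca F ![1, 1, 3] ⟨m, hm⟩ = 0 → ∀ p q : ℤ, p < ((3:ℕ):ℤ) → ca F ![p, q, ((3:ℕ):ℤ)] ⟨m, hm⟩ = 0 := by
    intro m hm h0 p q hp
    by_contra hne
    have h2 : ca F ![p, q, ((3:ℕ):ℤ)] ≠ 0 := fun h2 => hne (by rw [h2]; rfl)
    obtain ⟨a1, -, a3, ⟨u, hu⟩, ⟨w, hw⟩, -⟩ := h.supp h2
    push_cast at hp a3
    have hp1 : p = 1 := by omega
    subst hp1
    have b1 : -4 < q := by nlinarith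
    have b2 : q < 4 := by nlinarith
    have : q = 1 ∨ q = -1 ∨ q = 3 ∨ q = -3 := by omega
    rcases this with rfl | rfl | rfl | rfl
    · exact hne h0
    · rw [h.par] at hne
      apply hne
      rw [neg_neg]
      exact mul_eq_zero_of_right _ h0
    · exact hne (congrFun c3 _)
    · exact hne (c3' _)
  have p1 : ∀ m, ∀ hm : m < 25, ∀ p q : ℤ, p < ((1:ℕ):ℤ) → ca F ![p, q, ((3:ℕ):ℤ)] ⟨m, hm⟩ = 0 := by
    intro m hm p q hp; rw [h.posp _ _ _ (by push_cast at hp; omega)]; rfl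
  have m0 : ∀ m (hm : m < 25) (d p : ℕ), p < 1 → Mom (fun p q => ca F ![p, q, ((3:ℕ):ℤ)] ⟨m, hm⟩) 3 d p = 0 := by
    intro m hm d p hp
    refine Finset.sum_eq_zero fun q _ => ?_
    dsimp only
    rw [p1 m hm _ _ (by exact_mod_cast hp), mul_zero]
  have z24 := h.step (m := 24) o3 (Z_top 3) 1 (p1 _) (by decide)
  have z23 : Z F 3 23 := by
    refine h.step (m := 23) o3 z24 3 (fun hm => sm 23 hm ?_) (by decide)
    have h1 := (h.jac' z24 hm).JV 1 1 (fun d' hd' => by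
      interval_cases d'; exact h.mom_par hm 0 (by decide)) (m0 _ _ _) (by decide) 1
    rw [mo 23 hm 1 (by decide)] at h1
    simpa using h1
  have z22 : Z F 3 22 := by
    refine h.step (m := 22) o3 z23 3 (fun hm => sm 22 hm ?_) (by decide)
    have h1 := (h.jac' z23 hm).JV 0 1 (fun d' hd' => by omega) (m0 _ _ _) (by decide) 1
    rw [mo 22 hm 0 (by decide)] at h1
    simpa using h1
  refine h.step (m := 21) o3 z22 3 (fun hm => sm 21 hm ?_) (by decide)
  have h1 := (h.jac' z22 hm).heat (h.mom_par hm 0 (by decide)) (h.mom_par hm 2 (by decide)) 1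
  rw [mo 21 hm 3 (by decide), mo 21 hm 1 (by decide)] at h1
  push_cast at h1
  replace h1 : 2 * ca F ![1, 1, 3] ⟨21, hm⟩ = 3 * 1 * (2 * ca F ![1, 1, 3] ⟨21, hm⟩) := h1
  linear_combination (-1/4 : ℂ) * h1

lemma Law.z5 (h : Law F) : Z F 5 24 := by
  have o5 : Odd 5 := by decide
  have p1 : ∀ m, ∀ hm : m < 25, ∀ p q : ℤ, p < ((1:ℕ):ℤ) → ca F ![p, q, ((5:ℕ):ℤ)] ⟨m, hm⟩ = 0 := by
    intro m hm p q hp; rw [h.posp _ _ _ (by push_cast at hp; omega)]; rfl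
  have m0 : ∀ m (hm : m < 25) (d p : ℕ), p < 1 → Mom (fun p q => ca F ![p, q, ((5:ℕ):ℤ)] ⟨m, hm⟩) 5 d p = 0 := by
    intro m hm d p hp
    refine Finset.sum_eq_zero fun q _ => ?_
    dsimp only
    rw [p1 m hm _ _ (by exact_mod_cast hp), mul_zero]
  have hz : ca F ![1, 1, 5] 24 = 0 ∧ ca F ![1, 3, 5] 24 = 0 := by
    have hm : 24 < 25 := by norm_num
    have J := h.jac' (Z_top 5) hm
    have k0 := J.JV 0 1 (fun d' hd' => by omega) (m0 _ _ _) (by decide)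
    have k2 := J.JV 2 1 (fun d' hd' => by
      interval_cases d'
      · exact k0
      · exact h.mom_par hm 1 (by decide)) (m0 _ _ _) (by decide) 1
    have k0 := k0 1
    have e : Finset.Ioo (-((1:ℤ) + ((5:ℕ):ℤ))) (1 + ((5:ℕ):ℤ)) = {-5, -4, -3, -2, -1, 0, 1, 2, 3, 4, 5} := by decide
    have e2 : (((5:ℕ):ℤ)) = 5 := rfl
    have mo : ∀ d, Mom (fun p q => ca F ![p, q, ((5:ℕ):ℤ)] ⟨24, hm⟩) 5 d 1 = (1 + (-1) ^ d) * (ca F ![1, 1, 5] 24 + 3 ^ d * ca F ![1, 3, 5] 24) := by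
      intro d
      rw [Mom, e, e2]
      rw [Finset.sum_insert (by decide), Finset.sum_insert (by decide), Finset.sum_insert (by decide), Finset.sum_insert (by decide),
        Finset.sum_insert (by decide), Finset.sum_insert (by decide), Finset.sum_insert (by decide), Finset.sum_insert (by decide),
        Finset.sum_insert (by decide), Finset.sum_insert (by decide), Finset.sum_singleton]
      rw [h.oddq 1 (-4) 5 (by decide), h.oddq 1 (-2) 5 (by decide), h.oddq 1 0 5 (by decide), h.oddq 1 2 5 (by decide),
        h.oddq 1 4 5 (by decide), h.disc 11 1 5 5 (by norm_num) (by norm_num), h.disc 11 1 (-5) 5 (by norm_num) (by norm_num),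
        h.par 1 (-1) 5, h.par 1 (-3) 5]
      have e3 : ((-3 : ℤ) : ℂ) ^ d = (-1) ^ d * 3 ^ d := by rw [← mul_pow]; norm_num
      have e4 : (⟨24, hm⟩ : Fin 25) = 24 := rfl
      rw [e3, e4]
      simp
      ring
    rw [mo] at k0 k2
    constructor
    · linear_combination (9/16 : ℂ) * k0 - (1/16 : ℂ) * k2
    · linear_combination -(1/16 : ℂ) * k0 + (1/16 : ℂ) * k2
  refine h.step (m := 24) o5 (Z_top 5) 3 (fun hm p q hp => ?_) (by decide)
  by_contra hne
  have h2 : ca F ![p, q, ((5:ℕ):ℤ)] ≠ 0 := fun h2 => hne (by rw [h2]; rfl)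
  obtain ⟨a1, -, a3, ⟨u, hu⟩, ⟨w, hw⟩, -⟩ := h.supp h2
  push_cast at hp a3
  have hp1 : p = 1 := by omega
  subst hp1
  have b1 : -5 < q := by nlinarith
  have b2 : q < 5 := by nlinarith
  have : q = 1 ∨ q = -1 ∨ q = 3 ∨ q = -3 := by omega
  rcases this with rfl | rfl | rfl | rfl
  · exact hne hz.1
  · rw [h.par] at hne
    exact hne (mul_eq_zero_of_right _ hz.1)
  · exact hne hz.2
  · rw [h.par] at hne
    exact hne (mul_eq_zero_of_right _ hz.2)

lemma fac {f : Polynomial ℂ} (d1 : f.natDegree ≤ 9) (d2 : Polynomial.X ^ 4 ∣ f) (d3 : (Polynomial.X + Polynomial.C 1) ^ 4 ∣ f)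
    (e1 : f.eval 1 = 0) (e2 : f.eval (-2) = 0) : f = 0 := by
  have d4 : (Polynomial.X + Polynomial.C (-1)) ^ 1 ∣ f := by
    rw [pow_one, Polynomial.C_neg, ← sub_eq_add_neg, Polynomial.dvd_iff_isRoot]; exact e1
  have d5 : (Polynomial.X + Polynomial.C 2) ^ 1 ∣ f := by
    rw [pow_one, ← neg_neg (2 : ℂ), Polynomial.C_neg, ← sub_eq_add_neg, Polynomial.dvd_iff_isRoot]; exact e2
  have d2' : (Polynomial.X + Polynomial.C (0:ℂ)) ^ 4 ∣ f := by
    have e : (Polynomial.X + Polynomial.C (0:ℂ)) = Polynomial.X := by simp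
    rw [e]; exact d2
  have n01 : (0:ℂ) ≠ 1 := by norm_num
  have n12 : (-1:ℂ) ≠ 2 := by norm_num
  have m1 : (0:ℂ) ≠ -1 := by norm_num
  have m2 : (0:ℂ) ≠ 2 := by norm_num
  have m3 : (1:ℂ) ≠ -1 := by norm_num
  have m4 : (1:ℂ) ≠ 2 := by norm_num
  have d6 := (cop n01 4 4).mul_dvd d2' d3
  have d7 := (cop n12 1 1).mul_dvd d4 d5
  have cc := IsCoprime.mul_left (IsCoprime.mul_right (cop m1 4 1) (cop m2 4 1)) (IsCoprime.mul_right (cop m3 4 1) (cop m4 4 1))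
  have d8 := cc.mul_dvd d6 d7
  have nz : ∀ (a : ℂ) (n : ℕ), (Polynomial.X + Polynomial.C a) ^ n ≠ 0 := fun a n => pow_ne_zero _ (Polynomial.X_add_C_ne_zero _)
  have nd : ∀ (a : ℂ) (n : ℕ), ((Polynomial.X + Polynomial.C a) ^ n).natDegree = n := fun a n => by
    rw [Polynomial.natDegree_pow, Polynomial.natDegree_X_add_C, mul_one]
  refine Polynomial.eq_zero_of_dvd_of_natDegree_lt d8 ?_
  rw [Polynomial.natDegree_mul (mul_ne_zero (nz _ _) (nz _ _)) (mul_ne_zero (nz _ _) (nz _ _)),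
    Polynomial.natDegree_mul (nz _ _) (nz _ _), Polynomial.natDegree_mul (nz _ _) (nz _ _), nd, nd, nd, nd]
  omega

lemma Law.zB (h : Law F) (hA : ca F ![1, 1, 1] = 0) (z16 : Z F 1 16) : ca F ![3, 1, 1] = 0 := by
  have hp3 : ∀ p q : ℤ, p < ((3:ℕ):ℤ) → ca F ![p, q, 1] = 0 := fun p q hp => funext fun i =>
    h.small1 (congrFun hA i) p q hp
  have z10 : Z F 1 10 := by
    have s3 : ∀ {m}, Z F 1 (m + 1) → 27 - m < 18 → Z F 1 m := fun {m} z hm =>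
      h.step odd_one z 3 (fun hm p q hp' => congrFun (hp3 p q hp') _) (fun d hd _ => Or.inl (by omega))
    have z15 := s3 z16 (by norm_num)
    have z14 := s3 z15 (by norm_num)
    have z13 := s3 z14 (by norm_num)
    have z12 := s3 z13 (by norm_num)
    have z11 := s3 z12 (by norm_num)
    exact h.even1 z11 (by decide)
  have d1 : (pol (ca F ![3, 1, 1])).natDegree ≤ 9 := pol_deg fun i hi => z10 3 1 i hi
  have d2 : Polynomial.X ^ 4 ∣ pol (ca F ![3, 1, 1]) := X_dvd (fun i hi => by
    rw [h.sw, neg_eq_zero]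
    exact h.z3 hA 1 1 _ (by rw [Fin.val_rev]; omega)) (by norm_num)
  have d3 := sym_dvd (h.sym 3) d2
  have e1 : (pol (ca F ![3, 1, 1])).eval 1 = 0 := by
    have h1 := h.rLi 5 3 1 1 0
    norm_num at h1
    rw [pol_eval]
    have h2 : form (ca F ![5, 3, 1]) 1 0 = ca F ![5, 3, 1] 0 := by
      rw [form, Finset.sum_eq_single 0]
      · simp
      · intro i _ hi
        have : (i:ℕ) ≠ 0 := fun h0 => hi (Fin.ext h0)
        rw [zero_pow this]; simp
      · simp
    have h5 : ca F ![1, 3, 5] (Fin.rev 0) = 0 := h.z5 1 3 (Fin.rev 0) (by decide)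
    rw [h2, h.sw, h5] at h1
    linear_combination h1
  have e2 : (pol (ca F ![3, 1, 1])).eval (-2) = 0 := by
    rw [h.sym]; norm_num; exact e1
  have d9 := fac d1 d2 d3 e1 e2
  refine form_eq_zero fun y => ?_
  rw [← pol_eval, d9, Polynomial.eval_zero]

lemma Law.z1 (h : Law F) (hA : ca F ![1, 1, 1] = 0) (hB : ca F ![3, 1, 1] = 0) : Z F 1 0 := by
  refine h.ind1 5 0 (fun p q hp => ?_) 25 (fun m h1 h2 => by omega) (Z_top 1)
  by_contra hne
  obtain ⟨a1, -, a3, ⟨u, hu⟩, ⟨w, hw⟩, -⟩ := h.supp hne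
  push_cast at hp
  have hB' : ca F ![3, -1, 1] = 0 := funext fun i => by rw [h.par, neg_neg, hB]; simp
  have hC : ca F ![3, 3, 1] = 0 := h.zLi (by norm_num; exact hA)
  have hC' : ca F ![3, -3, 1] = 0 := funext fun i => by rw [h.par, neg_neg, hC]; simp
  have : p = 1 ∨ p = 3 := by omega
  rcases this with rfl | rfl
  · exact hne (funext fun i => h.small1 (congrFun hA i) 1 q (by norm_num))
  · have b1 : -4 < q := by nlinarith
    have b2 : q < 4 := by nlinarith
    have : q = 1 ∨ q = -1 ∨ q = 3 ∨ q = -3 := by omega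
    rcases this with rfl | rfl | rfl | rfl
    · exact hne hB
    · exact hne hB'
    · exact hne hC
    · exact hne hC'

lemma Law.main (h : Law F) (h21 : ca F ![1, 1, 1] 21 = 0) (h17 : ca F ![1, 1, 1] 17 = 0) (p q s : ℤ) : ca F ![p, q, s] = 0 := by
  obtain ⟨hA, z16⟩ := h.zA h21 h17
  have hB := h.zB hA z16
  have hz1 := h.z1 hA hB
  have key : ∀ M : ℕ, Z F M 0 := by
    intro M
    induction M using Nat.strong_induction_on with
    | _ M ih =>
      by_cases hM : Even M
      · intro p q l _; rw [h.odds _ _ _ (by exact_mod_cast hM)]; rfl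
      rw [Nat.not_even_iff_odd] at hM
      by_cases hM1 : M = 1
      · rw [hM1]; exact hz1
      have hM3 : 3 ≤ M := by obtain ⟨u, hu⟩ := hM; omega
      have lo : ∀ p q : ℤ, p < M → ca F ![p, q, M] = 0 := by
        intro p q hp
        by_cases h0 : p ≤ 0
        · exact h.posp _ _ _ h0
        · obtain ⟨n, rfl⟩ := Int.eq_ofNat_of_zero_le (by omega : 0 ≤ p)
          exact h.zW (funext fun l => ih n (by exact_mod_cast hp) _ _ l (Nat.zero_le _))
      have s1 : ∀ n, n ≤ 13 → Z F M (25 - n) := by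
        intro n
        induction n with
        | zero => intro _; exact Z_top M
        | succ n ihn =>
          intro hn
          have := ihn (by omega)
          rw [show 25 - n = 25 - (n + 1) + 1 by omega] at this
          refine h.step hM this M (fun hm p q hp => congrFun (lo p q hp) _) (fun d hd _ => Or.inl (by omega))
      have z12 := s1 13 le_rfl
      have hT : ∀ q : ℤ, ca F ![M, q, M] = 0 := by
        intro q
        funext i
        rcases Nat.lt_or_ge i 12 with h1 | h1
        · rw [h.sw, z12 _ _ _ (by rw [Fin.val_rev]; omega)]; simp
        · exact z12 _ _ _ h1
      have s2 : ∀ n, n ≤ 25 → Z F M (25 - n) := by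
        intro n
        induction n with
        | zero => intro _; exact Z_top M
        | succ n ihn =>
          intro hn
          have := ihn (by omega)
          rw [show 25 - n = 25 - (n + 1) + 1 by omega] at this
          refine h.step hM this (M + 2) (fun hm p q hp => ?_) (fun d hd _ => Or.inl (by omega))
          push_cast at hp
          have : p < M ∨ p = M ∨ p = M + 1 := by omega
          rcases this with h1 | rfl | rfl
          · exact congrFun (lo p q h1) _
          · exact congrFun (hT q) _
          · rw [h.oddp]
            · rfl
            · have : Odd (M:ℤ) := by exact_mod_cast hM
              exact this.add_one
      exact s2 25 le_rfl
  by_cases h0 : s ≤ 0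
  · exact h.poss _ _ _ h0
  · obtain ⟨n, rfl⟩ := Int.eq_ofNat_of_zero_le (by omega : 0 ≤ s)
    exact funext fun l => key n p q l (Nat.zero_le _)

end SG

namespace SG

abbrev V4 := Fin 4 → ℤ
abbrev VV := V4 × V4

lemma hs_pi (n : ℕ) (g : Fin n → ℤ → ℂ) (hg : ∀ j, Summable (fun u => ‖g j u‖)) :
    Summable (fun x : Fin n → ℤ => ‖∏ j, g j (x j)‖) ∧
    HasSum (fun x : Fin n → ℤ => ∏ j, g j (x j)) (∏ j, ∑' u, g j u) := by
  induction n with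
  | zero =>
    refine ⟨(hasSum_fintype _).summable, ?_⟩
    simp
  | succ n ih =>
    obtain ⟨h1, h2⟩ := ih (fun j => g j.succ) (fun j => hg _)
    let e : ℤ × (Fin n → ℤ) ≃ (Fin (n + 1) → ℤ) := Fin.consEquiv (fun _ => ℤ)
    have he : ∀ p : ℤ × (Fin n → ℤ), ∏ j, g j (e p j) = g 0 p.1 * ∏ j, g (Fin.succ j) (p.2 j) := by
      intro p
      rw [Fin.prod_univ_succ]
      rfl
    have h3 := summable_mul_of_summable_norm (hg 0) h1
    have h4 : Summable (fun p : ℤ × (Fin n → ℤ) => ‖g 0 p.1 * ∏ j, g (Fin.succ j) (p.2 j)‖) := by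
      simpa only [norm_mul] using (hg 0).mul_of_nonneg h1 (fun _ => norm_nonneg _) (fun _ => norm_nonneg _)
    constructor
    · rw [← e.summable_iff]
      refine h4.congr fun p => ?_
      show _ = ‖∏ j, g j (e p j)‖
      rw [he]
    · rw [← e.hasSum_iff, Fin.prod_univ_succ, ← h2.tsum_eq, tsum_mul_tsum_of_summable_norm (hg 0) h1]
      exact hs_congr (fun p => (he p).symm) h3.hasSum

/-- inner product -/
def dt (x y : V4) : ℤ := ∑ j, x j * y j
def ad (a : Fin 4 → ℂ) (x : V4) : ℂ := ∑ j, a j * x j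

def ex (p q r : ℂ) (z : VV) : ℂ :=
  cexp (Real.pi * I / 4 * (p * dt z.1 z.1 + 2 * q * dt z.1 z.2 + r * dt z.2 z.2))

def l1 (z : VV) : ℝ := ∑ j, (|(z.1 j : ℝ)| + |(z.2 j : ℝ)|)

lemma l1_nn (z) : 0 ≤ l1 z := Finset.sum_nonneg fun _ _ => by positivity

def bd (C δ : ℝ) (z : VV) : ℝ :=
  ∏ j, Real.exp (C * |(z.1 j : ℝ)| - δ * (z.1 j : ℝ) ^ 2) * Real.exp (C * |(z.2 j : ℝ)| - δ * (z.2 j : ℝ) ^ 2)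

lemma bd1 (C : ℝ) {δ : ℝ} (hδ : 0 < δ) : Summable (fun u : ℤ => Real.exp (C * |(u : ℝ)| - δ * (u : ℝ) ^ 2)) := by
  refine Summable.of_nonneg_of_le (fun _ => (Real.exp_pos _).le) (fun u => ?_)
    ((sum_exp_int one_pos).mul_left (Real.exp ((C + 1) ^ 2 / (4 * δ))))
  rw [← Real.exp_add, Real.exp_le_exp]
  have h : (C + 1) * |(u : ℝ)| - δ * |(u : ℝ)| ^ 2 ≤ (C + 1) ^ 2 / (4 * δ) := by
    rw [le_div_iff₀ (by positivity)]
    nlinarith [sq_nonneg (2 * δ * |(u : ℝ)| - (C + 1))]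
  rw [sq_abs] at h
  linarith

lemma bd_sum (C : ℝ) {δ : ℝ} (hδ : 0 < δ) : Summable (bd C δ) := by
  have h := (hs_pi 4 (fun _ u => ((Real.exp (C * |(u : ℝ)| - δ * (u : ℝ) ^ 2) : ℝ) : ℂ))
    (fun _ => by simpa only [Complex.norm_real, Real.norm_eq_abs, Real.abs_exp] using bd1 C hδ)).1
  refine (h.mul_of_nonneg h (fun _ => norm_nonneg _) (fun _ => norm_nonneg _)).congr fun z => ?_
  simp only [norm_prod, Complex.norm_real, Real.norm_eq_abs, Real.abs_exp, bd, Finset.prod_mul_distrib]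

lemma bd_eq (C δ : ℝ) (z : VV) : bd C δ z = Real.exp (C * l1 z - δ * (dt z.1 z.1 + dt z.2 z.2)) := by
  simp only [bd, ← Real.exp_add, ← Real.exp_sum, l1, dt]
  congr 1
  push_cast
  rw [← Finset.sum_add_distrib, Finset.mul_sum, Finset.mul_sum, ← Finset.sum_sub_distrib]
  exact Finset.sum_congr rfl fun j _ => by ring

lemma ex_norm (p q r : ℂ) (z : VV) : ‖ex p q r z‖ =
    Real.exp (-(Real.pi / 4) * (p.im * dt z.1 z.1 + 2 * q.im * dt z.1 z.2 + r.im * dt z.2 z.2)) := by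
  rw [ex, Complex.norm_exp]
  congr 1
  have : (Real.pi : ℂ) * I / 4 * (p * dt z.1 z.1 + 2 * q * dt z.1 z.2 + r * dt z.2 z.2) =
    ((Real.pi / 4 : ℝ) : ℂ) * (I * (p * ((dt z.1 z.1 : ℝ) : ℂ) + ((2 : ℝ) : ℂ) * q * ((dt z.1 z.2 : ℝ) : ℂ) + r * ((dt z.2 z.2 : ℝ) : ℂ))) := by
    push_cast; ring
  rw [this]
  simp [-Complex.ofReal_ofNat, -Complex.ofReal_intCast]
  ring

lemma ex_bound {p q r : ℂ} (h : mk p q r ∈ H2) : ∃ δ > 0, ∀ p' q' r' : ℂ, ‖p' - p‖ ≤ δ → ‖q' - q‖ ≤ δ →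
    ‖r' - r‖ ≤ δ → ∀ z, ‖ex p' q' r' z‖ ≤ Real.exp (-δ * (dt z.1 z.1 + dt z.2 z.2)) := by
  rw [mk_mem] at h
  obtain ⟨h1, h2⟩ := h
  have h3 : 0 < r.im := by
    by_contra h3
    nlinarith [sq_nonneg q.im]
  set δ := (p.im * r.im - q.im ^ 2) / (p.im + r.im) / 4 with hδ
  have h4 : 0 < δ := by
    have : 0 < p.im * r.im - q.im ^ 2 := by linarith
    positivity
  refine ⟨δ / 2, by positivity, fun p' q' r' hp hq hr z => ?_⟩
  rw [ex_norm, Real.exp_le_exp]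
  have key : 2 * δ * (dt z.1 z.1 + dt z.2 z.2) ≤ p'.im * dt z.1 z.1 + 2 * q'.im * dt z.1 z.2 + r'.im * dt z.2 z.2 := by
    have hp' : |p'.im - p.im| ≤ δ / 2 := (Complex.abs_im_le_norm (p' - p)).trans hp
    have hq' : |q'.im - q.im| ≤ δ / 2 := (Complex.abs_im_le_norm (q' - q)).trans hq
    have hr' : |r'.im - r.im| ≤ δ / 2 := (Complex.abs_im_le_norm (r' - r)).trans hr
    rw [abs_le] at hp' hq' hr'
    simp only [dt]
    push_cast
    rw [← Finset.sum_add_distrib, Finset.mul_sum, Finset.mul_sum, Finset.mul_sum, Finset.mul_sum,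
      ← Finset.sum_add_distrib, ← Finset.sum_add_distrib]
    refine Finset.sum_le_sum fun j _ => ?_
    generalize (z.1 j : ℝ) = x
    generalize (z.2 j : ℝ) = y
    have e1 : 4 * δ * (x ^ 2 + y ^ 2) ≤ p.im * x ^ 2 + 2 * q.im * (x * y) + r.im * y ^ 2 := by
      rw [hδ, mul_div_cancel₀ _ (by norm_num : (4 : ℝ) ≠ 0), div_mul_eq_mul_div, div_le_iff₀ (by positivity)]
      nlinarith [sq_nonneg (p.im * x + q.im * y), sq_nonneg (q.im * x + r.im * y)]
    have e2 : -(δ / 2) * x ^ 2 ≤ (p'.im - p.im) * x ^ 2 := mul_le_mul_of_nonneg_right hp'.1 (sq_nonneg x)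
    have e3 : -(δ / 2) * y ^ 2 ≤ (r'.im - r.im) * y ^ 2 := mul_le_mul_of_nonneg_right hr'.1 (sq_nonneg y)
    have e4 : -(δ / 2) * (x ^ 2 + y ^ 2) ≤ (q'.im - q.im) * (2 * (x * y)) := by
      nlinarith [mul_nonneg (by linarith [hq'.1] : 0 ≤ q'.im - q.im + δ / 2) (sq_nonneg (x + y)),
        mul_nonneg (by linarith [hq'.2] : 0 ≤ δ / 2 - (q'.im - q.im)) (sq_nonneg (x - y))]
    nlinarith [sq_nonneg x, sq_nonneg y]
  have h5 : (0 : ℝ) ≤ dt z.1 z.1 + dt z.2 z.2 := by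
    simp only [dt]; push_cast; rw [← Finset.sum_add_distrib]
    exact Finset.sum_nonneg fun j _ => by nlinarith [sq_nonneg (z.1 j : ℝ), sq_nonneg (z.2 j : ℝ)]
  have := Real.pi_gt_three
  nlinarith [mul_nonneg h4.le h5, mul_le_mul_of_nonneg_left key (by positivity : 0 ≤ Real.pi / 4),
    mul_nonneg (by linarith : 0 ≤ Real.pi - 3) (mul_nonneg h4.le h5)]

lemma ex_bound' {p q r : ℂ} (h : mk p q r ∈ H2) (C : ℝ) : ∃ δ > 0, ∃ u : VV → ℝ, Summable u ∧
    ∀ p' q' r' : ℂ, ‖p' - p‖ ≤ δ → ‖q' - q‖ ≤ δ →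
    ‖r' - r‖ ≤ δ → ∀ z, Real.exp (C * l1 z) * ‖ex p' q' r' z‖ ≤ u z := by
  obtain ⟨δ, h0, h1⟩ := ex_bound h
  refine ⟨δ, h0, bd C δ, bd_sum C h0, fun p' q' r' hp hq hr z => ?_⟩
  rw [bd_eq, sub_eq_add_neg, Real.exp_add, ← neg_mul]
  exact mul_le_mul_of_nonneg_left (h1 p' q' r' hp hq hr z) (Real.exp_pos _).le

lemma ex_sum {p q r : ℂ} (h : mk p q r ∈ H2) (C : ℝ) : Summable (fun z => Real.exp (C * l1 z) * ‖ex p q r z‖) := by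
  obtain ⟨δ, h0, u, hu, h1⟩ := ex_bound' h C
  refine Summable.of_nonneg_of_le (fun _ => by positivity) (fun z => ?_) hu
  exact h1 p q r (by simpa using h0.le) (by simpa using h0.le) (by simpa using h0.le) z

lemma ad_le (a : Fin 4 → ℂ) : ∃ A : ℝ, 0 ≤ A ∧ ∀ z : VV, ‖ad a z.1‖ ≤ A * l1 z ∧ ‖ad a z.2‖ ≤ A * l1 z := by
  have h : ∀ j, ‖a j‖ ≤ ∑ j, ‖a j‖ := fun j => Finset.single_le_sum (f := fun j => ‖a j‖) (fun _ _ => norm_nonneg _) (Finset.mem_univ j)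
  refine ⟨∑ j, ‖a j‖, by positivity, fun z => ⟨?_, ?_⟩⟩ <;>
  · refine (norm_sum_le _ _).trans ?_
    rw [l1, Finset.mul_sum]
    refine Finset.sum_le_sum fun j _ => ?_
    rw [norm_mul, Complex.norm_intCast]
    refine mul_le_mul (h j) ?_ (abs_nonneg _) (by positivity)
    have := abs_nonneg (z.1 j : ℝ)
    have := abs_nonneg (z.2 j : ℝ)
    linarith
end SG

namespace SG

def Adm (φ : VV → ℂ) : Prop := ∃ K C : ℝ, 0 ≤ K ∧ 0 ≤ C ∧ ∀ z, ‖φ z‖ ≤ K * Real.exp (C * l1 z)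

def ser (φ : VV → ℂ) (p q r : ℂ) : ℂ := ∑' z, φ z * ex p q r z

lemma Adm.mul {φ ψ} (h : Adm φ) (h' : Adm ψ) : Adm (fun z => φ z * ψ z) := by
  obtain ⟨K, C, hK, hC, h⟩ := h
  obtain ⟨K', C', hK', hC', h'⟩ := h'
  refine ⟨K * K', C + C', by positivity, by positivity, fun z => ?_⟩
  rw [norm_mul, add_mul, Real.exp_add, mul_mul_mul_comm]
  exact mul_le_mul (h z) (h' z) (norm_nonneg _) (by positivity)

lemma Adm.pow {φ} (h : Adm φ) (n : ℕ) : Adm (fun z => φ z ^ n) := by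
  induction n with
  | zero => exact ⟨1, 0, by simp, le_rfl, fun z => by simp⟩
  | succ n ih => simpa only [pow_succ] using ih.mul h

lemma Adm.sm {φ : VV → ℂ} (h : Adm φ) {p q r : ℂ} (hm : mk p q r ∈ H2) : Summable (fun z => ‖φ z * ex p q r z‖) := by
  obtain ⟨K, C, hK, hC, h⟩ := h
  refine Summable.of_nonneg_of_le (fun _ => norm_nonneg _) (fun z => ?_) ((ex_sum hm C).mul_left K)
  rw [norm_mul, ← mul_assoc]
  exact mul_le_mul_of_nonneg_right (h z) (norm_nonneg _)

lemma Adm.hs {φ : VV → ℂ} (h : Adm φ) {p q r : ℂ} (hm : mk p q r ∈ H2) : HasSum (fun z => φ z * ex p q r z) (ser φ p q r) :=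
  (h.sm hm).of_norm.hasSum

lemma adm_of_le {φ : VV → ℂ} {A : ℝ} (hA : 0 ≤ A) (h : ∀ z, ‖φ z‖ ≤ A * l1 z) : Adm φ := by
  refine ⟨1, A, zero_le_one, hA, fun z => (h z).trans ?_⟩
  have := Real.add_one_le_exp (A * l1 z)
  linarith

lemma adm_ad1 (a) : Adm (fun z => ad a z.1) := by
  obtain ⟨A, hA, h⟩ := ad_le a
  exact adm_of_le hA fun z => (h z).1
lemma adm_ad2 (a) : Adm (fun z => ad a z.2) := by
  obtain ⟨A, hA, h⟩ := ad_le a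
  exact adm_of_le hA fun z => (h z).2

lemma dt_le (z : VV) (x y : V4) (hx : ∀ j, |(x j : ℝ)| ≤ |(z.1 j : ℝ)| + |(z.2 j : ℝ)|)
    (hy : ∀ j, |(y j : ℝ)| ≤ |(z.1 j : ℝ)| + |(z.2 j : ℝ)|) : |(dt x y : ℝ)| ≤ l1 z * l1 z := by
  simp only [dt]
  push_cast
  refine (Finset.abs_sum_le_sum_abs _ _).trans ?_
  conv_rhs => rw [l1, Finset.sum_mul]
  refine Finset.sum_le_sum fun j _ => ?_
  rw [abs_mul]
  refine mul_le_mul (hx j) ((hy j).trans ?_) (abs_nonneg _) (by positivity)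
  exact Finset.single_le_sum (f := fun j => |(z.1 j : ℝ)| + |(z.2 j : ℝ)|) (fun _ _ => by positivity) (Finset.mem_univ j)

abbrev MM := Fin 2 → Fin 2 → ℂ
def pr (i j : Fin 2) : MM →L[ℂ] ℂ :=
  (ContinuousLinearMap.proj j : (Fin 2 → ℂ) →L[ℂ] ℂ).comp (ContinuousLinearMap.proj i : MM →L[ℂ] (Fin 2 → ℂ))

lemma pr_norm (i j) : ‖pr i j‖ ≤ 1 := by
  refine ContinuousLinearMap.opNorm_le_bound _ zero_le_one fun τ => ?_
  rw [one_mul]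
  exact (norm_le_pi_norm (τ i) j).trans (norm_le_pi_norm τ i)

lemma nsm (c : ℂ) (L : MM →L[ℂ] ℂ) : ‖c • L‖ = ‖c‖ * ‖L‖ := norm_smul c L

def LL (z : VV) : MM →L[ℂ] ℂ := ((Real.pi : ℂ) * I / 4) • ((dt z.1 z.1 : ℂ) • pr 0 0 + (2 * dt z.1 z.2 : ℂ) • pr 0 1 + (dt z.2 z.2 : ℂ) • pr 1 1)

lemma LL_norm (z : VV) : ‖LL z‖ ≤ Real.pi * (l1 z * l1 z) := by
  have e1 := dt_le z z.1 z.1 (fun j => by simp) (fun j => by simp)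
  have e2 := dt_le z z.1 z.2 (fun j => by simp) (fun j => by simp)
  have e3 := dt_le z z.2 z.2 (fun j => by simp) (fun j => by simp)
  have f1 : ‖(dt z.1 z.1 : ℂ) • pr 0 0‖ ≤ l1 z * l1 z := by
    rw [nsm, Complex.norm_intCast]
    nlinarith [pr_norm 0 0, norm_nonneg (pr 0 0), abs_nonneg (dt z.1 z.1 : ℝ)]
  have f2 : ‖(2 * dt z.1 z.2 : ℂ) • pr 0 1‖ ≤ 2 * (l1 z * l1 z) := by
    rw [nsm, norm_mul, Complex.norm_intCast, Complex.norm_ofNat]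
    nlinarith [pr_norm 0 1, norm_nonneg (pr 0 1), abs_nonneg (dt z.1 z.2 : ℝ)]
  have f3 : ‖(dt z.2 z.2 : ℂ) • pr 1 1‖ ≤ l1 z * l1 z := by
    rw [nsm, Complex.norm_intCast]
    nlinarith [pr_norm 1 1, norm_nonneg (pr 1 1), abs_nonneg (dt z.2 z.2 : ℝ)]
  rw [LL, nsm]
  have h := (norm_add₃_le (a := (dt z.1 z.1 : ℂ) • pr 0 0) (b := (2 * dt z.1 z.2 : ℂ) • pr 0 1) (c := (dt z.2 z.2 : ℂ) • pr 1 1))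
  have hp : ‖(Real.pi : ℂ) * I / 4‖ = Real.pi / 4 := by
    simp [abs_of_pos Real.pi_pos]
  rw [hp]
  nlinarith [Real.pi_pos]

lemma ex_LL (τ : MM) (z : VV) : ex (τ 0 0) (τ 0 1) (τ 1 1) z = cexp (LL z τ) := by
  rw [ex]; congr 1
  simp [LL, pr]; ring

lemma Adm.diff {φ : VV → ℂ} (h : Adm φ) {τ : MM} (hm : mk (τ 0 0) (τ 0 1) (τ 1 1) ∈ H2) :
    DifferentiableAt ℂ (fun τ : MM => ser φ (τ 0 0) (τ 0 1) (τ 1 1)) τ := by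
  have hh := h
  obtain ⟨K, C, hK, hC, h⟩ := h
  obtain ⟨δ, h0, u, hu, h1⟩ := ex_bound' hm (C + 1)
  have key := hasFDerivAt_tsum_of_isPreconnected (𝕜 := ℂ) (f := fun (z : VV) (τ : MM) => φ z * ex (τ 0 0) (τ 0 1) (τ 1 1) z)
    (f' := fun z τ => φ z • (ex (τ 0 0) (τ 0 1) (τ 1 1) z • LL z)) (hu.mul_left (K * (Real.pi * 2))) (Metric.isOpen_ball (x := τ) (ε := δ))
    (convex_ball τ δ).isPreconnected (fun z σ _ => ?_) (fun z σ hσ => ?_) (Metric.mem_ball_self h0)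
    (hh.hs hm).summable (Metric.mem_ball_self h0)
  · exact key.differentiableAt
  · simp only [ex_LL]
    exact ((LL z).hasFDerivAt.cexp).const_mul _
  · have hd : ∀ i j, ‖σ i j - τ i j‖ ≤ δ := fun i j => by
      rw [mem_ball_iff_norm] at hσ
      exact ((norm_le_pi_norm ((σ - τ) i) j).trans (norm_le_pi_norm (σ - τ) i)).trans hσ.le
    have b := h1 _ _ _ (hd 0 0) (hd 0 1) (hd 1 1) z
    have hl : l1 z * l1 z ≤ 2 * Real.exp (l1 z) := by
      have := Real.quadratic_le_exp_of_nonneg (l1_nn z)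
      nlinarith [l1_nn z]
    have hL : ‖LL z‖ ≤ Real.pi * 2 * Real.exp (l1 z) := by
      refine (LL_norm z).trans ?_
      nlinarith [Real.pi_pos]
    calc _ ≤ ‖φ z‖ * (‖ex (σ 0 0) (σ 0 1) (σ 1 1) z‖ * ‖LL z‖) := by
          rw [nsm, nsm]
      _ ≤ (K * Real.exp (C * l1 z)) * (‖ex (σ 0 0) (σ 0 1) (σ 1 1) z‖ * (Real.pi * 2 * Real.exp (l1 z))) := by
          have := h z
          gcongr
      _ = K * (Real.pi * 2) * (Real.exp ((C + 1) * l1 z) * ‖ex (σ 0 0) (σ 0 1) (σ 1 1) z‖) := by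
          rw [add_mul, one_mul, Real.exp_add]; ring
      _ ≤ _ := by gcongr

lemma dt_nn (x) : (0 : ℝ) ≤ dt x x := by
  simp only [dt]; push_cast
  exact Finset.sum_nonneg fun j _ => mul_self_nonneg _

lemma dt_pos {x : V4} (h : x ≠ 0) : (0 : ℝ) < dt x x := by
  obtain ⟨j, hj⟩ := Function.ne_iff.1 h
  simp only [dt]; push_cast
  refine Finset.sum_pos' (fun j _ => mul_self_nonneg _) ⟨j, Finset.mem_univ _, ?_⟩
  have : (x j : ℝ) ≠ 0 := by exact_mod_cast hj
  exact mul_self_pos.2 this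

lemma Adm.cusp {φ : VV → ℂ} (h : Adm φ) (h0 : ∀ x, φ (x, 0) = 0) {p : ℂ} (hp : 0 < p.im) :
    Tendsto (fun t : ℝ => ser φ p 0 (t * I)) atTop (𝓝 0) := by
  have hm : mk p 0 I ∈ H2 := by rw [mk_mem]; simpa using hp
  have := tendsto_tsum_of_dominated_convergence (𝓕 := atTop) (f := fun (t : ℝ) z => φ z * ex p 0 (t * I) z) (g := fun _ => 0)
    (h.sm hm) (fun z => ?_) ?_
  · simpa [ser] using this
  · by_cases hz : z.2 = 0
    · have : φ z = 0 := by rw [← h0 z.1, ← hz]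
      simp [this]
    rw [tendsto_zero_iff_norm_tendsto_zero]
    have e : ∀ t : ℝ, ‖φ z * ex p 0 (t * I) z‖ = ‖φ z‖ * (Real.exp (-(Real.pi / 4) * (p.im * dt z.1 z.1)) * Real.exp (-(Real.pi / 4 * dt z.2 z.2 * t))) := by
      intro t
      rw [norm_mul, ex_norm, ← Real.exp_add]
      congr 2
      simp; ring
    simp only [e]
    have h2 : Tendsto (fun t : ℝ => Real.exp (-(Real.pi / 4 * dt z.2 z.2 * t))) atTop (𝓝 0) := by
      refine Real.tendsto_exp_neg_atTop_nhds_zero.comp (tendsto_id.const_mul_atTop ?_)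
      have := dt_pos hz
      have := Real.pi_pos
      positivity
    simpa using (h2.const_mul _).const_mul ‖φ z‖
  · filter_upwards [eventually_ge_atTop 1] with t ht z
    rw [norm_mul, norm_mul, ex_norm, ex_norm]
    refine mul_le_mul_of_nonneg_left (Real.exp_le_exp.2 ?_) (norm_nonneg _)
    have : (dt z.2 z.2 : ℝ) ≤ t * dt z.2 z.2 := by nlinarith [dt_nn z.2]
    simp
    nlinarith [Real.pi_pos]
end SG

namespace SG

def sm (x : V4) : ℤ := x 0 + x 1 + x 2 + x 3
abbrev ev (x : V4) : Prop := x 0 % 2 = 0 ∧ x 1 % 2 = 0 ∧ x 2 % 2 = 0 ∧ x 3 % 2 = 0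
abbrev od (x : V4) : Prop := x 0 % 2 = 1 ∧ x 1 % 2 = 1 ∧ x 2 % 2 = 1 ∧ x 3 % 2 = 1
def eE (x : V4) : ℤ := if ev x then (if sm x % 4 = 0 then 0 else 2) else if od x then -1 else 0
def eD (x : V4) : ℤ := if od x then (if sm x % 4 = 0 then 1 else -1) else 0
def wW (z : VV) : ℤ := eE z.1 * eD z.2 - eD z.1 * eE z.2

lemma wW_swap (z : VV) : wW z.swap = - wW z := by
  simp only [wW, Prod.fst_swap, Prod.snd_swap]; ring

lemma wW_aux {a1 a2 a3 a4 a5 a6 a7 a8 a9 : Prop} [Decidable a1] [Decidable a2] [Decidable a3] [Decidable a4]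
    [Decidable a5] [Decidable a6] [Decidable a7] [Decidable a8] [Decidable a9]
    (h1 : a3 → ((a5 ↔ a1) ∧ (a6 ↔ a2))) (h2 : a4 → ((a5 ↔ a2) ∧ (a6 ↔ a1))) (h3 : a1 → ¬ a2) (h4 : a3 → ¬ a4)
    (h5 : (a1 ∨ a2) → (a3 ∨ a4) → (a9 ↔ (a7 ↔ a8))) :
    ((if a5 then (if a9 then 0 else 2) else if a6 then -1 else 0) * (if a4 then (if a8 then 1 else -1) else 0) -
    (if a6 then (if a9 then 1 else -1) else 0) * (if a3 then (if a8 then 0 else 2) else if a4 then -1 else 0) : ℤ) =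
    -((if a1 then (if a7 then 0 else 2) else if a2 then -1 else 0) * (if a4 then (if a8 then 1 else -1) else 0) -
    (if a2 then (if a7 then 1 else -1) else 0) * (if a3 then (if a8 then 0 else 2) else if a4 then -1 else 0)) := by
  by_cases a1 <;> by_cases a2 <;> by_cases a3 <;> by_cases a4 <;> by_cases a7 <;> by_cases a8 <;> simp_all

lemma wW_L (x y : V4) : wW (x - y, y) = - wW (x, y) := by
  have h1 : ev y → ((ev (x - y) ↔ ev x) ∧ (od (x - y) ↔ od x)) := by
    simp only [ev, od, Pi.sub_apply]; omega
  have h2 : od y → ((ev (x - y) ↔ od x) ∧ (od (x - y) ↔ ev x)) := by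
    simp only [ev, od, Pi.sub_apply]; omega
  have h3 : ev x → ¬ od x := by simp only [ev, od]; omega
  have h4 : ev y → ¬ od y := by simp only [ev, od]; omega
  have h5 : (ev x ∨ od x) → (ev y ∨ od y) → (sm (x - y) % 4 = 0 ↔ (sm x % 4 = 0 ↔ sm y % 4 = 0)) := by
    simp only [ev, od, sm, Pi.sub_apply]; omega
  simp only [wW, eE, eD]
  exact wW_aux h1 h2 h3 h4 h5

lemma wW_zero (x : V4) : wW (x, 0) = 0 := by simp [wW, eE, eD, ev, od, sm]

lemma cls {x : V4} (h : eE x ≠ 0 ∨ eD x ≠ 0) : (ev x ∧ sm x % 4 ≠ 0) ∨ od x := by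
  by_contra h'
  push Not at h'
  rcases h with h | h <;> apply h <;> simp only [eE, eD] <;> split_ifs <;> simp_all

lemma dt_cls {x : V4} (h : eE x ≠ 0 ∨ eD x ≠ 0) : ∃ k, dt x x = 8 * k + 4 := by
  have e : dt x x = x 0 * x 0 + x 1 * x 1 + x 2 * x 2 + x 3 * x 3 := by simp [dt, Fin.sum_univ_four]
  rcases cls h with ⟨⟨h0, h1, h2, h3⟩, h4⟩ | ⟨h0, h1, h2, h3⟩
  · obtain ⟨a, ha⟩ := Int.dvd_of_emod_eq_zero h0
    obtain ⟨b, hb⟩ := Int.dvd_of_emod_eq_zero h1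
    obtain ⟨c, hc⟩ := Int.dvd_of_emod_eq_zero h2
    obtain ⟨d, hd⟩ := Int.dvd_of_emod_eq_zero h3
    have h5 : (a + b + c + d) % 2 = 1 := by simp only [sm] at h4; omega
    have h6 : ∀ n : ℤ, ∃ m, n * n = 2 * m + n := fun n => by
      obtain ⟨m, hm⟩ := Int.even_mul_succ_self (n - 1)
      exact ⟨m, by linarith⟩
    obtain ⟨a', ha'⟩ := h6 a
    obtain ⟨b', hb'⟩ := h6 b
    obtain ⟨c', hc'⟩ := h6 c
    obtain ⟨d', hd'⟩ := h6 d
    obtain ⟨k, hk⟩ : ∃ k, a + b + c + d = 2 * k + 1 := ⟨(a + b + c + d) / 2, by omega⟩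
    refine ⟨a' + b' + c' + d' + k, ?_⟩
    rw [e, ha, hb, hc, hd]; linarith
  · have h6 : ∀ n : ℤ, n % 2 = 1 → ∃ m, n * n = 8 * m + 1 := fun n hn => by
      obtain ⟨m, hm⟩ : ∃ m, n = 2 * m + 1 := ⟨n / 2, by omega⟩
      obtain ⟨k, hk⟩ := Int.even_mul_succ_self m
      exact ⟨k, by rw [hm]; linarith⟩
    obtain ⟨a', ha'⟩ := h6 _ h0
    obtain ⟨b', hb'⟩ := h6 _ h1
    obtain ⟨c', hc'⟩ := h6 _ h2
    obtain ⟨d', hd'⟩ := h6 _ h3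
    exact ⟨a' + b' + c' + d', by rw [e]; linarith⟩

lemma wW_ne {z : VV} (h : wW z ≠ 0) : (eE z.1 ≠ 0 ∨ eD z.1 ≠ 0) ∧ (eE z.2 ≠ 0 ∨ eD z.2 ≠ 0) := by
  by_contra h'
  apply h
  rw [wW]
  by_cases h1 : eE z.1 = 0 <;> by_cases h2 : eD z.1 = 0 <;> by_cases h3 : eE z.2 = 0 <;> by_cases h4 : eD z.2 = 0 <;> simp_all

lemma dt_comm (x y) : dt x y = dt y x := Finset.sum_congr rfl fun _ _ => mul_comm _ _
lemma dt_sub (x y w) : dt (x - y) w = dt x w - dt y w := by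
  simp [dt, sub_mul, Finset.sum_sub_distrib]
lemma ad_sub (a x y) : ad a (x - y) = ad a x - ad a y := by
  simp [ad, mul_sub, Finset.sum_sub_distrib]

/-- x·y is even when the weight is nonzero -/
lemma dt_even {z : VV} (h : wW z ≠ 0) : ∃ k, dt z.1 z.2 = 2 * k := by
  have h' : wW (z.1 - z.2, z.2) ≠ 0 := by rw [wW_L]; simpa using h
  obtain ⟨k, hk⟩ := dt_cls (wW_ne h).1
  obtain ⟨l, hl⟩ := dt_cls (wW_ne h).2
  obtain ⟨m, hm⟩ := dt_cls (wW_ne h').1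
  simp only [dt_sub] at hm
  rw [dt_comm z.1 (z.1 - z.2), dt_comm z.2 (z.1 - z.2), dt_sub, dt_sub, dt_comm z.2 z.1] at hm
  exact ⟨2 * k + 2 * l - 2 * m + 1, by omega⟩

lemma wW_bd (z) : ‖(wW z : ℂ)‖ ≤ 4 := by
  have h1 : ∀ x, |eE x| ≤ 2 := fun x => by rw [eE]; split_ifs <;> simp
  have h2 : ∀ x, |eD x| ≤ 1 := fun x => by rw [eD]; split_ifs <;> simp
  rw [Complex.norm_intCast]
  have : |wW z| ≤ 4 := by
    rw [wW]
    refine (abs_sub _ _).trans ?_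
    rw [abs_mul, abs_mul]
    nlinarith [h1 z.1, h1 z.2, h2 z.1, h2 z.2, abs_nonneg (eE z.1), abs_nonneg (eE z.2), abs_nonneg (eD z.1), abs_nonneg (eD z.2)]
  exact_mod_cast this

lemma adm_W : Adm (fun z => (wW z : ℂ)) := ⟨4, 0, by norm_num, le_rfl, fun z => by simpa using wW_bd z⟩

/-- pluriharmonic coefficient -/
def ph (a : Fin 4 → ℂ) (X Y : ℂ) (n : ℕ) (z : VV) : ℂ := wW z * (X * ad a z.1 + Y * ad a z.2) ^ n
def ci (a : Fin 4 → ℂ) (i : ℕ) (z : VV) : ℂ := wW z * (ad a z.1 ^ (24 - i) * ad a z.2 ^ i)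

lemma adm_ci (a i) : Adm (ci a i) := adm_W.mul (((adm_ad1 a).pow _).mul ((adm_ad2 a).pow _))
lemma adm_lin (a : Fin 4 → ℂ) (X Y : ℂ) : Adm (fun z => X * ad a z.1 + Y * ad a z.2) := by
  obtain ⟨A, hA, h⟩ := ad_le a
  refine adm_of_le (A := (‖X‖ + ‖Y‖) * A) (by positivity) fun z => (norm_add_le _ _).trans ?_
  rw [norm_mul, norm_mul]
  nlinarith [mul_le_mul_of_nonneg_left (h z).1 (norm_nonneg X), mul_le_mul_of_nonneg_left (h z).2 (norm_nonneg Y)]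
lemma adm_ph (a X Y n) : Adm (ph a X Y n) := adm_W.mul ((adm_lin a X Y).pow _)

open Classical in
def Tf (a : Fin 4 → ℂ) (τ : MM) : Fin 25 → ℂ :=
  if τ ∈ H2 then fun i => (Nat.choose 24 i : ℂ) * ser (ci a i) (τ 0 0) (τ 0 1) (τ 1 1) else 0

lemma Tf_mk (a) {p q r} (h : mk p q r ∈ H2) (i) : Tf a (mk p q r) i = (Nat.choose 24 i : ℂ) * ser (ci a i) p q r := by
  rw [Tf, if_pos h]; rfl

lemma Tf_form (a) {p q r} (h : mk p q r ∈ H2) (X Y : ℂ) : form (Tf a (mk p q r)) X Y = ser (ph a X Y 24) p q r := by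
  rw [form]
  have hs : ∀ i : Fin 25, HasSum (fun z => (Nat.choose 24 i : ℂ) * (ci a i z * ex p q r z) * (X ^ (24 - (i : ℕ)) * Y ^ (i : ℕ)))
    (Tf a (mk p q r) i * (X ^ (24 - (i : ℕ)) * Y ^ (i : ℕ))) := fun i => by
    rw [Tf_mk a h]
    exact (((adm_ci a i).hs h).mul_left _).mul_right _
  rw [← (hasSum_sum (s := Finset.univ) fun i _ => hs i).tsum_eq]
  refine tsum_congr fun z => ?_
  have := add_pow (Y * ad a z.2) (X * ad a z.1) 24
  rw [ph, add_comm (X * _), this, Finset.sum_range, Finset.mul_sum, Finset.sum_mul]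
  refine Finset.sum_congr rfl fun i _ => ?_
  rw [ci]; ring

lemma ser_ph (a) (X Y n p q r) (X' Y' p' q' r' : ℂ) (e : VV ≃ VV) (c : ℂ)
    (h : ∀ z, ph a X Y n (e z) * ex p q r (e z) = c * (ph a X' Y' n z * ex p' q' r' z)) :
    ser (ph a X Y n) p q r = c * ser (ph a X' Y' n) p' q' r' := by
  rw [ser, ← e.tsum_eq, ser, ← tsum_mul_left]
  exact tsum_congr h

def eL : VV ≃ VV where
  toFun z := (z.1 - z.2, z.2)
  invFun z := (z.1 + z.2, z.2)
  left_inv z := by simp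
  right_inv z := by simp

lemma mul_I_exp (k : ℤ) : cexp (Real.pi * I / 4 * ((8 * k + 4 : ℤ) : ℂ)) = -1 := by
  have : (Real.pi : ℂ) * I / 4 * ((8 * k + 4 : ℤ) : ℂ) = k * (2 * Real.pi * I) + Real.pi * I := by push_cast; ring
  rw [this, Complex.exp_add, Complex.exp_int_mul_two_pi_mul_I, Complex.exp_pi_mul_I, one_mul]

lemma Tf_T (a) {p q r} (h : mk p q r ∈ H2) : Tf a (mk (p + 1) q r) = - Tf a (mk p q r) := by
  have h' : mk (p + 1) q r ∈ H2 := mem_z h (by simp) rfl rfl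
  refine form_ext fun y => ?_
  rw [form_neg, Tf_form a h', Tf_form a h, ← neg_one_mul]
  refine ser_ph a _ _ _ _ _ _ _ _ _ _ _ (Equiv.refl _) _ fun z => ?_
  by_cases hz : wW z = 0
  · simp [ph, hz]
  obtain ⟨k, hk⟩ := dt_cls (wW_ne hz).1
  have := mul_I_exp k
  rw [← hk] at this
  have e : ex (p + 1) q r z = ex p q r z * cexp (Real.pi * I / 4 * dt z.1 z.1) := by
    rw [ex, ex, ← Complex.exp_add]; congr 1; ring
  rw [Equiv.refl_apply, e, this, mul_neg_one, mul_neg, neg_one_mul]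

lemma Tf_W (a) {p q r} (h : mk p q r ∈ H2) (x y : ℂ) : form (Tf a (mk r q p)) x y = - form (Tf a (mk p q r)) y x := by
  rw [Tf_form a h, Tf_form a (mem_sw h), ← neg_one_mul]
  refine ser_ph a _ _ _ _ _ _ _ _ _ _ _ (Equiv.prodComm _ _) _ fun z => ?_
  have : ex r q p (Equiv.prodComm _ _ z) = ex p q r z := by
    rw [ex, ex, dt_comm z.1 z.2]; congr 1; simp; ring
  rw [this, ph, ph]
  simp only [Equiv.prodComm_apply, wW_swap, Prod.fst_swap, Prod.snd_swap]
  rw [add_comm (x * _)]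
  generalize (y * ad a z.1 + x * ad a z.2) ^ 24 = w
  push_cast; ring

lemma L_mem {a b d : ℂ} (h : mk a b d ∈ H2) : mk a (b + a) (d + 2 * b + a) ∈ H2 := by
  rw [mk_mem] at *
  refine ⟨h.1, ?_⟩
  simp; nlinarith [h.2]

lemma Li_mem {a b d : ℂ} (h : mk a b d ∈ H2) : mk a (b - a) (d - 2 * b + a) ∈ H2 := by
  rw [mk_mem] at *
  refine ⟨h.1, ?_⟩
  simp; nlinarith [h.2]

lemma Tf_L (a) {p q r} (h : mk p q r ∈ H2) (x y : ℂ) :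
    form (Tf a (mk p (q + p) (r + 2 * q + p))) x y = - form (Tf a (mk p q r)) x (y - x) := by
  rw [Tf_form a h, Tf_form a (L_mem h), ← neg_one_mul]
  refine ser_ph a _ _ _ _ _ _ _ _ _ _ _ eL _ fun z => ?_
  have : ex p (q + p) (r + 2 * q + p) (eL z) = ex p q r z := by
    rw [ex, ex]; congr 1
    simp only [eL, Equiv.coe_fn_mk, dt_sub]
    rw [dt_comm z.1 (z.1 - z.2), dt_comm z.2 (z.1 - z.2), dt_sub, dt_sub, dt_comm z.2 z.1]
    push_cast; ring
  rw [this, ph, ph]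
  simp only [eL, Equiv.coe_fn_mk, wW_L, ad_sub]
  have e : x * (ad a z.1 - ad a z.2) + y * ad a z.2 = x * ad a z.1 + (y - x) * ad a z.2 := by ring
  rw [e]
  generalize (x * ad a z.1 + (y - x) * ad a z.2) ^ 24 = w
  push_cast; ring

lemma H2_of {τ : MM} (h : τ ∈ H2) : mk (τ 0 0) (τ 0 1) (τ 1 1) ∈ H2 := by rw [← eq_mk h]; exact h

lemma Tf_diff (a) : DifferentiableOn ℂ (Tf a) H2 := by
  have : DifferentiableOn ℂ (fun τ : MM => fun i : Fin 25 => (Nat.choose 24 i : ℂ) * ser (ci a i) (τ 0 0) (τ 0 1) (τ 1 1)) H2 := by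
    intro τ hτ
    refine (differentiableAt_pi.2 fun i => ?_).differentiableWithinAt
    exact ((adm_ci a i).diff (H2_of hτ)).const_mul _
  refine this.congr fun τ hτ => ?_
  rw [Tf, if_pos hτ]

lemma diagH_mk (p q) : diagH p q = mk p 0 q := by
  funext i j; fin_cases i <;> fin_cases j <;> simp [diagH, mk]

lemma Tf_cusp (a) {p : ℂ} (hp : 0 < p.im) : Tendsto (fun t : ℝ => Tf a (diagH p (t * I))) atTop (𝓝 0) := by
  rw [tendsto_pi_nhds]
  intro i
  have := ((adm_ci a i).cusp (fun x => by simp [ci, wW_zero]) hp).const_mul (Nat.choose 24 i : ℂ)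
  rw [mul_zero] at this
  refine this.congr' ?_
  filter_upwards [eventually_gt_atTop 0] with t ht
  have hm : mk p 0 (t * I) ∈ H2 := by
    rw [mk_mem]; simp; exact ⟨hp, by positivity⟩
  rw [diagH_mk, Tf_mk a hm]
end SG

namespace SG

def ee (τ z : ℂ) (u : ℤ) : ℂ := cexp (Real.pi * I / 4 * (τ * (u * u)) + Real.pi * I * (u * z))
def th (p : ℤ → ℂ) (τ z : ℂ) : ℂ := ∑' u : ℤ, p u * ee τ z u
def pA (u : ℤ) : ℂ := if u % 2 = 0 then 1 else 0
def pB (u : ℤ) : ℂ := if u % 2 = 0 then I ^ u else 0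
def pC (u : ℤ) : ℂ := if u % 2 = 1 then 1 else 0
def pD (u : ℤ) : ℂ := if u % 2 = 1 then I ^ u else 0

lemma th_even (p : ℤ → ℂ) (τ z : ℂ) (hp : ∀ u, u % 2 ≠ 0 → p u = 0) : th p τ z = ∑' n : ℤ, p (2 * n) * ee τ z (2 * n) := by
  have hi : Function.Injective (fun n : ℤ => 2 * n) := fun a b h => by simpa using h
  refine (hi.tsum_eq (f := fun u => p u * ee τ z u) fun u hu => ?_).symm
  by_contra h
  apply hu
  show p u * ee τ z u = 0
  rw [hp u fun h' => h ⟨u / 2, by simp only; omega⟩, zero_mul]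

lemma th_odd (p : ℤ → ℂ) (τ z : ℂ) (hp : ∀ u, u % 2 ≠ 1 → p u = 0) : th p τ z = ∑' n : ℤ, p (2 * n + 1) * ee τ z (2 * n + 1) := by
  have hi : Function.Injective (fun n : ℤ => 2 * n + 1) := fun a b h => by simpa using h
  refine (hi.tsum_eq (f := fun u => p u * ee τ z u) fun u hu => ?_).symm
  by_contra h
  apply hu
  show p u * ee τ z u = 0
  rw [hp u fun h' => h ⟨u / 2, by simp only; omega⟩, zero_mul]

lemma I_zp (n : ℤ) : I ^ (2 * n) = cexp (Real.pi * I * n) := by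
  rw [_root_.zpow_mul, mul_comm (Real.pi * I : ℂ), Complex.exp_int_mul, Complex.exp_pi_mul_I]
  norm_num

lemma th_A (τ z : ℂ) : th pA τ z = jacobiTheta₂ z τ := by
  rw [th_even _ _ _ fun u h => by simp [pA, h]]
  refine tsum_congr fun n => ?_
  rw [pA, if_pos (by omega), one_mul, ee, jacobiTheta₂_term]
  congr 1; push_cast; ring

lemma th_B (τ z : ℂ) : th pB τ z = jacobiTheta₂ (z + 1 / 2) τ := by
  rw [th_even _ _ _ fun u h => by simp [pB, h]]
  refine tsum_congr fun n => ?_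
  rw [pB, if_pos (by omega), ee, jacobiTheta₂_term, I_zp, ← Complex.exp_add]
  congr 1; push_cast; ring

lemma th_C (τ z : ℂ) : th pC τ z = cexp (Real.pi * I * (τ / 4 + z)) * jacobiTheta₂ (z + τ / 2) τ := by
  rw [th_odd _ _ _ fun u h => by simp [pC, h], jacobiTheta₂, ← tsum_mul_left]
  refine tsum_congr fun n => ?_
  rw [pC, if_pos (by omega), one_mul, ee, jacobiTheta₂_term, ← Complex.exp_add]
  congr 1; push_cast; ring

lemma th_D (τ z : ℂ) : th pD τ z = I * cexp (Real.pi * I * (τ / 4 + z)) * jacobiTheta₂ (z + τ / 2 + 1 / 2) τ := by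
  rw [th_odd _ _ _ fun u h => by simp [pD, h], jacobiTheta₂, ← tsum_mul_left]
  refine tsum_congr fun n => ?_
  rw [pD, if_pos (by omega), ee, jacobiTheta₂_term, zpow_add_one₀ I_ne_zero, I_zp, mul_comm _ I, mul_assoc I, mul_assoc I,
    ← Complex.exp_add, ← Complex.exp_add]
  congr 2; push_cast; ring

def kk (τ : ℂ) : ℂ := (-I * τ) ^ (1 / 2 : ℂ)

lemma kk_ne {τ : ℂ} (h : τ ≠ 0) : kk τ ≠ 0 := by
  rw [kk, Complex.cpow_ne_zero_iff]; left; simp [h]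

lemma kk4 (τ : ℂ) : kk τ ^ 4 = - τ ^ 2 := by
  rw [kk, ← Complex.cpow_nat_mul]
  norm_num
  rw [mul_pow, I_sq]; ring

lemma fe {τ : ℂ} (h : τ ≠ 0) (z : ℂ) : jacobiTheta₂ (z / τ) (-1 / τ) = kk τ * cexp (Real.pi * I * (z ^ 2 / τ)) * jacobiTheta₂ z τ := by
  rw [jacobiTheta₂_functional_equation z τ]
  have hk := kk_ne h
  rw [kk] at hk ⊢
  have : cexp (-Real.pi * I * z ^ 2 / τ) = (cexp (Real.pi * I * (z ^ 2 / τ)))⁻¹ := by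
    rw [← Complex.exp_neg]; congr 1; ring
  rw [this]
  have := Complex.exp_ne_zero (Real.pi * I * (z ^ 2 / τ))
  field_simp

def gg (τ z : ℂ) : ℂ := kk τ * cexp (Real.pi * I * (z ^ 2 / τ))

lemma S_A {τ : ℂ} (h : τ ≠ 0) (z : ℂ) : th pA (-1 / τ) (z / τ) = gg τ z * th pA τ z := by
  rw [th_A, th_A, fe h, gg]

lemma S_B {τ : ℂ} (h : τ ≠ 0) (z : ℂ) : th pB (-1 / τ) (z / τ) = gg τ z * th pC τ z := by
  have e : z / τ + 1 / 2 = (z + τ / 2) / τ := by field_simp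
  rw [th_B, th_C, e, fe h, gg, ← mul_assoc, mul_assoc (kk τ) (cexp _) (cexp _), ← Complex.exp_add]
  congr 3; field_simp; ring

lemma S_C {τ : ℂ} (h : τ ≠ 0) (z : ℂ) : th pC (-1 / τ) (z / τ) = gg τ z * th pB τ z := by
  have e : z / τ + -1 / τ / 2 = (z - 1 / 2) / τ := by field_simp; ring
  have e2 : jacobiTheta₂ (z + 1 / 2) τ = jacobiTheta₂ (z - 1 / 2) τ := by
    rw [← jacobiTheta₂_add_left (z - 1 / 2)]; congr 1; ring
  rw [th_C, th_B, e, fe h, gg, e2, ← mul_assoc, mul_left_comm, ← Complex.exp_add]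
  congr 3; field_simp; ring

lemma S_D {τ : ℂ} (h : τ ≠ 0) (z : ℂ) : th pD (-1 / τ) (z / τ) = -I * (gg τ z * th pD τ z) := by
  have e : z / τ + -1 / τ / 2 + 1 / 2 = (z + τ / 2 - 1 / 2) / τ := by field_simp; ring
  have e2 : jacobiTheta₂ (z + τ / 2 + 1 / 2) τ = jacobiTheta₂ (z + τ / 2 - 1 / 2) τ := by
    rw [← jacobiTheta₂_add_left (z + τ / 2 - 1 / 2)]; congr 1; ring
  rw [th_D, th_D, e, fe h, gg, e2]
  have e3 : cexp (Real.pi * I * (-1 / τ / 4 + z / τ)) * cexp (Real.pi * I * ((z + τ / 2 - 1 / 2) ^ 2 / τ)) =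
    -I * (cexp (Real.pi * I * (z ^ 2 / τ)) * cexp (Real.pi * I * (τ / 4 + z))) := by
    have e4 : -I = cexp (-(Real.pi / 2 * I)) := by
      rw [Complex.exp_neg, Complex.exp_pi_div_two_mul_I, Complex.inv_I]
    rw [e4, ← Complex.exp_add, ← Complex.exp_add, ← Complex.exp_add]
    congr 1; field_simp; ring
  linear_combination (I * kk τ * jacobiTheta₂ (z + τ / 2 - 1 / 2) τ) * e3

def hE (τ : ℂ) (z : Fin 4 → ℂ) : ℂ := ∏ j, th pA τ (z j) - ∏ j, th pB τ (z j) - ∏ j, th pC τ (z j)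
def hD (τ : ℂ) (z : Fin 4 → ℂ) : ℂ := ∏ j, th pD τ (z j)

lemma gg4 (τ : ℂ) (z : Fin 4 → ℂ) : ∏ j, gg τ (z j) = - τ ^ 2 * cexp (Real.pi * I * ((∑ j, z j ^ 2) / τ)) := by
  simp only [gg, Finset.prod_mul_distrib, ← Complex.exp_sum, Finset.sum_div, Finset.mul_sum]
  rw [Finset.prod_const, ← kk4]; rfl

lemma S_hE {τ : ℂ} (h : τ ≠ 0) (z : Fin 4 → ℂ) : hE (-1 / τ) (fun j => z j / τ) =
    - τ ^ 2 * cexp (Real.pi * I * ((∑ j, z j ^ 2) / τ)) * hE τ z := by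
  simp only [hE, S_A h, S_B h, S_C h, Finset.prod_mul_distrib, ← gg4]; ring

lemma S_hD {τ : ℂ} (h : τ ≠ 0) (z : Fin 4 → ℂ) : hD (-1 / τ) (fun j => z j / τ) =
    - τ ^ 2 * cexp (Real.pi * I * ((∑ j, z j ^ 2) / τ)) * hD τ z := by
  simp only [hD, S_D h, Finset.prod_mul_distrib, ← gg4, Finset.prod_const]
  have : (-I) ^ (Finset.univ : Finset (Fin 4)).card = 1 := by
    rw [Finset.card_univ, Fintype.card_fin]
    linear_combination (I ^ 2 - 1) * I_sq
  rw [this, one_mul]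

lemma I4 {n : ℤ} (h : n % 2 = 0) : I ^ n = if n % 4 = 0 then 1 else -1 := by
  split_ifs with h'
  · obtain ⟨k, rfl⟩ := Int.dvd_of_emod_eq_zero h'
    rw [_root_.zpow_mul]; simp [zpow_ofNat]
  · obtain ⟨k, rfl⟩ : ∃ k, n = 4 * k + 2 := ⟨n / 4, by omega⟩
    rw [zpow_add₀ I_ne_zero, _root_.zpow_mul]; simp [zpow_ofNat]

lemma eE_prod (x : V4) : (eE x : ℂ) = ∏ j, pA (x j) - ∏ j, pB (x j) - ∏ j, pC (x j) := by
  simp only [Fin.prod_univ_four]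
  by_cases h : ev x
  · have h2 : sm x % 2 = 0 := by simp only [sm]; obtain ⟨h0, h1, h2, h3⟩ := h; omega
    have := I4 h2
    rw [sm, zpow_add₀ I_ne_zero, zpow_add₀ I_ne_zero, zpow_add₀ I_ne_zero, ← sm] at this
    rw [eE, if_pos h]
    obtain ⟨h0, h1, h2, h3⟩ := h
    simp only [pA, pB, pC, h0, h1, h2, h3, if_true, this]
    split_ifs <;> simp_all; norm_num
  · have hA : pA (x 0) * pA (x 1) * pA (x 2) * pA (x 3) = 0 := by
      by_contra h'; apply h; simp [pA] at h'; simp only [ev]; omega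
    have hB : pB (x 0) * pB (x 1) * pB (x 2) * pB (x 3) = 0 := by
      by_contra h'; apply h; simp [pB] at h'; simp only [ev]; omega
    rw [eE, if_neg h, hA, hB]
    split_ifs with h1
    · obtain ⟨h0, h1, h2, h3⟩ := h1
      simp [pC, h0, h1, h2, h3]
    · have hC : pC (x 0) * pC (x 1) * pC (x 2) * pC (x 3) = 0 := by
        by_contra h'; apply h1; simp [pC] at h'; tauto
      simp [hC]

lemma eD_prod (x : V4) : (eD x : ℂ) = ∏ j, pD (x j) := by
  simp only [Fin.prod_univ_four]
  rw [eD]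
  split_ifs with h h4
  all_goals first
    | (have h2 : sm x % 2 = 0 := by simp only [sm]; obtain ⟨h0, h1, h2, h3⟩ := h; omega
       have := I4 h2
       rw [sm, zpow_add₀ I_ne_zero, zpow_add₀ I_ne_zero, zpow_add₀ I_ne_zero, ← sm] at this
       obtain ⟨h0, h1, h2, h3⟩ := h
       simp only [pD, h0, h1, h2, h3, if_true, this, h4]
       simp)
    | (have hA : pD (x 0) * pD (x 1) * pD (x 2) * pD (x 3) = 0 := by
         by_contra h'; apply h; simp [pD] at h'; tauto
       rw [hA]; simp)

lemma ee_norm (τ z : ℂ) (u : ℤ) : ‖ee τ z u‖ ≤ Real.exp (Real.pi * ‖z‖ * |(u : ℝ)| - Real.pi / 4 * τ.im * (u : ℝ) ^ 2) := by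
  rw [ee, Complex.norm_exp, Real.exp_le_exp]
  have e : (Real.pi : ℂ) * I / 4 * (τ * (u * u)) + Real.pi * I * (u * z) =
    ((Real.pi / 4 * (u * u) : ℝ) : ℂ) * (I * τ) + ((Real.pi * u : ℝ) : ℂ) * (I * z) := by push_cast; ring
  rw [e, Complex.add_re, Complex.re_ofReal_mul, Complex.re_ofReal_mul, Complex.I_mul_re, Complex.I_mul_re]
  have h1 : -(u * z.im) ≤ |(u : ℝ)| * ‖z‖ := by
    refine (neg_le_abs _).trans ?_
    rw [abs_mul]
    exact mul_le_mul_of_nonneg_left (Complex.abs_im_le_norm z) (abs_nonneg _)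
  nlinarith [mul_le_mul_of_nonneg_left h1 Real.pi_pos.le]

lemma th_hs (p : ℤ → ℂ) (hp : ∀ u, ‖p u‖ ≤ 1) {τ : ℂ} (h : 0 < τ.im) (z : Fin 4 → ℂ) :
    HasSum (fun x : V4 => (∏ j, p (x j)) * ∏ j, ee τ (z j) (x j)) (∏ j, th p τ (z j)) := by
  refine hs_congr (fun x => Finset.prod_mul_distrib) (hs_pi 4 (fun j u => p u * ee τ (z j) u) fun j => ?_).2
  refine Summable.of_nonneg_of_le (fun _ => norm_nonneg _) (fun u => ?_)
    (bd1 (Real.pi * ‖z j‖) (δ := Real.pi / 4 * τ.im) (by have := Real.pi_pos; positivity))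
  rw [norm_mul]
  exact (mul_le_of_le_one_left (norm_nonneg _) (hp u)).trans (ee_norm _ _ _)

lemma hE_hs {τ : ℂ} (h : 0 < τ.im) (z : Fin 4 → ℂ) : HasSum (fun x : V4 => (eE x : ℂ) * ∏ j, ee τ (z j) (x j)) (hE τ z) := by
  have hA := th_hs pA (fun u => by rw [pA]; split_ifs <;> simp) h z
  have hB := th_hs pB (fun u => by rw [pB]; split_ifs <;> simp) h z
  have hC := th_hs pC (fun u => by rw [pC]; split_ifs <;> simp) h z
  exact hs_congr (fun x => by rw [eE_prod]; ring) ((hA.sub hB).sub hC)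

lemma hD_hs {τ : ℂ} (h : 0 < τ.im) (z : Fin 4 → ℂ) : HasSum (fun x : V4 => (eD x : ℂ) * ∏ j, ee τ (z j) (x j)) (hD τ z) :=
  hs_congr (fun x => by rw [eD_prod]) (th_hs pD (fun u => by rw [pD]; split_ifs <;> simp) h z)
end SG

namespace SG

def gf (a : Fin 4 → ℂ) (X Y : ℂ) (z : VV) : ℂ := wW z * cexp (Real.pi * I * (X * ad a z.1 + Y * ad a z.2))

lemma lin_bd (a : Fin 4 → ℂ) (X Y : ℂ) : ∃ A : ℝ, 0 ≤ A ∧ ∀ z : VV, ‖Real.pi * I * (X * ad a z.1 + Y * ad a z.2)‖ ≤ A * l1 z := by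
  obtain ⟨A, hA, h⟩ := ad_le a
  refine ⟨Real.pi * ((‖X‖ + ‖Y‖) * A), by have := Real.pi_pos; positivity, fun z => ?_⟩
  have h1 : ‖(Real.pi : ℂ) * I‖ = Real.pi := by simp [abs_of_pos Real.pi_pos]
  rw [norm_mul, h1, mul_assoc]
  refine mul_le_mul_of_nonneg_left ((norm_add_le _ _).trans ?_) Real.pi_pos.le
  rw [norm_mul, norm_mul]
  nlinarith [mul_le_mul_of_nonneg_left (h z).1 (norm_nonneg X), mul_le_mul_of_nonneg_left (h z).2 (norm_nonneg Y)]

lemma adm_gf (a X Y) : Adm (gf a X Y) := by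
  obtain ⟨A, hA, h⟩ := lin_bd a X Y
  refine adm_W.mul ⟨1, A, zero_le_one, hA, fun z => ?_⟩
  rw [one_mul]
  exact (Complex.norm_exp_le_exp_norm _).trans (Real.exp_le_exp.2 (h z))

lemma gf_ee (a X Y p q r) (x y : V4) : cexp (Real.pi * I * (X * ad a x + Y * ad a y)) * ex p q r (x, y) =
    (∏ j, ee p (q * y j / 2 + X * a j) (x j)) * cexp (Real.pi * I / 4 * (r * dt y y) + Real.pi * I * (Y * ad a y)) := by
  simp only [ex, ee, ← Complex.exp_sum, ← Complex.exp_add]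
  congr 1
  simp only [dt, ad, Fin.sum_univ_four]
  push_cast
  ring

lemma gf_sum (a X Y) {p q r : ℂ} (h : mk p q r ∈ H2) : ser (gf a X Y) p q r =
    ∑' y : V4, (hE p (fun j => q * y j / 2 + X * a j) * eD y - hD p (fun j => q * y j / 2 + X * a j) * eE y) *
      cexp (Real.pi * I / 4 * (r * dt y y) + Real.pi * I * (Y * ad a y)) := by
  have hp : 0 < p.im := ((mk_mem _ _ _).1 h).1
  have hs := ((adm_gf a X Y).hs h).summable
  have hs' : Summable (fun c : V4 × V4 => gf a X Y (Equiv.prodComm V4 V4 c) * ex p q r (Equiv.prodComm V4 V4 c)) :=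
    (Equiv.prodComm V4 V4).summable_iff.2 hs
  rw [ser, ← (Equiv.prodComm V4 V4).tsum_eq, Summable.tsum_prod hs']
  refine tsum_congr fun y => ?_
  refine HasSum.tsum_eq ?_
  refine hs_congr (fun x => ?_) ((((hE_hs hp (fun j => q * y j / 2 + X * a j)).mul_right (eD y : ℂ)).sub
    ((hD_hs hp (fun j => q * y j / 2 + X * a j)).mul_right (eE y : ℂ))).mul_right
      (cexp (Real.pi * I / 4 * (r * dt y y) + Real.pi * I * (Y * ad a y))))
  show _ = gf a X Y (x, y) * ex p q r (x, y)
  have g := gf_ee a X Y p q r x y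
  rw [gf, mul_assoc (wW (x, y) : ℂ), g, wW]
  push_cast; ring

lemma gf_S {a : Fin 4 → ℂ} (ha : ∑ j, a j ^ 2 = 0) (X Y) {p q r : ℂ} (h : mk p q r ∈ H2) :
    ser (gf a X Y) (-1 / p) (q / p) (r - q ^ 2 / p) = - p ^ 2 * ser (gf a (p * X) (q * X + Y)) p q r := by
  have hp := mk_ne h
  rw [gf_sum a X Y (gS_mem h), gf_sum a _ _ h, ← tsum_mul_left]
  refine tsum_congr fun y => ?_
  have e : (fun j => q / p * y j / 2 + X * a j) = fun j => (q * y j / 2 + p * X * a j) / p := by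
    funext j; field_simp
  have e2 : (∑ j, (q * y j / 2 + p * X * a j) ^ 2) / p = q ^ 2 / p * dt y y / 4 + q * X * ad a y := by
    have : ∑ j, (q * y j / 2 + p * X * a j) ^ 2 = q ^ 2 * dt y y / 4 + p * q * X * ad a y + p ^ 2 * X ^ 2 * ∑ j, a j ^ 2 := by
      simp only [dt, ad, Fin.sum_univ_four]; push_cast; ring
    rw [this, ha]; field_simp; ring
  have e3 : cexp (Real.pi * I / 4 * (r * dt y y) + Real.pi * I * ((q * X + Y) * ad a y)) =
    cexp (Real.pi * I * (q ^ 2 / p * dt y y / 4 + q * X * ad a y)) *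
    cexp (Real.pi * I / 4 * ((r - q ^ 2 / p) * dt y y) + Real.pi * I * (Y * ad a y)) := by
    rw [← Complex.exp_add]; congr 1; ring
  rw [e, S_hE hp, S_hD hp, e2, e3]
  ring

lemma gf_ser (a X Y) {p q r : ℂ} (h : mk p q r ∈ H2) (t : ℂ) :
    HasSum (fun n : ℕ => ((Real.pi * I) ^ n / n.factorial * ser (ph a X Y n) p q r) * t ^ n) (ser (gf a (t * X) (t * Y)) p q r) := by
  obtain ⟨A, hA, hb⟩ := lin_bd a (t * X) (t * Y)
  let w : VV → ℂ := fun z => Real.pi * I * (t * X * ad a z.1 + t * Y * ad a z.2)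
  let f : VV × ℕ → ℂ := fun zn => wW zn.1 * ex p q r zn.1 * (w zn.1 ^ zn.2 / zn.2.factorial)
  have hexp : ∀ z, HasSum (fun n => f (z, n)) (gf a (t * X) (t * Y) z * ex p q r z) := fun z => by
    have h1 := (NormedSpace.expSeries_div_hasSum_exp (w z)).mul_left (wW z * ex p q r z)
    rw [← Complex.exp_eq_exp_ℂ] at h1
    have e : gf a (t * X) (t * Y) z * ex p q r z = wW z * ex p q r z * cexp (w z) := by rw [gf]; ring
    rw [e]; exact h1
  have hnorm : ∀ z, HasSum (fun n => ‖f (z, n)‖) (‖(wW z : ℂ)‖ * ‖ex p q r z‖ * Real.exp ‖w z‖) := fun z => by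
    have h1 := (NormedSpace.expSeries_div_hasSum_exp (‖w z‖)).mul_left (‖(wW z : ℂ)‖ * ‖ex p q r z‖)
    rw [← Real.exp_eq_exp_ℝ] at h1
    have e : (fun n => ‖f (z, n)‖) = fun n => ‖(wW z : ℂ)‖ * ‖ex p q r z‖ * (‖w z‖ ^ n / n.factorial) := by
      funext n; simp [f]
    rw [e]; exact h1
  have hsum : Summable f := by
    refine Summable.of_norm ?_
    rw [summable_prod_of_nonneg (fun _ => norm_nonneg _)]
    refine ⟨fun z => (hnorm z).summable, ?_⟩
    simp only [fun z => (hnorm z).tsum_eq]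
    refine Summable.of_nonneg_of_le (fun _ => by positivity) (fun z => ?_) ((ex_sum h A).mul_left 4)
    have := wW_bd z
    have h2 := Real.exp_le_exp.2 (hb z)
    calc _ ≤ 4 * ‖ex p q r z‖ * Real.exp (A * l1 z) := by gcongr
      _ = _ := by ring
  have h1 : HasSum f (ser (gf a (t * X) (t * Y)) p q r) := by
    have := hsum.hasSum.prod_fiberwise hexp
    rw [ser, this.tsum_eq]; exact hsum.hasSum
  have h2 := (Equiv.prodComm ℕ VV).hasSum_iff.2 h1
  refine h2.prod_fiberwise fun n => ?_
  have h3 := (((adm_ph a X Y n).hs h).mul_left ((Real.pi * I : ℂ) ^ n / n.factorial)).mul_right (t ^ n)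
  refine hs_congr (fun z => ?_) h3
  show _ = wW z * ex p q r z * (w z ^ n / n.factorial)
  have e : w z = Real.pi * I * t * (X * ad a z.1 + Y * ad a z.2) := by simp only [w]; ring
  rw [e, ph, mul_pow (Real.pi * I * t : ℂ), mul_pow (Real.pi * I : ℂ) t]
  ring

lemma ph_S {a : Fin 4 → ℂ} (ha : ∑ j, a j ^ 2 = 0) (X Y) {p q r : ℂ} (h : mk p q r ∈ H2) (n : ℕ) :
    ser (ph a X Y n) (-1 / p) (q / p) (r - q ^ 2 / p) = - p ^ 2 * ser (ph a (p * X) (q * X + Y) n) p q r := by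
  have key := pow_uniq (c := fun n => (Real.pi * I) ^ n / n.factorial * (ser (ph a X Y n) (-1 / p) (q / p) (r - q ^ 2 / p) -
    - p ^ 2 * ser (ph a (p * X) (q * X + Y) n) p q r)) one_pos (fun t _ _ => ?_) n
  · have h1 : (Real.pi * I : ℂ) ^ n / n.factorial ≠ 0 := by
      have := Real.pi_ne_zero
      have := Nat.factorial_ne_zero n
      simp_all
    exact sub_eq_zero.1 ((mul_eq_zero.1 key).resolve_left h1)
  · have h1 := gf_ser a X Y (gS_mem h) t
    have h2 := (gf_ser a (p * X) (q * X + Y) h t).mul_left (- p ^ 2)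
    have e1 : t * (p * X) = p * (t * X) := by ring
    have e2 : t * (q * X + Y) = q * (t * X) + t * Y := by ring
    rw [e1, e2, ← gf_S ha _ _ h] at h2
    have h3 := h1.sub h2
    rw [sub_self] at h3
    exact hs_congr (fun n => by ring) h3

lemma Tf_law {a : Fin 4 → ℂ} (ha : ∑ j, a j ^ 2 = 0) : Law (Tf a) := by
  refine ⟨Tf_diff a, fun p q r h => Tf_T a h, fun p q r h => Tf_W a h, fun p q r h => Tf_L a h, fun p q r h x y => ?_⟩
  rw [Tf_form a (gS_mem h), Tf_form a h, ph_S ha _ _ h]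

/-- modular behaviour under a matrix -/
def PP (ε : M4 → ℂ) (F : MM → Fin 25 → ℂ) (γ : M4) : Prop := γ ∈ Sp4Z ∧ ∀ τ ∈ H2,
  (den γ τ).det ≠ 0 ∧ moeb γ τ ∈ H2 ∧ F (moeb γ τ) = ε γ • wt 24 2 (den γ τ) (F τ)

lemma PP_mul {ε : M4 → ℂ} (hε : IsEps ε) {F γ δ} (h : PP ε F γ) (h' : PP ε F δ) : PP ε F (γ * δ) := by
  refine ⟨Sp_mul h.1 h'.1, fun τ hτ => ?_⟩
  obtain ⟨d1, d2, d3⟩ := h'.2 τ hτ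
  obtain ⟨g1, g2, g3⟩ := h.2 _ d2
  have e1 := den_mul (γ := γ) d1
  have e2 := moeb_mul (γ := γ) d1 g1
  rw [e1, e2]
  refine ⟨by rw [Matrix.det_mul]; exact mul_ne_zero g1 d1, g2, ?_⟩
  rw [g3, d3, wt_smul, smul_smul, hε.2.1 _ h.1 _ h'.1, wt_mul]

lemma PP_all {ε : M4 → ℂ} (hε : IsEps ε) {F} (h : Law F) {γ : M4} (hγ : γ ∈ Sp4Z) : PP ε F γ := by
  obtain ⟨eT, eTi, eS, eW, eL, eLi⟩ := eps_gen hε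
  have one : ε 1 = 1 := by
    have := hε.2.1 1 one_Sp 1 one_Sp
    rw [one_mul] at this
    rcases hε.1 1 one_Sp with h | h
    · exact h
    · rw [h] at this; norm_num at this
  refine Submonoid.closure_induction (motive := fun γ _ => PP ε F γ) ?_ ?_ ?_ (Sp_Gen hγ)
  · intro γ hγ
    simp only [Set.mem_insert_iff, Set.mem_singleton_iff] at hγ
    rcases hγ with rfl | rfl | rfl | rfl | rfl | rfl
    · refine ⟨gT_Sp, fun τ hτ => ?_⟩
      have hm := H2_of hτ
      rw [eq_mk hτ, den_gT, moeb_gT, eT]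
      refine ⟨by simp, mem_z hm (by simp) rfl rfl, form_ext fun y => ?_⟩
      rw [h.hT _ _ _ hm, form_smul, form_wt, form_neg]; simp
    · refine ⟨gTi_Sp, fun τ hτ => ?_⟩
      have hm := H2_of hτ
      rw [eq_mk hτ, den_gTi, moeb_gTi, eTi]
      have hm' : mk (τ 0 0 - 1) (τ 0 1) (τ 1 1) ∈ H2 := mem_z hm (by simp) rfl rfl
      refine ⟨by simp, hm', form_ext fun y => ?_⟩
      have := h.hT _ _ _ hm'
      rw [sub_add_cancel] at this
      rw [form_smul, form_wt, this, form_neg]; simp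
    · refine ⟨gS_Sp, fun τ hτ => ?_⟩
      have hm := H2_of hτ
      rw [eq_mk hτ, den_gS, moeb_gS _ _ _ (mk_ne hm), eS]
      refine ⟨by simpa [Matrix.det_fin_two] using mk_ne hm, gS_mem hm, form_ext fun y => ?_⟩
      rw [h.hS _ _ _ hm, form_smul, form_wt]; simp [Matrix.det_fin_two]
    · refine ⟨gW_Sp, fun τ hτ => ?_⟩
      have hm := H2_of hτ
      rw [eq_mk hτ, den_gW, moeb_gW, eW]
      refine ⟨by simp [Matrix.det_fin_two], mem_sw hm, form_ext fun y => ?_⟩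
      rw [h.hW _ _ _ hm, form_smul, form_wt]; simp
    · refine ⟨gL_Sp, fun τ hτ => ?_⟩
      have hm := H2_of hτ
      rw [eq_mk hτ, den_gL, moeb_gL, eL]
      refine ⟨by simp [Matrix.det_fin_two], L_mem hm, form_ext fun y => ?_⟩
      rw [h.hL _ _ _ hm, form_smul, form_wt]; simp [sub_eq_neg_add]
    · refine ⟨gLi_Sp, fun τ hτ => ?_⟩
      have hm := H2_of hτ
      rw [eq_mk hτ, den_gLi, moeb_gLi, eLi]
      refine ⟨by simp [Matrix.det_fin_two], Li_mem hm, form_ext fun y => ?_⟩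
      have := h.hL _ _ _ (Li_mem hm) 1 (y + 1)
      have e1 : τ 0 1 - τ 0 0 + τ 0 0 = τ 0 1 := by ring
      have e2 : τ 1 1 - 2 * τ 0 1 + τ 0 0 + 2 * (τ 0 1 - τ 0 0) + τ 0 0 = τ 1 1 := by ring
      rw [e1, e2, add_sub_cancel_right] at this
      rw [form_smul, form_wt]
      simp [add_comm 1 y, this]
  · refine ⟨one_Sp, fun τ hτ => ?_⟩
    have e : den 1 τ = 1 := by
      ext i j; fin_cases i <;> fin_cases j <;> simp [den, blk, Matrix.one_apply, Matrix.mul_apply]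
    have e2 : moeb 1 τ = τ := by
      funext i j; rw [moeb, e]
      fin_cases i <;> fin_cases j <;> simp [blk, Matrix.one_apply, Matrix.mul_apply]
    rw [e, e2, one, one_smul]
    refine ⟨by simp, hτ, ?_⟩
    simp [wt, symAct_one]
  · intro γ δ _ _ h1 h2
    exact PP_mul hε h1 h2

lemma Tf_mem {ε : M4 → ℂ} (hε : IsEps ε) {a : Fin 4 → ℂ} (ha : ∑ j, a j ^ 2 = 0) : Tf a ∈ SiegelCusp 24 2 Sp4Z ε := by
  have hl := Tf_law ha
  refine ⟨Tf_diff a, fun γ hγ τ hτ => ((PP_all hε hl hγ).2 τ hτ).2.2, fun γ hγ τ₁ hτ₁ => ?_, fun τ hτ => by rw [Tf, if_neg hτ]⟩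
  have h := (Tf_cusp a hτ₁).const_smul (ε γ)
  rw [smul_zero] at h
  refine h.congr' ?_
  filter_upwards [eventually_gt_atTop 0] with t ht
  have hm : diagH τ₁ (t * I) ∈ H2 := by
    rw [diagH_mk, mk_mem]; simp; exact ⟨hτ₁, by positivity⟩
  obtain ⟨d1, -, d3⟩ := (PP_all hε hl hγ).2 _ hm
  rw [slashS, d3, symAct_smul, wt, symAct_smul, ← symAct_mul, Matrix.nonsing_inv_mul _ (isUnit_iff_ne_zero.2 d1), symAct_one,
    smul_smul, smul_smul]
  congr 1
  have := zpow_ne_zero 2 d1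
  rw [_root_.zpow_neg]
  field_simp
end SG

namespace SG

/-- exponent index -/
def kz (z : VV) : Fin 3 → ℤ := ![dt z.1 z.1 / 4, dt z.1 z.2 / 2, dt z.2 z.2 / 4]

lemma ex_ek {z : VV} (h : wW z ≠ 0) (Z : Fin 3 → ℂ) : ex (2 * Z 0) (2 * Z 1) (2 * Z 2) z = ek (kz z) Z := by
  obtain ⟨k, hk⟩ := dt_cls (wW_ne h).1
  obtain ⟨l, hl⟩ := dt_cls (wW_ne h).2
  obtain ⟨m, hm⟩ := dt_even h
  have e1 : kz z 0 = 2 * k + 1 := by simp only [kz, hk, Matrix.cons_val]; omega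
  have e2 : kz z 1 = m := by simp only [kz, hm, Matrix.cons_val]; omega
  have e3 : kz z 2 = 2 * l + 1 := by simp only [kz, hl, Matrix.cons_val]; omega
  rw [ex, ek, e1, e2, e3, hk, hl, hm]
  congr 1; push_cast; ring

lemma ca_Tf {a : Fin 4 → ℂ} (hl : Law (Tf a)) (i : Fin 25) (k : Fin 3 → ℤ) :
    ca (Tf a) k i = ∑' z : kz ⁻¹' {k}, (Nat.choose 24 i : ℂ) * ci a i z := by
  refine sub_eq_zero.1 (uniq (c := fun k => ca (Tf a) k i - ∑' z : kz ⁻¹' {k}, (Nat.choose 24 i : ℂ) * ci a i z) (fun Z hZ => ?_) k)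
  have hm : mk (2 * Z 0) (2 * Z 1) (2 * Z 2) ∈ H2 := by
    rw [mk_mem]; simp only [dom, Set.mem_ofPred_eq] at hZ; simp; constructor <;> nlinarith [hZ.1, hZ.2]
  have h1 := hl.fe i Z hZ
  have h2 := ((adm_ci a i).hs hm).mul_left (Nat.choose 24 i : ℂ)
  rw [← Tf_mk a hm] at h2
  have h3 := h1.sub (h2.tsum_fiberwise kz)
  rw [sub_self] at h3
  refine hs_congr (fun k => ?_) h3
  rw [sub_mul, ← tsum_mul_right]
  congr 1
  refine tsum_congr fun z => ?_
  have hz : kz z = k := z.2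
  by_cases hw : wW z = 0
  · simp [ci, hw]
  · rw [ex_ek hw, hz, mul_assoc]

def NL : List V4 := [![2,0,0,0],![-2,0,0,0],![0,2,0,0],![0,-2,0,0],![0,0,2,0],![0,0,-2,0],![0,0,0,2],![0,0,0,-2],
  ![1,1,1,1],![1,1,1,-1],![1,1,-1,1],![1,1,-1,-1],![1,-1,1,1],![1,-1,1,-1],![1,-1,-1,1],![1,-1,-1,-1],
  ![-1,1,1,1],![-1,1,1,-1],![-1,1,-1,1],![-1,1,-1,-1],![-1,-1,1,1],![-1,-1,1,-1],![-1,-1,-1,1],![-1,-1,-1,-1]]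

lemma NL_dec : ∀ a b c d : Fin 5, ((a : ℤ) - 2) * (a - 2) + ((b : ℤ) - 2) * (b - 2) + ((c : ℤ) - 2) * (c - 2) + ((d : ℤ) - 2) * (d - 2) = 4 →
    (![(a : ℤ) - 2, (b : ℤ) - 2, (c : ℤ) - 2, (d : ℤ) - 2] : V4) ∈ NL := by decide +kernel

lemma NL_mem {x : V4} (h : dt x x = 4) : x ∈ NL := by
  have h' : x 0 * x 0 + x 1 * x 1 + x 2 * x 2 + x 3 * x 3 = 4 := by rw [← h]; simp [dt, Fin.sum_univ_four]
  have hb : ∀ j, ∃ a : Fin 5, x j = (a : ℤ) - 2 := fun j => by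
    have : x j * x j ≤ 4 := by fin_cases j <;> simp <;> nlinarith [mul_self_nonneg (x 0), mul_self_nonneg (x 1), mul_self_nonneg (x 2), mul_self_nonneg (x 3)]
    have h1 : x j ≤ 2 := by nlinarith
    have h2 : -2 ≤ x j := by nlinarith
    exact ⟨⟨(x j + 2).toNat, by omega⟩, by simp; omega⟩
  obtain ⟨a, ha⟩ := hb 0
  obtain ⟨b, hb1⟩ := hb 1
  obtain ⟨c, hc⟩ := hb 2
  obtain ⟨d, hd⟩ := hb 3
  have e : x = ![(a : ℤ) - 2, (b : ℤ) - 2, (c : ℤ) - 2, (d : ℤ) - 2] := by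
    funext j; fin_cases j
    · exact ha
    · exact hb1
    · exact hc
    · exact hd
  rw [e]
  rw [ha, hb1, hc, hd] at h'
  exact NL_dec a b c d h'

def NS : Finset VV := (NL.toFinset ×ˢ NL.toFinset).filter fun z => dt z.1 z.1 = 4 ∧ dt z.1 z.2 = 2 ∧ dt z.2 z.2 = 4

lemma ca_fin {a : Fin 4 → ℂ} (hl : Law (Tf a)) (i : Fin 25) :
    ca (Tf a) ![1, 1, 1] i = (Nat.choose 24 i : ℂ) * ∑ z ∈ NS, ci a i z := by
  rw [ca_Tf hl, tsum_subtype (kz ⁻¹' {![1, 1, 1]}) (fun z => (Nat.choose 24 i : ℂ) * ci a i z),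
    tsum_eq_sum (s := NS), Finset.mul_sum]
  · refine Finset.sum_congr rfl fun z hz => ?_
    rw [Set.indicator_of_mem]
    simp only [NS, Finset.mem_filter] at hz
    obtain ⟨-, h1, h2, h3⟩ := hz
    simp [kz, h1, h2, h3]
  · intro z hz
    by_cases hw : wW z = 0
    · refine Set.indicator_apply_eq_zero.2 fun _ => by simp [ci, hw]
    · rw [Set.indicator_of_notMem]
      intro hk
      apply hz
      obtain ⟨k, hk1⟩ := dt_cls (wW_ne hw).1
      obtain ⟨l, hl1⟩ := dt_cls (wW_ne hw).2
      obtain ⟨m, hm⟩ := dt_even hw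
      have hk : kz z = ![1, 1, 1] := hk
      have e0 : dt z.1 z.1 / 4 = 1 := congrFun hk 0
      have e1 : dt z.1 z.2 / 2 = 1 := congrFun hk 1
      have e2 : dt z.2 z.2 / 4 = 1 := congrFun hk 2
      have f0 : dt z.1 z.1 = 4 := by omega
      have f1 : dt z.1 z.2 = 2 := by omega
      have f2 : dt z.2 z.2 = 4 := by omega
      simp only [NS, Finset.mem_filter, Finset.mem_product, List.mem_toFinset]
      exact ⟨⟨NL_mem f0, NL_mem f2⟩, f0, f1, f2⟩

def adg (α : Fin 4 → GaussianInt) (x : V4) : GaussianInt := α 0 * x 0 + α 1 * x 1 + α 2 * x 2 + α 3 * x 3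
def sg (α : Fin 4 → GaussianInt) (i : ℕ) : GaussianInt := ∑ z ∈ NS, (wW z : GaussianInt) * (adg α z.1 ^ (24 - i) * adg α z.2 ^ i)

lemma sg_eq (α : Fin 4 → GaussianInt) (i : ℕ) :
    ∑ z ∈ NS, ci (fun j => GaussianInt.toComplex (α j)) i z = GaussianInt.toComplex (sg α i) := by
  rw [sg, map_sum]
  refine Finset.sum_congr rfl fun z _ => ?_
  have : ∀ x, ad (fun j => GaussianInt.toComplex (α j)) x = GaussianInt.toComplex (adg α x) := fun x => by
    simp [ad, adg, Fin.sum_univ_four]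
  rw [ci, this, this]
  simp

def α1 : Fin 4 → GaussianInt := ![1, 2, 2, ⟨0, 3⟩]
def α2 : Fin 4 → GaussianInt := ![1, ⟨0, 1⟩, 2, ⟨0, 2⟩]

lemma sg1 : sg α1 21 = ⟨0, -40842184835255500800⟩ ∧ sg α1 17 = ⟨0, 63265897144280678400⟩ := by decide +kernel
lemma sg2 : sg α2 21 = ⟨-2886960100147200, 0⟩ ∧ sg α2 17 = ⟨4931314620825600, 0⟩ := by decide +kernel

def a1 : Fin 4 → ℂ := fun j => GaussianInt.toComplex (α1 j)
def a2 : Fin 4 → ℂ := fun j => GaussianInt.toComplex (α2 j)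

lemma iso {α : Fin 4 → GaussianInt} (h : ∑ j, α j ^ 2 = 0) : ∑ j, (GaussianInt.toComplex (α j)) ^ 2 = 0 := by
  have := congrArg GaussianInt.toComplex h
  simpa using this
lemma iso1 : ∑ j, a1 j ^ 2 = 0 := iso (by decide +kernel)
lemma iso2 : ∑ j, a2 j ^ 2 = 0 := iso (by decide +kernel)

lemma vals : ca (Tf a1) ![1,1,1] 21 = (Nat.choose 24 21 : ℂ) * (-40842184835255500800 * I) ∧
    ca (Tf a1) ![1,1,1] 17 = (Nat.choose 24 17 : ℂ) * (63265897144280678400 * I) ∧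
    ca (Tf a2) ![1,1,1] 21 = (Nat.choose 24 21 : ℂ) * (-2886960100147200) ∧
    ca (Tf a2) ![1,1,1] 17 = (Nat.choose 24 17 : ℂ) * 4931314620825600 := by
  have h1 := ca_fin (Tf_law iso1)
  have h2 := ca_fin (Tf_law iso2)
  have e21 : ((21 : Fin 25) : ℕ) = 21 := rfl
  have e17 : ((17 : Fin 25) : ℕ) = 17 := rfl
  refine ⟨(h1 21).trans ?_, (h1 17).trans ?_, (h2 21).trans ?_, (h2 17).trans ?_⟩
  · rw [e21, show ∑ z ∈ NS, ci a1 21 z = _ from sg_eq α1 21, sg1.1]; simp [GaussianInt.toComplex_def]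
  · rw [e17, show ∑ z ∈ NS, ci a1 17 z = _ from sg_eq α1 17, sg1.2]; simp [GaussianInt.toComplex_def]
  · rw [e21, show ∑ z ∈ NS, ci a2 21 z = _ from sg_eq α2 21, sg2.1]; simp [GaussianInt.toComplex_def]
  · rw [e17, show ∑ z ∈ NS, ci a2 17 z = _ from sg_eq α2 17, sg2.2]; simp [GaussianInt.toComplex_def]
end SG

namespace SG

lemma dom_H2 {Z : Fin 3 → ℂ} (hZ : Z ∈ dom) : mk (2 * Z 0) (2 * Z 1) (2 * Z 2) ∈ H2 := by
  rw [mk_mem]; simp only [dom, Set.mem_ofPred_eq] at hZ; simp; constructor <;> nlinarith [hZ.1, hZ.2]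

lemma ca_add {F G : MM → Fin 25 → ℂ} (hF : Law F) (hG : Law G) (h : Law (F + G)) (k i) :
    ca (F + G) k i = ca F k i + ca G k i := by
  refine sub_eq_zero.1 (uniq (c := fun k => ca (F + G) k i - (ca F k i + ca G k i)) (fun Z hZ => ?_) k)
  have := (h.fe i Z hZ).sub ((hF.fe i Z hZ).add (hG.fe i Z hZ))
  rw [Pi.add_apply, Pi.add_apply, sub_self] at this
  exact hs_congr (fun k => by ring) this

lemma ca_smul {F : MM → Fin 25 → ℂ} (c : ℂ) (hF : Law F) (h : Law (c • F)) (k i) :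
    ca (c • F) k i = c * ca F k i := by
  refine sub_eq_zero.1 (uniq (c := fun k => ca (c • F) k i - c * ca F k i) (fun Z hZ => ?_) k)
  have := (h.fe i Z hZ).sub ((hF.fe i Z hZ).mul_left c)
  rw [Pi.smul_apply, Pi.smul_apply, smul_eq_mul, sub_self] at this
  exact hs_congr (fun k => by ring) this

lemma zero_of {F : MM → Fin 25 → ℂ} (h : Law F) (h0 : ∀ k, ca F k = 0) {τ : MM} (hτ : τ ∈ H2) : F τ = 0 := by
  have hm := H2_of hτ
  rw [eq_mk hτ]
  funext i
  let Z : Fin 3 → ℂ := ![τ 0 0 / 2, τ 0 1 / 2, τ 1 1 / 2]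
  have hZ : Z ∈ dom := by
    rw [mk_mem] at hm
    simp only [dom, Set.mem_ofPred_eq, Z]
    simp
    constructor <;> nlinarith [hm.1, hm.2]
  have h1 := h.fe i Z hZ
  have e0 : 2 * Z 0 = τ 0 0 := by simp [Z]; ring
  have e1 : 2 * Z 1 = τ 0 1 := by simp [Z]; ring
  have e2 : 2 * Z 2 = τ 1 1 := by simp [Z]; ring
  rw [e0, e1, e2] at h1
  have h2 : HasSum (fun k => ca F k i * ek k Z) 0 := hs_congr (fun k => by simp [h0]) (hasSum_zero (α := ℂ))
  exact h1.unique h2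

def Lfn {ε : M4 → ℂ} (hε : IsEps ε) : ↥(SiegelCusp 24 2 Sp4Z ε) →ₗ[ℂ] (Fin 2 → ℂ) where
  toFun F := ![ca F.1 ![1,1,1] 21, ca F.1 ![1,1,1] 17]
  map_add' F G := by
    have h := fun i => ca_add (law_of hε F.2) (law_of hε G.2) (law_of hε (F + G).2) ![1,1,1] i
    have h1 := h 21
    have h2 := h 17
    funext j; fin_cases j
    · exact h1
    · exact h2
  map_smul' c F := by
    have h := fun i => ca_smul c (law_of hε F.2) (law_of hε (c • F).2) ![1,1,1] i
    have h1 := h 21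
    have h2 := h 17
    funext j; fin_cases j
    · exact h1
    · exact h2

lemma Lfn_inj {ε : M4 → ℂ} (hε : IsEps ε) : Function.Injective (Lfn hε) := by
  rw [← LinearMap.ker_eq_bot, LinearMap.ker_eq_bot']
  intro F hF
  have hl := law_of hε F.2
  have h1 : ca F.1 ![1,1,1] 21 = 0 := congrFun hF 0
  have h2 : ca F.1 ![1,1,1] 17 = 0 := congrFun hF 1
  have h0 : ∀ k, ca F.1 k = 0 := fun k => by
    have e : k = ![k 0, k 1, k 2] := by funext j; fin_cases j <;> rfl
    rw [e]; exact hl.main h1 h2 _ _ _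
  apply Subtype.ext
  funext τ
  by_cases hτ : τ ∈ H2
  · exact zero_of hl h0 hτ
  · exact F.2.2.2.2 τ hτ

lemma Lfn_surj {ε : M4 → ℂ} (hε : IsEps ε) : Function.Surjective (Lfn hε) := by
  intro v
  obtain ⟨v1, v2, v3, v4⟩ := vals
  let F1 : ↥(SiegelCusp 24 2 Sp4Z ε) := ⟨Tf a1, Tf_mem hε iso1⟩
  let F2 : ↥(SiegelCusp 24 2 Sp4Z ε) := ⟨Tf a2, Tf_mem hε iso2⟩
  have c21 : ((Nat.choose 24 21 : ℕ) : ℂ) = 2024 := by norm_num [Nat.choose]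
  have c17 : ((Nat.choose 24 17 : ℕ) : ℂ) = 346104 := by norm_num [Nat.choose]
  rw [c21] at v1 v3
  rw [c17] at v2 v4
  let A : ℂ := -40842184835255500800
  let B : ℂ := 63265897144280678400
  let C : ℂ := -2886960100147200
  let D : ℂ := 4931314620825600
  have hD : A * D - B * C ≠ 0 := by norm_num [A, B, C, D]
  let x := v 0 / 2024
  let y := v 1 / 346104
  refine ⟨(-I * ((x * D - y * C) / (A * D - B * C))) • F1 + ((A * y - B * x) / (A * D - B * C)) • F2, ?_⟩
  rw [map_add, map_smul, map_smul]
  have hI : I * I = -1 := Complex.I_mul_I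
  have w1 : Lfn hε F1 = ![2024 * (A * I), 346104 * (B * I)] := by
    funext j; fin_cases j
    · exact v1
    · exact v2
  have w2 : Lfn hε F2 = ![2024 * C, 346104 * D] := by
    funext j; fin_cases j
    · exact v3
    · exact v4
  rw [w1, w2]
  have hx : v 0 = 2024 * x := by simp only [x]; ring
  have hy : v 1 = 346104 * y := by simp only [y]; ring
  clear_value A B C D x y
  have hu := mul_inv_cancel₀ hD
  have g0 : -I * ((x * D - y * C) / (A * D - B * C)) * (2024 * (A * I)) + (A * y - B * x) / (A * D - B * C) * (2024 * C) = v 0 := by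
    rw [hx, div_eq_mul_inv, div_eq_mul_inv]
    generalize (A * D - B * C)⁻¹ = u at *
    linear_combination (-(2024 * A * (x * D - y * C) * u)) * hI + 2024 * x * hu
  have g1 : -I * ((x * D - y * C) / (A * D - B * C)) * (346104 * (B * I)) + (A * y - B * x) / (A * D - B * C) * (346104 * D) = v 1 := by
    rw [hy, div_eq_mul_inv, div_eq_mul_inv]
    generalize (A * D - B * C)⁻¹ = u at *
    linear_combination (-(346104 * B * (x * D - y * C) * u)) * hI + 346104 * y * hu
  funext j; fin_cases j
  · exact g0
  · exact g1

end SG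

/-- The space `S_{24,2}(Γ₂,ε)` has dimension 2 over `ℂ`. -/
theorem dim_S24_2_eps (ε : Matrix (Fin 4) (Fin 4) ℤ → ℂ) (hε : IsEps ε) :
    Module.finrank ℂ ↥(SiegelCusp 24 2 Sp4Z ε) = 2 := by
  rw [(LinearEquiv.ofBijective (SG.Lfn hε) ⟨SG.Lfn_inj hε, SG.Lfn_surj hε⟩).finrank_eq]
  simp
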